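/- For every real c > 1/4 there exist infinitely many pairwise distinct functions φ : ℝ → ℝ, each infinitely differentiable, even (φ(−z) = φ(z) for all z), not identically zero, satisfying φ⁗(z) − φ″(z) + c·φ(z) = φ(z)² for all z ∈ ℝ, and each decaying exponentially as |z| → ∞ (for each such φ there exist C > 0, κ > 0 with |φ(z)| ≤ C·e^{−κ|z|} for all z). Equivalently, there is an injective sequence n ↦ φₙ of such solutions. -/

import Mathlib

open Real Filter


namespace Pulse
open Set Topology




/-! ### Global existence for globally Lipschitz C1 fields -/

theorem global_exist {E : Type*} [NormedAddCommGroup E] [NormedSpace ℝ E] [CompleteSpace E]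
    (G : E → E) (hG : ContDiff ℝ 1 G) (K : NNReal) (hK0 : 0 < K) (hK : LipschitzWith K G) (x : E) :
    ∃ γ : ℝ → E, γ 0 = x ∧ ∀ t, HasDerivAt γ (G (γ t)) t := by
  have key := exists_isMIntegralCurve_of_isMIntegralCurveOn (I := modelWithCornersSelf ℝ E) (M := E)
    (v := G)
    (by
      intro y
      exact contMDiffAt_vectorSpace_iff_contDiffAt.2 hG.contDiffAt)
    (ε := 1 / (2 * K)) (by positivity) ?_ x
  · obtain ⟨γ, h0, h⟩ := key
    refine ⟨γ, h0, fun t => ?_⟩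
    have := (h t).hasFDerivAt
    have h2 : HasFDerivAt γ (ContinuousLinearMap.smulRight (1 : ℝ →L[ℝ] ℝ) (G (γ t)) : ℝ →L[ℝ] E) t :=
      this
    simpa using h2.hasDerivAt
  · intro y
    have hpos : (0 : ℝ) < 1 / (2 * K) := by positivity
    let t₀ : Icc (-(1 / (2 * (K : ℝ)))) (1 / (2 * K)) := ⟨0, by constructor <;> linarith⟩
    have hPL : IsPicardLindelof (fun _ => G) t₀ y (‖G y‖₊ / K + 1) 0
        (‖G y‖₊ + K * (‖G y‖₊ / K + 1)) K := by
      constructor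
      · intro t _
        exact hK.lipschitzOnWith
      · intro z _
        exact continuousOn_const
      · intro t _ z hz
        have h1 := hK.dist_le_mul z y
        have h2 : dist z y ≤ (‖G y‖₊ / K + 1 : NNReal) := by simpa using hz
        have h3 : ‖G z‖ ≤ ‖G y‖ + dist (G z) (G y) := by
          rw [dist_eq_norm]
          have := norm_add_le (G y) (G z - G y)
          simpa using this
        have h4 : (K : ℝ) * dist z y ≤ K * ((‖G y‖₊ / K + 1 : NNReal) : ℝ) := by gcongr
        push_cast at h2 h4 ⊢
        linarith
      · simp only [t₀, sub_zero, zero_sub, neg_neg, max_self]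
        push_cast
        simp only [sub_zero]
        have hk : (0 : ℝ) < K := by exact_mod_cast hK0
        have hn := norm_nonneg (G y)
        rw [mul_one_div, div_le_iff₀ (by positivity)]
        field_simp
        nlinarith
    obtain ⟨α, h0, h⟩ := hPL.exists_eq_forall_mem_Icc_hasDerivWithinAt₀
    refine ⟨α, h0, fun t ht => ?_⟩
    have h1 := (h t ⟨ht.1.le, ht.2.le⟩).mono Ioo_subset_Icc_self
    have h2 := h1.hasFDerivWithinAt.hasMFDerivWithinAt
    exact h2

/-- transport of a derivative along pointwise equalities -/
theorem hd_cg {f g : ℝ → ℝ} {f' g' x : ℝ} (h : HasDerivAt f f' x) (hg : ∀ y, g y = f y)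
    (h' : g' = f') : HasDerivAt g g' x := by
  have : g = f := funext hg
  rw [this, h']
  exact h

/-! ### The truncated nonlinearity -/

theorem hasDerivAt_max_sq (x : ℝ) : HasDerivAt (fun y : ℝ => (max y 0) ^ 2) (2 * max x 0) x := by
  rcases lt_trichotomy x 0 with h | h | h
  · rw [max_eq_right h.le]
    have : (fun y : ℝ => (max y 0) ^ 2) =ᶠ[𝓝 x] fun _ => 0 := by
      filter_upwards [gt_mem_nhds h] with y hy
      simp [max_eq_right (le_of_lt hy)]
    simpa using (hasDerivAt_const x (0 : ℝ)).congr_of_eventuallyEq this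
  · subst h
    simp only [max_self, mul_zero]
    rw [hasDerivAt_iff_isLittleO_nhds_zero]
    simp only [zero_add, max_self, smul_eq_mul, mul_zero, sub_zero]
    have : (fun y : ℝ => (max y 0) ^ 2 - 0 ^ 2) =O[𝓝 0] fun y : ℝ => y ^ 2 := by
      apply Asymptotics.IsBigO.of_bound 1
      filter_upwards with y
      simp only [one_mul]
      rw [Real.norm_eq_abs, Real.norm_eq_abs, abs_of_nonneg (a := y ^ 2) (by positivity),
        zero_pow two_ne_zero, sub_zero, abs_of_nonneg (sq_nonneg _)]
      rcases le_total y 0 with hy | hy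
      · rw [max_eq_right hy]; nlinarith
      · rw [max_eq_left hy]
    refine this.trans_isLittleO ?_
    have := Asymptotics.isLittleO_pow_id (𝕜 := ℝ) (n := 2) (by norm_num)
    exact this
  · rw [max_eq_left h.le]
    have : (fun y : ℝ => (max y 0) ^ 2) =ᶠ[𝓝 x] fun y => y ^ 2 := by
      filter_upwards [lt_mem_nhds h] with y hy
      rw [max_eq_left (le_of_lt hy)]
    have h2 := (hasDerivAt_pow 2 x).congr_of_eventuallyEq this
    simpa using h2

theorem hasDerivAt_max_cube (x : ℝ) :
    HasDerivAt (fun y : ℝ => (max y 0) ^ 3 / 3) ((max x 0) ^ 2) x := by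
  have h1 : (fun y : ℝ => (max y 0) ^ 3 / 3) = fun y => y * (max y 0) ^ 2 / 3 := by
    funext y
    rcases le_total y 0 with hy | hy
    · rw [max_eq_right hy]; ring
    · rw [max_eq_left hy]; ring
  rw [h1]
  have h2 := ((hasDerivAt_id x).mul (hasDerivAt_max_sq x)).div_const 3
  refine hd_cg h2 (fun y => by simp) ?_
  simp only [id]
  rcases le_total x 0 with hy | hy
  · rw [max_eq_right hy]; ring
  · rw [max_eq_left hy]; ring

noncomputable def ff (v : ℝ) : ℝ := v ^ 2 - v - (max (v - 2) 0) ^ 2 - (max (-1 - v) 0) ^ 2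

noncomputable def FF (v : ℝ) : ℝ :=
  v ^ 3 / 3 - v ^ 2 / 2 - (max (v - 2) 0) ^ 3 / 3 + (max (-1 - v) 0) ^ 3 / 3

noncomputable def dff (v : ℝ) : ℝ := 2 * v - 1 - 2 * max (v - 2) 0 + 2 * max (-1 - v) 0

theorem hasDerivAt_ff (v : ℝ) : HasDerivAt ff (dff v) v := by
  have h1 := (hasDerivAt_max_sq (v - 2)).comp v ((hasDerivAt_id v).sub_const 2)
  have h2 := (hasDerivAt_max_sq (-1 - v)).comp v ((hasDerivAt_id v).const_sub (-1))
  have h3 := (((hasDerivAt_pow 2 v).sub (hasDerivAt_id v)).sub h1).sub h2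
  refine hd_cg h3 (fun y => by simp [ff]) ?_
  simp [dff]

theorem hasDerivAt_FF (v : ℝ) : HasDerivAt FF (ff v) v := by
  have h1 := (hasDerivAt_max_cube (v - 2)).comp v ((hasDerivAt_id v).sub_const 2)
  have h2 := (hasDerivAt_max_cube (-1 - v)).comp v ((hasDerivAt_id v).const_sub (-1))
  have h3 := ((((hasDerivAt_pow 3 v).div_const 3).sub ((hasDerivAt_pow 2 v).div_const 2)).sub h1).add h2
  refine hd_cg h3 (fun y => by simp [FF]) ?_
  simp [ff]
  ring

theorem ff_cont : Continuous ff := by unfold ff; fun_prop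

theorem FF_cont : Continuous FF := by unfold FF; fun_prop

theorem ff_contDiff : ContDiff ℝ 1 ff := by
  rw [contDiff_one_iff_deriv]
  refine ⟨fun v => (hasDerivAt_ff v).differentiableAt, ?_⟩
  have : deriv ff = dff := funext fun v => (hasDerivAt_ff v).deriv
  rw [this]
  unfold dff
  fun_prop

theorem ff_mid {v : ℝ} (h1 : -1 ≤ v) (h2 : v ≤ 2) : ff v = v ^ 2 - v := by
  unfold ff
  rw [max_eq_right (by linarith), max_eq_right (by linarith)]; ring

theorem ff_lo {v : ℝ} (h1 : v ≤ -1) : ff v = -3 * v - 1 := by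
  unfold ff
  rw [max_eq_right (by linarith), max_eq_left (by linarith)]; ring

theorem ff_hi {v : ℝ} (h1 : 2 ≤ v) : ff v = 3 * v - 4 := by
  unfold ff
  rw [max_eq_left (by linarith), max_eq_right (by linarith)]; ring

theorem FF_mid {v : ℝ} (h1 : -1 ≤ v) (h2 : v ≤ 2) : FF v = v ^ 3 / 3 - v ^ 2 / 2 := by
  unfold FF
  rw [max_eq_right (by linarith), max_eq_right (by linarith)]; ring

theorem FF_lo {v : ℝ} (h1 : v ≤ -1) : FF v = -3 / 2 * v ^ 2 - v - 1 / 3 := by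
  unfold FF
  rw [max_eq_right (by linarith), max_eq_left (by linarith)]; ring

theorem FF_hi {v : ℝ} (h1 : 2 ≤ v) : FF v = 3 / 2 * v ^ 2 - 4 * v + 8 / 3 := by
  unfold FF
  rw [max_eq_left (by linarith), max_eq_right (by linarith)]; ring

theorem ff_cases (v : ℝ) : (v ≤ -1 ∧ ff v = -3 * v - 1 ∧ FF v = -3 / 2 * v ^ 2 - v - 1 / 3) ∨
    (-1 ≤ v ∧ v ≤ 2 ∧ ff v = v ^ 2 - v ∧ FF v = v ^ 3 / 3 - v ^ 2 / 2) ∨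
    (2 ≤ v ∧ ff v = 3 * v - 4 ∧ FF v = 3 / 2 * v ^ 2 - 4 * v + 8 / 3) := by
  rcases le_total v (-1) with h | h
  · exact Or.inl ⟨h, ff_lo h, FF_lo h⟩
  · rcases le_total v 2 with h' | h'
    · exact Or.inr (Or.inl ⟨h, h', ff_mid h h', FF_mid h h'⟩)
    · exact Or.inr (Or.inr ⟨h', ff_hi h', FF_hi h'⟩)

theorem dff_abs (v : ℝ) : |dff v| ≤ 3 := by
  unfold dff
  rw [abs_le]
  rcases le_total (v - 2) 0 with h | h <;> rcases le_total (-1 - v) 0 with h' | h' <;>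
    simp only [max_eq_left, max_eq_right, h, h'] <;> constructor <;> linarith

theorem ff_lip : LipschitzWith 3 ff := by
  apply lipschitzWith_of_nnnorm_deriv_le (fun v => (hasDerivAt_ff v).differentiableAt)
  intro v
  rw [(hasDerivAt_ff v).deriv]
  have := dff_abs v
  rw [← NNReal.coe_le_coe]
  simpa using this

theorem ff_lip' (u w : ℝ) : |ff u - ff w| ≤ 3 * |u - w| := by
  simpa [Real.dist_eq] using ff_lip.dist_le_mul u w

theorem ff_zero : ff 0 = 0 := by rw [ff_mid] <;> norm_num
theorem FF_zero : FF 0 = 0 := by rw [FF_mid] <;> norm_num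

theorem ff_abs (v : ℝ) : |ff v| ≤ 3 * |v| := by
  simpa [ff_zero] using ff_lip' v 0

theorem ff_ge (v : ℝ) : -v ≤ ff v := by
  rcases ff_cases v with ⟨h, h1, _⟩ | ⟨h, h', h1, _⟩ | ⟨h, h1, _⟩ <;> rw [h1] <;> nlinarith

theorem ff_ge' (v : ℝ) : -1 / 4 ≤ ff v := by
  rcases ff_cases v with ⟨h, h1, _⟩ | ⟨h, h', h1, _⟩ | ⟨h, h1, _⟩ <;> rw [h1] <;>
    nlinarith [sq_nonneg (v - 1 / 2)]

theorem ff_pos_neg {v : ℝ} (hv : v < 0) : 0 < ff v := by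
  rcases ff_cases v with ⟨h, h1, _⟩ | ⟨h, h', h1, _⟩ | ⟨h, h1, _⟩ <;> rw [h1] <;> nlinarith

theorem ff_nonneg_ge {v : ℝ} (hv : 1 ≤ v) : 0 ≤ ff v := by
  rcases ff_cases v with ⟨h, h1, _⟩ | ⟨h, h', h1, _⟩ | ⟨h, h1, _⟩ <;> rw [h1] <;> nlinarith

theorem ff_nonpos {v : ℝ} (h0 : 0 ≤ v) (hv : v ≤ 1) : ff v ≤ 0 := by
  rw [ff_mid (by linarith) (by linarith)]; nlinarith

theorem v_ff_nonpos {v : ℝ} (hv : v ≤ 1) : v * ff v ≤ 0 := by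
  rcases le_total v 0 with h | h
  · rcases h.lt_or_eq with h | h
    · nlinarith [ff_pos_neg h]
    · rw [h]; simp
  · nlinarith [ff_nonpos h hv]

theorem ff_eq_zero {v : ℝ} (h : ff v = 0) : v = 0 ∨ v = 1 := by
  rcases ff_cases v with ⟨h', h1, _⟩ | ⟨h', h'', h1, _⟩ | ⟨h', h1, _⟩
  · linarith
  · have : v * (v - 1) = 0 := by nlinarith
    rcases mul_eq_zero.1 this with h | h
    · exact Or.inl h
    · right; linarith
  · linarith

/-- sign of FF -/
theorem FF_neg_of_neg {v : ℝ} (hv : v < 0) : FF v < 0 := by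
  rcases ff_cases v with ⟨h, _, h1⟩ | ⟨h, h', _, h1⟩ | ⟨h, _, h1⟩ <;> rw [h1] <;>
    nlinarith [mul_pos_of_neg_of_neg hv hv, sq_nonneg v]

theorem FF_neg {v : ℝ} (h0 : v ≠ 0) (hv : v < 3 / 2) : FF v < 0 := by
  rcases lt_or_gt_of_ne h0 with h | h
  · exact FF_neg_of_neg h
  · rw [FF_mid (by linarith) (by linarith)]
    have : 0 < v ^ 2 * (3 / 2 - v) := by
      have : 0 < 3 / 2 - v := by linarith
      positivity
    nlinarith

theorem FF_pos {v : ℝ} (hv : 3 / 2 < v) : 0 < FF v := by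
  rcases ff_cases v with ⟨h, _, h1⟩ | ⟨h, h', _, h1⟩ | ⟨h, _, h1⟩
  · linarith
  · rw [h1]
    have : 0 < v ^ 2 * (v - 3 / 2) := by
      have : 0 < v - 3 / 2 := by linarith
      positivity
    nlinarith
  · rw [h1]; nlinarith

theorem FF_le {v : ℝ} (hv : v ≤ -(3 / 5)) : FF v ≤ -(1 / 4) := by
  rcases ff_cases v with ⟨h, _, h1⟩ | ⟨h, h', _, h1⟩ | ⟨h, _, h1⟩
  · rw [h1]; nlinarith
  · rw [h1]; nlinarith [mul_nonneg (show 0 ≤ v + 1 by linarith) (show 0 ≤ -(3/5) - v by linarith), sq_nonneg v,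
      mul_nonneg (mul_nonneg (show 0 ≤ v + 1 by linarith) (show 0 ≤ -(3/5) - v by linarith)) (show 0 ≤ -v by linarith)]
  · linarith

theorem FF_eq_zero {v : ℝ} (h : FF v = 0) : v = 0 ∨ v = 3 / 2 := by
  by_contra hh
  push Not at hh
  rcases lt_trichotomy v (3 / 2) with h1 | h1 | h1
  · exact absurd h (FF_neg hh.1 h1).ne
  · exact hh.2 h1
  · exact absurd h (FF_pos h1).ne'

theorem FF_ge (v : ℝ) : -2 * v ^ 2 ≤ FF v := by
  rcases ff_cases v with ⟨h, _, h1⟩ | ⟨h, h', _, h1⟩ | ⟨h, _, h1⟩ <;> rw [h1]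
  · nlinarith
  · nlinarith [mul_nonneg (sq_nonneg v) (show 0 ≤ v + 1 by linarith)]
  · nlinarith




/-! ### Elementary calculus helpers -/

theorem mono_le {f f' : ℝ → ℝ} (h : ∀ t, HasDerivAt f (f' t) t) {a b : ℝ} (hab : a ≤ b)
    (hp : ∀ t ∈ Ioo a b, 0 ≤ f' t) : f a ≤ f b := by
  rcases hab.eq_or_lt with rfl | hab
  · exact le_rfl
  obtain ⟨c, hc, hc'⟩ := exists_hasDerivAt_eq_slope f f' hab
    (fun t _ => (h t).continuousAt.continuousWithinAt) (fun t _ => h t)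
  have h1 := hp c hc
  rw [hc'] at h1
  have : 0 < b - a := by linarith
  rw [le_div_iff₀ this] at h1
  linarith

theorem mono_lt {f f' : ℝ → ℝ} (h : ∀ t, HasDerivAt f (f' t) t) {a b : ℝ} (hab : a < b)
    (hp : ∀ t ∈ Ioo a b, 0 < f' t) : f a < f b := by
  obtain ⟨c, hc, hc'⟩ := exists_hasDerivAt_eq_slope f f' hab
    (fun t _ => (h t).continuousAt.continuousWithinAt) (fun t _ => h t)
  have h1 := hp c hc
  rw [hc'] at h1
  have : 0 < b - a := by linarith
  rw [lt_div_iff₀ this] at h1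
  linarith

theorem anti_le {f f' : ℝ → ℝ} (h : ∀ t, HasDerivAt f (f' t) t) {a b : ℝ} (hab : a ≤ b)
    (hp : ∀ t ∈ Ioo a b, f' t ≤ 0) : f b ≤ f a := by
  have := mono_le (f := fun t => - f t) (f' := fun t => - f' t) (fun t => (h t).neg) hab
    (fun t ht => by linarith [hp t ht])
  linarith

theorem anti_lt {f f' : ℝ → ℝ} (h : ∀ t, HasDerivAt f (f' t) t) {a b : ℝ} (hab : a < b)
    (hp : ∀ t ∈ Ioo a b, f' t < 0) : f b < f a := by
  have := mono_lt (f := fun t => - f t) (f' := fun t => - f' t) (fun t => (h t).neg) hab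
    (fun t ht => by linarith [hp t ht])
  linarith

/-- increments: if `m ≤ deriv f` on the interval then `m (b-a) ≤ f b - f a`. -/
theorem incr_ge {f f' : ℝ → ℝ} (h : ∀ t, HasDerivAt f (f' t) t) {a b m : ℝ} (hab : a ≤ b)
    (hp : ∀ t ∈ Ioo a b, m ≤ f' t) : m * (b - a) ≤ f b - f a := by
  have := mono_le (f := fun t => f t - m * t) (f' := fun t => f' t - m * 1)
    (fun t => (h t).sub ((hasDerivAt_id t).const_mul m)) hab
    (fun t ht => by linarith [hp t ht])
  linarith

theorem incr_le {f f' : ℝ → ℝ} (h : ∀ t, HasDerivAt f (f' t) t) {a b m : ℝ} (hab : a ≤ b)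
    (hp : ∀ t ∈ Ioo a b, f' t ≤ m) : f b - f a ≤ m * (b - a) := by
  have := anti_le (f := fun t => f t - m * t) (f' := fun t => f' t - m * 1)
    (fun t => (h t).sub ((hasDerivAt_id t).const_mul m)) hab
    (fun t ht => by linarith [hp t ht])
  linarith

theorem cont_of {f f' : ℝ → ℝ} (h : ∀ t, HasDerivAt f (f' t) t) : Continuous f :=
  continuous_iff_continuousAt.2 fun t => (h t).continuousAt

theorem gron {f f' : ℝ → ℝ} (h : ∀ t, HasDerivAt f (f' t) t) {C a b : ℝ} (hab : a ≤ b)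
    (hp : ∀ t ∈ Ioo a b, f' t ≤ C * f t) : f b ≤ f a * exp (C * (b - a)) := by
  have h1 := anti_le (f := fun t => f t * exp (-C * t))
    (f' := fun t => f' t * exp (-C * t) + f t * (exp (-C * t) * (-C * 1)))
    (fun t => (h t).mul ((hasDerivAt_exp _).comp t ((hasDerivAt_id t).const_mul (-C)))) hab
    (fun t ht => by
      have h2 := hp t ht
      have h3 := exp_pos (-C * t)
      nlinarith)
  have h4 : f b * exp (-C * b) * exp (C * b) ≤ f a * exp (-C * a) * exp (C * b) := by
    gcongr
  rw [mul_assoc, mul_assoc, ← exp_add, ← exp_add] at h4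
  ring_nf at h4
  simp only [exp_zero, mul_one] at h4
  ring_nf
  convert h4 using 3

/-- First zero lemma. -/
theorem first_zero {g : ℝ → ℝ} (hg : Continuous g) {z w : ℝ} (hzw : z ≤ w) (hz : g z < 0)
    (hw : 0 ≤ g w) : ∃ t, z < t ∧ t ≤ w ∧ g t = 0 ∧ ∀ s ∈ Ico z t, g s < 0 := by
  let S := Icc z w ∩ g ⁻¹' Ici 0
  have hS : IsCompact S := isCompact_Icc.inter_right (isClosed_Ici.preimage hg)
  have hne : S.Nonempty := ⟨w, ⟨hzw, le_rfl⟩, hw⟩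
  obtain ⟨t, ht, hmin⟩ := hS.exists_isLeast hne
  have hlt : ∀ s ∈ Ico z t, g s < 0 := by
    intro s hs
    by_contra hc
    have : t ≤ s := hmin ⟨⟨hs.1, hs.2.le.trans ht.1.2⟩, not_lt.1 hc⟩
    linarith [hs.2]
  have hzt : z < t := by
    rcases ht.1.1.lt_or_eq with h | h
    · exact h
    · exfalso
      have : 0 ≤ g t := ht.2
      rw [← h] at this
      linarith
  refine ⟨t, hzt, ht.1.2, ?_, hlt⟩
  apply le_antisymm _ ht.2
  have hmem : t ∈ closure (Ico z t) := by
    rw [closure_Ico hzt.ne]; exact ⟨hzt.le, le_rfl⟩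
  exact (isClosed_Iic.preimage hg).closure_subset_iff.2 (fun s hs => (hlt s hs).le) hmem

/-! ### Curves and solutions -/

@[ext] structure Cur where
  v0 : ℝ → ℝ
  v1 : ℝ → ℝ
  v2 : ℝ → ℝ
  v3 : ℝ → ℝ
  d0 : ∀ t, HasDerivAt v0 (v1 t) t
  d1 : ∀ t, HasDerivAt v1 (v2 t) t
  d2 : ∀ t, HasDerivAt v2 (v3 t) t
  c3 : Continuous v3

namespace Cur
theorem c0 (x : Cur) : Continuous x.v0 := cont_of x.d0
theorem c1 (x : Cur) : Continuous x.v1 := cont_of x.d1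
theorem c2 (x : Cur) : Continuous x.v2 := cont_of x.d2

def shift (x : Cur) (c : ℝ) : Cur where
  v0 t := x.v0 (t + c)
  v1 t := x.v1 (t + c)
  v2 t := x.v2 (t + c)
  v3 t := x.v3 (t + c)
  d0 t := (x.d0 (t + c)).comp_add_const t c
  d1 t := (x.d1 (t + c)).comp_add_const t c
  d2 t := (x.d2 (t + c)).comp_add_const t c
  c3 := x.c3.comp (continuous_id.add continuous_const)

def rev (x : Cur) (c : ℝ) : Cur where
  v0 t := x.v0 (c - t)
  v1 t := - x.v1 (c - t)
  v2 t := x.v2 (c - t)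
  v3 t := - x.v3 (c - t)
  d0 t := (x.d0 (c - t)).comp_const_sub c t
  d1 t := hd_cg ((x.d1 (c - t)).comp_const_sub c t).neg (fun _ => rfl) (by simp)
  d2 t := (x.d2 (c - t)).comp_const_sub c t
  c3 := (x.c3.comp (continuous_const.sub continuous_id)).neg

end Cur

/-- The truncated equation. -/
def SolEq (P : ℝ) (x : Cur) : Prop :=
  ∀ t, HasDerivAt x.v3 (P * x.v2 t + ff (x.v0 t)) t

noncomputable def HH (P : ℝ) (x : Cur) (t : ℝ) : ℝ :=
  x.v1 t * x.v3 t - x.v2 t ^ 2 / 2 - P * x.v1 t ^ 2 / 2 - FF (x.v0 t)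

theorem SolEq.shift {P : ℝ} {x : Cur} (h : SolEq P x) (c : ℝ) : SolEq P (x.shift c) :=
  fun t => (h (t + c)).comp_add_const t c

theorem SolEq.rev {P : ℝ} {x : Cur} (h : SolEq P x) (c : ℝ) : SolEq P (x.rev c) :=
  fun t => hd_cg ((h (c - t)).comp_const_sub c t).neg (fun _ => rfl) (by simp [Cur.rev])

theorem SolEq.HH_const {P : ℝ} {x : Cur} (h : SolEq P x) (s t : ℝ) : HH P x s = HH P x t := by
  have hd : ∀ t, HasDerivAt (HH P x) 0 t := by
    intro t
    have h1 := ((((x.d1 t).mul (h t)).sub (((x.d2 t).pow 2).div_const 2)).sub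
      ((((x.d1 t).pow 2).const_mul P).div_const 2)).sub ((hasDerivAt_FF (x.v0 t)).comp t (x.d0 t))
    refine hd_cg h1 (fun y => by simp [HH]) ?_
    simp
    ring
  rcases le_total s t with hst | hst
  · exact le_antisymm (mono_le hd hst (fun _ _ => le_rfl)) (anti_le hd hst (fun _ _ => le_rfl))
  · exact le_antisymm (anti_le hd hst (fun _ _ => le_rfl)) (mono_le hd hst (fun _ _ => le_rfl))

theorem exists_sol (P : ℝ) (y0 y1 y2 y3 : ℝ) : ∃ x : Cur, SolEq P x ∧ x.v0 0 = y0 ∧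
    x.v1 0 = y1 ∧ x.v2 0 = y2 ∧ x.v3 0 = y3 := by
  let G : ℝ × ℝ × ℝ × ℝ → ℝ × ℝ × ℝ × ℝ := fun u => (u.2.1, u.2.2.1, u.2.2.2, P * u.2.2.1 + ff u.1)
  have hG : ContDiff ℝ 1 G := by
    have := ff_contDiff
    fun_prop
  have hL : LipschitzWith (‖P‖₊ + 4) G := by
    apply LipschitzWith.of_dist_le_mul
    intro u w
    have b0 : |u.1 - w.1| ≤ dist u w := by
      rw [← Real.dist_eq]; exact le_max_left _ _
    have b : dist u.2 w.2 ≤ dist u w := le_max_right _ _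
    have b1 : |u.2.1 - w.2.1| ≤ dist u w := by
      rw [← Real.dist_eq]; exact (le_max_left _ _).trans b
    have b' : dist u.2.2 w.2.2 ≤ dist u w := (le_max_right _ _).trans b
    have b2 : |u.2.2.1 - w.2.2.1| ≤ dist u w := by
      rw [← Real.dist_eq]; exact (le_max_left _ _).trans b'
    have b3 : |u.2.2.2 - w.2.2.2| ≤ dist u w := by
      rw [← Real.dist_eq]; exact (le_max_right _ _).trans b'
    have hd := dist_nonneg (x := u) (y := w)
    have hP := abs_nonneg P
    have b4 : |(P * u.2.2.1 + ff u.1) - (P * w.2.2.1 + ff w.1)| ≤ (|P| + 4) * dist u w := by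
      have e : (P * u.2.2.1 + ff u.1) - (P * w.2.2.1 + ff w.1)
        = P * (u.2.2.1 - w.2.2.1) + (ff u.1 - ff w.1) := by ring
      rw [e]
      refine (abs_add_le _ _).trans ?_
      rw [abs_mul]
      have := ff_lip' u.1 w.1
      have : |P| * |u.2.2.1 - w.2.2.1| ≤ |P| * dist u w := by gcongr
      nlinarith
    have e1 : dist u w ≤ (|P| + 4) * dist u w := by nlinarith
    simp only [NNReal.coe_add, coe_nnnorm, Real.norm_eq_abs, G]
    push_cast
    refine max_le ?_ (max_le ?_ (max_le ?_ ?_))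
    · rw [Real.dist_eq]; exact b1.trans e1
    · rw [Real.dist_eq]; exact b2.trans e1
    · rw [Real.dist_eq]; exact b3.trans e1
    · rw [Real.dist_eq]; exact b4
  obtain ⟨γ, h0, h⟩ := global_exist G hG _ (by positivity) hL (y0, y1, y2, y3)
  refine ⟨⟨fun t => (γ t).1, fun t => (γ t).2.1, fun t => (γ t).2.2.1, fun t => (γ t).2.2.2,
    fun t => ?_, fun t => ?_, fun t => ?_, ?_⟩, fun t => ?_, ?_, ?_, ?_, ?_⟩
  · exact (ContinuousLinearMap.fst ℝ ℝ (ℝ × ℝ × ℝ)).hasFDerivAt.comp_hasDerivAt t (h t)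
  · exact ((ContinuousLinearMap.fst ℝ ℝ (ℝ × ℝ)).comp
      (ContinuousLinearMap.snd ℝ ℝ (ℝ × ℝ × ℝ))).hasFDerivAt.comp_hasDerivAt t (h t)
  · exact (((ContinuousLinearMap.fst ℝ ℝ ℝ).comp (ContinuousLinearMap.snd ℝ ℝ (ℝ × ℝ))).comp
      (ContinuousLinearMap.snd ℝ ℝ (ℝ × ℝ × ℝ))).hasFDerivAt.comp_hasDerivAt t (h t)
  · have : Continuous γ := continuous_iff_continuousAt.2 fun t => (h t).continuousAt
    fun_prop
  · exact (((ContinuousLinearMap.snd ℝ ℝ ℝ).comp (ContinuousLinearMap.snd ℝ ℝ (ℝ × ℝ))).comp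
      (ContinuousLinearMap.snd ℝ ℝ (ℝ × ℝ × ℝ))).hasFDerivAt.comp_hasDerivAt t (h t)
  all_goals simp [h0]

/-- The basic comparison estimate. -/
theorem compare {P : ℝ} (hP0 : 0 ≤ P) (hP : P ≤ 2) (x y : Cur) (g1 g2 : ℝ → ℝ) (δ T : ℝ)
    (_hδ : 0 ≤ δ) (hx : ∀ t, HasDerivAt x.v3 (P * x.v2 t + g1 t) t)
    (hy : ∀ t, HasDerivAt y.v3 (P * y.v2 t + g2 t) t)
    (hg : ∀ t ∈ Icc 0 T, |g1 t - g2 t| ≤ 3 * |x.v0 t - y.v0 t| + δ) :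
    ∀ t ∈ Icc 0 T, (x.v0 t - y.v0 t) ^ 2 + (x.v1 t - y.v1 t) ^ 2 + (x.v2 t - y.v2 t) ^ 2
      + (x.v3 t - y.v3 t) ^ 2 + δ ^ 2 ≤ ((x.v0 0 - y.v0 0) ^ 2 + (x.v1 0 - y.v1 0) ^ 2
      + (x.v2 0 - y.v2 0) ^ 2 + (x.v3 0 - y.v3 0) ^ 2 + δ ^ 2) * exp (8 * T) := by
  intro t ht
  have hd : ∀ t, HasDerivAt (fun t => (x.v0 t - y.v0 t) ^ 2 + (x.v1 t - y.v1 t) ^ 2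
      + (x.v2 t - y.v2 t) ^ 2 + (x.v3 t - y.v3 t) ^ 2 + δ ^ 2)
      (2 * ((x.v0 t - y.v0 t) * (x.v1 t - y.v1 t) + (x.v1 t - y.v1 t) * (x.v2 t - y.v2 t)
       + (x.v2 t - y.v2 t) * (x.v3 t - y.v3 t)
       + (x.v3 t - y.v3 t) * (P * (x.v2 t - y.v2 t) + (g1 t - g2 t)))) t := by
    intro t
    have h := (((((x.d0 t).sub (y.d0 t)).pow 2).add (((x.d1 t).sub (y.d1 t)).pow 2)).add
      (((x.d2 t).sub (y.d2 t)).pow 2)).add (((hx t).sub (hy t)).pow 2)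
    refine hd_cg (h.add_const (δ ^ 2)) (fun s => by simp) ?_
    simp
    ring
  have h1 := gron hd (C := 8) ht.1 (by
    intro s hs
    have h2 := hg s ⟨hs.1.le, hs.2.le.trans ht.2⟩
    generalize x.v0 s - y.v0 s = a at *
    generalize x.v1 s - y.v1 s = b at *
    generalize x.v2 s - y.v2 s = c at *
    generalize x.v3 s - y.v3 s = d at *
    generalize g1 s - g2 s = e at *
    have e1 : d * e ≤ |d| * (3 * |a| + δ) := by
      calc d * e ≤ |d * e| := le_abs_self _
        _ = |d| * |e| := abs_mul _ _
        _ ≤ _ := by gcongr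
    have e2 : 2 * (|d| * (3 * |a| + δ)) ≤ 4 * d ^ 2 + 3 * a ^ 2 + δ ^ 2 := by
      rw [← sq_abs d, ← sq_abs a]
      nlinarith [sq_nonneg (|d| - |a|), sq_nonneg (|d| - δ)]
    have e3 : 2 * (P * (c * d)) ≤ 2 * (c ^ 2 + d ^ 2) := by
      nlinarith [mul_nonneg hP0 (sq_nonneg (c - d)),
        mul_nonneg (sub_nonneg.2 hP) (add_nonneg (sq_nonneg c) (sq_nonneg d))]
    nlinarith [sq_nonneg (a - b), sq_nonneg (b - c), sq_nonneg (c - d), sq_nonneg a, sq_nonneg b,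
      sq_nonneg c, sq_nonneg d, sq_nonneg δ])
  refine h1.trans ?_
  gcongr
  linarith [ht.2]

theorem SolEq.unique_fwd {P : ℝ} (hP0 : 0 ≤ P) (hP : P ≤ 2) {x y : Cur} (hx : SolEq P x)
    (hy : SolEq P y) (h0 : x.v0 0 = y.v0 0) (h1 : x.v1 0 = y.v1 0) (h2 : x.v2 0 = y.v2 0)
    (h3 : x.v3 0 = y.v3 0) (t : ℝ) (ht : 0 ≤ t) :
    x.v0 t = y.v0 t ∧ x.v1 t = y.v1 t ∧ x.v2 t = y.v2 t ∧ x.v3 t = y.v3 t := by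
  have := compare hP0 hP x y _ _ 0 t le_rfl hx hy (fun s _ => by
    simpa using ff_lip' (x.v0 s) (y.v0 s)) t ⟨ht, le_rfl⟩
  rw [h0, h1, h2, h3] at this
  simp only [sub_self, ne_eq, OfNat.ofNat_ne_zero, not_false_eq_true, zero_pow, add_zero,
    zero_mul] at this
  have k0 := sq_nonneg (x.v0 t - y.v0 t)
  have k1 := sq_nonneg (x.v1 t - y.v1 t)
  have k2 := sq_nonneg (x.v2 t - y.v2 t)
  have k3 := sq_nonneg (x.v3 t - y.v3 t)
  refine ⟨?_, ?_, ?_, ?_⟩ <;> rw [← sub_eq_zero, ← sq_eq_zero_iff] <;> linarith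

theorem SolEq.unique {P : ℝ} (hP0 : 0 ≤ P) (hP : P ≤ 2) {x y : Cur} (hx : SolEq P x)
    (hy : SolEq P y) (t₀ : ℝ) (h0 : x.v0 t₀ = y.v0 t₀) (h1 : x.v1 t₀ = y.v1 t₀)
    (h2 : x.v2 t₀ = y.v2 t₀) (h3 : x.v3 t₀ = y.v3 t₀) : x = y := by
  have key : ∀ t, x.v0 t = y.v0 t ∧ x.v1 t = y.v1 t ∧ x.v2 t = y.v2 t ∧ x.v3 t = y.v3 t := by
    intro t
    rcases le_total t₀ t with h | h
    · have := SolEq.unique_fwd hP0 hP (hx.shift t₀) (hy.shift t₀) (by simpa [Cur.shift])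
        (by simpa [Cur.shift]) (by simpa [Cur.shift]) (by simpa [Cur.shift]) (t - t₀) (by linarith)
      simpa [Cur.shift] using this
    · have := SolEq.unique_fwd hP0 hP (hx.rev t₀) (hy.rev t₀) (by simpa [Cur.rev])
        (by simpa [Cur.rev]) (by simpa [Cur.rev]) (by simpa [Cur.rev]) (t₀ - t) (by linarith)
      simpa [Cur.rev] using this
  ext t
  · exact (key t).1
  · exact (key t).2.1
  · exact (key t).2.2.1
  · exact (key t).2.2.2

/-- Nontrivial solution with zero energy. -/
structure IsSol (P : ℝ) (x : Cur) : Prop where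
  pos : 0 < P
  lt : P < 2
  eq : SolEq P x
  H : ∀ t, HH P x t = 0
  nt : ∀ t, ¬ (x.v0 t = 0 ∧ x.v1 t = 0 ∧ x.v2 t = 0 ∧ x.v3 t = 0)

def zeroCur : Cur where
  v0 _ := 0
  v1 _ := 0
  v2 _ := 0
  v3 _ := 0
  d0 t := hasDerivAt_const t 0
  d1 t := hasDerivAt_const t 0
  d2 t := hasDerivAt_const t 0
  c3 := continuous_const

theorem IsSol.mk' {P : ℝ} (h0 : 0 < P) (h2 : P < 2) {x : Cur} (h : SolEq P x) (hH : HH P x 0 = 0)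
    (hn : x.v0 0 ≠ 0) : IsSol P x := by
  refine ⟨h0, h2, h, fun t => by rw [h.HH_const t 0, hH], ?_⟩
  rintro t ⟨a0, a1, a2, a3⟩
  have hz : SolEq P zeroCur := by
    intro t
    refine hd_cg (hasDerivAt_const t (0 : ℝ)) (fun _ => rfl) ?_
    simp [zeroCur, ff_zero]
  have := SolEq.unique h0.le h2.le h hz t a0 a1 a2 a3
  apply hn
  rw [this]
  rfl

theorem IsSol.shift {P : ℝ} {x : Cur} (h : IsSol P x) (c : ℝ) : IsSol P (x.shift c) :=
  ⟨h.pos, h.lt, h.eq.shift c, fun t => h.H (t + c), fun t => h.nt (t + c)⟩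

theorem IsSol.rev {P : ℝ} {x : Cur} (h : IsSol P x) (c : ℝ) : IsSol P (x.rev c) :=
  ⟨h.pos, h.lt, h.eq.rev c, fun t => by
    have := h.H (c - t)
    simp only [HH, Cur.rev] at *
    nlinarith, fun t => by
    have := h.nt (c - t)
    simpa [Cur.rev] using this⟩

theorem IsSol.H' {P : ℝ} {x : Cur} (h : IsSol P x) (t : ℝ) :
    x.v1 t * x.v3 t - x.v2 t ^ 2 / 2 - P * x.v1 t ^ 2 / 2 - FF (x.v0 t) = 0 := h.H t

/-! ### The family of even orbits -/

noncomputable def xa (P a : ℝ) : Cur :=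
  Classical.choose (exists_sol P a 0 (-(a * √(1 - 2 * a / 3))) 0)

theorem xa_spec (P a : ℝ) : SolEq P (xa P a) ∧ (xa P a).v0 0 = a ∧ (xa P a).v1 0 = 0 ∧
    (xa P a).v2 0 = -(a * √(1 - 2 * a / 3)) ∧ (xa P a).v3 0 = 0 :=
  Classical.choose_spec (exists_sol P a 0 (-(a * √(1 - 2 * a / 3))) 0)

theorem xa_isSol {P : ℝ} (h0 : 0 < P) (h2 : P < 2) {a : ℝ} (ha : 0 < a) (ha' : a ≤ 3 / 2) :
    IsSol P (xa P a) := by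
  obtain ⟨h, e0, e1, e2, e3⟩ := xa_spec P a
  refine IsSol.mk' h0 h2 h ?_ (by rw [e0]; exact ha.ne')
  rw [HH, e0, e1, e2, e3, FF_mid (by linarith) (by linarith), neg_sq, mul_pow, sq_sqrt (by linarith)]
  ring

/-! ### Convergence -/

def Conv {ι : Type} (l : Filter ι) (x : ι → Cur) (y : Cur) : Prop :=
  ∀ T ε : ℝ, 0 < ε → ∀ᶠ k in l, ∀ t ∈ Icc 0 T, |(x k).v0 t - y.v0 t| < ε ∧
    |(x k).v1 t - y.v1 t| < ε ∧ |(x k).v2 t - y.v2 t| < ε ∧ |(x k).v3 t - y.v3 t| < ε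

theorem conv_of_compare {ι : Type} {l : Filter ι} {P : ℝ} (hP0 : 0 ≤ P) (hP : P ≤ 2) (x : ι → Cur)
    (y : Cur) (g : ι → ℝ → ℝ) (g2 : ι → ℝ → ℝ)
    (hx : ∀ᶠ k in l, ∀ t, HasDerivAt (x k).v3 (P * (x k).v2 t + g k t) t)
    (hy : ∀ k, ∀ t, HasDerivAt y.v3 (P * y.v2 t + g2 k t) t)
    (hg : ∀ T δ, 0 < δ → ∀ᶠ k in l,
      ∀ t ∈ Icc 0 T, |g k t - g2 k t| ≤ 3 * |(x k).v0 t - y.v0 t| + δ)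
    (i0 : Tendsto (fun k => (x k).v0 0) l (𝓝 (y.v0 0)))
    (i1 : Tendsto (fun k => (x k).v1 0) l (𝓝 (y.v1 0)))
    (i2 : Tendsto (fun k => (x k).v2 0) l (𝓝 (y.v2 0)))
    (i3 : Tendsto (fun k => (x k).v3 0) l (𝓝 (y.v3 0))) : Conv l x y := by
  intro T ε hε
  obtain ⟨δ, hδ, hδ'⟩ : ∃ δ : ℝ, 0 < δ ∧ 5 * δ ^ 2 * exp (8 * T) < ε ^ 2 := by
    refine ⟨ε / (3 * exp (4 * T)), by positivity, ?_⟩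
    have : exp (8 * T) = exp (4 * T) ^ 2 := by rw [← exp_nat_mul]; congr 1; push_cast; ring
    rw [this]
    field_simp
    norm_num
  have t0 := Metric.tendsto_nhds.1 i0 δ hδ
  have t1 := Metric.tendsto_nhds.1 i1 δ hδ
  have t2 := Metric.tendsto_nhds.1 i2 δ hδ
  have t3 := Metric.tendsto_nhds.1 i3 δ hδ
  filter_upwards [hx, hg T δ hδ, t0, t1, t2, t3] with k hx hg t0 t1 t2 t3 t ht
  have key := compare hP0 hP (x k) y _ _ δ T hδ.le hx (hy k) hg t ht
  rw [Real.dist_eq] at t0 t1 t2 t3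
  have s0 := sq_lt_sq' (abs_lt.1 t0).1 (abs_lt.1 t0).2
  have s1 := sq_lt_sq' (abs_lt.1 t1).1 (abs_lt.1 t1).2
  have s2 := sq_lt_sq' (abs_lt.1 t2).1 (abs_lt.1 t2).2
  have s3 := sq_lt_sq' (abs_lt.1 t3).1 (abs_lt.1 t3).2
  have key2 : ((((x k).v0 0 - y.v0 0) ^ 2 + ((x k).v1 0 - y.v1 0) ^ 2
      + ((x k).v2 0 - y.v2 0) ^ 2 + ((x k).v3 0 - y.v3 0) ^ 2 + δ ^ 2)) * exp (8 * T) ≤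
      5 * δ ^ 2 * exp (8 * T) := by
    gcongr
    linarith
  have k0 := sq_nonneg ((x k).v0 t - y.v0 t)
  have k1 := sq_nonneg ((x k).v1 t - y.v1 t)
  have k2 := sq_nonneg ((x k).v2 t - y.v2 t)
  have k3 := sq_nonneg ((x k).v3 t - y.v3 t)
  have kd := sq_nonneg δ
  refine ⟨?_, ?_, ?_, ?_⟩ <;> refine abs_lt_of_sq_lt_sq ?_ hε.le <;> linarith

theorem xa_conv {ι : Type} {l : Filter ι} {P : ℝ} (hP0 : 0 ≤ P) (hP : P ≤ 2) {a : ι → ℝ} {b : ℝ}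
    (h : Tendsto a l (𝓝 b)) : Conv l (fun k => xa P (a k)) (xa P b) := by
  apply conv_of_compare hP0 hP _ _ (fun k t => ff ((xa P (a k)).v0 t))
    (fun _ t => ff ((xa P b).v0 t)) (Eventually.of_forall fun k => (xa_spec P (a k)).1)
    (fun _ => (xa_spec P b).1)
  · intro T δ hδ
    filter_upwards with k t _
    have := ff_lip' ((xa P (a k)).v0 t) ((xa P b).v0 t)
    linarith
  · simpa only [(xa_spec P _).2.1] using h
  · simpa only [(xa_spec P _).2.2.1] using tendsto_const_nhds
  · simp only [(xa_spec P _).2.2.2.1]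
    have : Continuous fun a : ℝ => -(a * √(1 - 2 * a / 3)) := by fun_prop
    exact (this.tendsto b).comp h
  · simpa only [(xa_spec P _).2.2.2.2] using tendsto_const_nhds




/-! ### Long time behaviour of monotone solutions -/

/-- If `deriv f ≤ -ε` on `[T,∞)` then `f` goes below any level. -/
theorem drops {f f' : ℝ → ℝ} (h : ∀ t, HasDerivAt f (f' t) t) {T ε : ℝ} (hε : 0 < ε)
    (hp : ∀ t, T ≤ t → f' t ≤ -ε) (M : ℝ) : ∃ t₁, T ≤ t₁ ∧ ∀ t, t₁ ≤ t → f t < M := by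
  refine ⟨T + (|f T - M| + 1) / ε, ?_, ?_⟩
  · have : 0 ≤ (|f T - M| + 1) / ε := by positivity
    linarith
  · intro t ht
    have h0 : 0 ≤ (|f T - M| + 1) / ε := by positivity
    have h1 := incr_le h (a := T) (b := t) (m := -ε) (by linarith) (fun s hs => hp s hs.1.le)
    have h2 : (|f T - M| + 1) / ε ≤ t - T := by linarith
    rw [div_le_iff₀ hε] at h2
    have h3 := le_abs_self (f T - M)
    nlinarith

theorem drops1 {f f' : ℝ → ℝ} (h : ∀ t, HasDerivAt f (f' t) t) {T ε : ℝ} (hε : 0 < ε)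
    (hp : ∀ t, T ≤ t → f' t ≤ -ε) (M : ℝ) : ∃ t, T ≤ t ∧ f t < M := by
  obtain ⟨t, h1, h2⟩ := drops h hε hp M
  exact ⟨t, h1, h2 t le_rfl⟩

theorem mvt_small {f f' : ℝ → ℝ} (h : ∀ t, HasDerivAt f (f' t) t) {a b B : ℝ} (hab : a + 1 ≤ b)
    (ha : |f a| ≤ B) (hb : |f b| ≤ B) : ∃ p ∈ Ioo a b, |f' p| ≤ 2 * B := by
  obtain ⟨p, hp, hp'⟩ := exists_hasDerivAt_eq_slope f f' (show a < b by linarith)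
    (fun t _ => (h t).continuousAt.continuousWithinAt) (fun t _ => h t)
  refine ⟨p, hp, ?_⟩
  rw [hp', abs_div, div_le_iff₀ (by rw [abs_pos]; linarith), abs_of_pos (a := b - a) (by linarith)]
  have h1 : |f b - f a| ≤ 2 * B := by
    have := abs_sub (f b) (f a)
    linarith
  have : 0 ≤ B := (abs_nonneg _).trans ha
  nlinarith

theorem bd_incr {f f' : ℝ → ℝ} (h : ∀ t, HasDerivAt f (f' t) t) {a b L M : ℝ}
    (hp : ∀ t ∈ Icc a b, |f' t| ≤ M) (hL : b - a ≤ L) (s t : ℝ) (hs : s ∈ Icc a b) (ht : t ∈ Icc a b) :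
    |f t| ≤ |f s| + M * L := by
  have hM : 0 ≤ M := (abs_nonneg _).trans (hp s hs)
  have key : |f t - f s| ≤ M * L := by
    rcases le_total s t with hst | hst
    · have h1 := incr_le h hst (fun r hr => (abs_le.1 (hp r ⟨by linarith [hs.1, hr.1], by linarith [ht.2, hr.2]⟩)).2)
      have h2 := incr_ge h hst (fun r hr => (abs_le.1 (hp r ⟨by linarith [hs.1, hr.1], by linarith [ht.2, hr.2]⟩)).1)
      rw [abs_le]
      constructor <;> nlinarith [hs.1, ht.2]
    · have h1 := incr_le h hst (fun r hr => (abs_le.1 (hp r ⟨by linarith [ht.1, hr.1], by linarith [hs.2, hr.2]⟩)).2)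
      have h2 := incr_ge h hst (fun r hr => (abs_le.1 (hp r ⟨by linarith [ht.1, hr.1], by linarith [hs.2, hr.2]⟩)).1)
      rw [abs_le]
      constructor <;> nlinarith [ht.1, hs.2]
  have := abs_sub_abs_le_abs_sub (f t) (f s)
  linarith

/-- Derivative bounds. -/
theorem DB {P : ℝ} (hP0 : 0 ≤ P) (hP : P ≤ 2) {x : Cur} (h : SolEq P x) {ℓ : ℝ} (hl : ff ℓ = 0)
    {t B : ℝ} (hB : ∀ s ∈ Icc t (t + 7), |x.v0 s - ℓ| ≤ B) :
    |x.v1 t| ≤ 5000 * B ∧ |x.v2 t| ≤ 5000 * B ∧ |x.v3 t| ≤ 20000 * B := by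
  have hB0 : 0 ≤ B := (abs_nonneg _).trans (hB t ⟨le_rfl, by linarith⟩)
  have d0 : ∀ s, HasDerivAt (fun s => x.v0 s - ℓ) (x.v1 s) s := fun s => (x.d0 s).sub_const ℓ
  have hv : ∀ r, 0 ≤ r → r ≤ 7 → |x.v0 (t + r) - ℓ| ≤ B := fun r h1 h2 =>
    hB _ ⟨by linarith, by linarith⟩
  obtain ⟨p1, hp1, b1⟩ := mvt_small d0 (a := t + 0) (b := t + 1) (by linarith) (hv _ (by norm_num) (by norm_num)) (hv _ (by norm_num) (by norm_num))
  obtain ⟨p2, hp2, b2⟩ := mvt_small d0 (a := t + 2) (b := t + 3) (by linarith) (hv _ (by norm_num) (by norm_num)) (hv _ (by norm_num) (by norm_num))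
  obtain ⟨p3, hp3, b3⟩ := mvt_small d0 (a := t + 4) (b := t + 5) (by linarith) (hv _ (by norm_num) (by norm_num)) (hv _ (by norm_num) (by norm_num))
  obtain ⟨p4, hp4, b4⟩ := mvt_small d0 (a := t + 6) (b := t + 7) (by linarith) (hv _ (by norm_num) (by norm_num)) (hv _ (by norm_num) (by norm_num))
  obtain ⟨r1, hr1, c1⟩ := mvt_small x.d1 (a := p1) (b := p2) (by linarith [hp1.2, hp2.1]) b1 b2
  obtain ⟨r2, hr2, c2⟩ := mvt_small x.d1 (a := p3) (b := p4) (by linarith [hp3.2, hp4.1]) b3 b4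
  have m1 : r1 ∈ Icc t (t + 7) := ⟨by linarith [hr1.1, hp1.1], by linarith [hr1.2, hp2.2]⟩
  have m2 : r2 ∈ Icc t (t + 7) := ⟨by linarith [hr2.1, hp3.1], by linarith [hr2.2, hp4.2]⟩
  have dW : ∀ s, HasDerivAt (fun s => x.v2 s - P * (x.v0 s - ℓ)) (x.v3 s - P * x.v1 s) s :=
    fun s => (x.d2 s).sub ((d0 s).const_mul P)
  have dW' : ∀ s, HasDerivAt (fun s => x.v3 s - P * x.v1 s) (ff (x.v0 s)) s := fun s =>
    hd_cg ((h s).sub ((x.d1 s).const_mul P)) (fun _ => rfl) (by ring)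
  have hPv : ∀ s ∈ Icc t (t + 7), |P * (x.v0 s - ℓ)| ≤ 2 * B := by
    intro s hs
    rw [abs_mul, abs_of_nonneg hP0]
    have := hB s hs
    have := abs_nonneg (x.v0 s - ℓ)
    nlinarith
  have w1 : |x.v2 r1 - P * (x.v0 r1 - ℓ)| ≤ 6 * B := by
    have := abs_sub (x.v2 r1) (P * (x.v0 r1 - ℓ))
    have := hPv r1 m1
    linarith
  have w2 : |x.v2 r2 - P * (x.v0 r2 - ℓ)| ≤ 6 * B := by
    have := abs_sub (x.v2 r2) (P * (x.v0 r2 - ℓ))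
    have := hPv r2 m2
    linarith
  obtain ⟨q, hq, hq'⟩ := mvt_small dW (a := r1) (b := r2)
    (by linarith [hr1.2, hr2.1, hp2.2, hp3.1]) w1 w2
  have mq : q ∈ Icc t (t + 7) := ⟨by linarith [m1.1, hq.1], by linarith [m2.2, hq.2]⟩
  have e1 : ∀ s ∈ Icc t (t + 7), |x.v3 s - P * x.v1 s| ≤ 33 * B := by
    intro s hs
    have := bd_incr dW' (a := t) (b := t + 7) (M := 3 * B) (L := 7) (fun r hr => by
      have h1 := ff_lip' (x.v0 r) ℓ
      rw [hl, sub_zero] at h1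
      have := hB r hr
      linarith) (by linarith) q s mq hs
    linarith
  have e2 : ∀ s ∈ Icc t (t + 7), |x.v2 s| ≤ 239 * B := by
    intro s hs
    have h1 := bd_incr dW (a := t) (b := t + 7) (M := 33 * B) (L := 7) e1 (by linarith) r1 s m1 hs
    have h2 := abs_sub_abs_le_abs_sub (x.v2 s) (P * (x.v0 s - ℓ))
    have := hPv s hs
    linarith
  have e3 : ∀ s ∈ Icc t (t + 7), |x.v1 s| ≤ 1675 * B := by
    intro s hs
    have h1 := bd_incr x.d1 (a := t) (b := t + 7) (M := 239 * B) (L := 7) e2 (by linarith) p1 s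
      ⟨by linarith [hp1.1], by linarith [hp1.2]⟩ hs
    linarith
  have mt : t ∈ Icc t (t + 7) := ⟨le_rfl, by linarith⟩
  refine ⟨by linarith [e3 t mt], by linarith [e2 t mt], ?_⟩
  have h1 := abs_sub_abs_le_abs_sub (x.v3 t) (P * x.v1 t)
  have h2 := e1 t mt
  have h3 := e3 t mt
  rw [abs_mul, abs_of_nonneg hP0] at h1
  have := abs_nonneg (x.v1 t)
  nlinarith

theorem DB_loc {P : ℝ} (hP0 : 0 ≤ P) (hP : P ≤ 2) {x : Cur} (h : SolEq P x)
    {t B : ℝ} (hB : ∀ s ∈ Icc t (t + 7), |x.v0 s| ≤ B) :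
    |x.v1 t| ≤ 5000 * B ∧ |x.v2 t| ≤ 5000 * B ∧ |x.v3 t| ≤ 20000 * B :=
  DB hP0 hP h ff_zero (by simpa using hB)

/-- A bounded solution converging to a limit: the limit is a zero of `ff`. -/
theorem lim_zero {P : ℝ} (hP0 : 0 ≤ P) (hP : P ≤ 2) {x : Cur} (h : SolEq P x) {ℓ : ℝ}
    (hl : Tendsto x.v0 atTop (𝓝 ℓ)) : ff ℓ = 0 := by
  have hf : Tendsto (fun t => ff (x.v0 t)) atTop (𝓝 (ff ℓ)) := (ff_cont.tendsto ℓ).comp hl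
  have dW' : ∀ s, HasDerivAt (fun s => x.v3 s - P * x.v1 s) (ff (x.v0 s)) s := fun s =>
    hd_cg ((h s).sub ((x.d1 s).const_mul P)) (fun _ => rfl) (by ring)
  obtain ⟨T, hT⟩ : ∃ T, ∀ t, T ≤ t → |x.v0 t| ≤ |ℓ| + 1 := by
    have := (hl.abs).eventually (gt_mem_nhds (show |ℓ| < |ℓ| + 1 by linarith))
    obtain ⟨T, hT⟩ := eventually_atTop.1 this
    exact ⟨T, fun t ht => (hT t ht).le⟩
  have hb : ∀ t, T ≤ t → |x.v3 t - P * x.v1 t| ≤ 30000 * (|ℓ| + 1) := by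
    intro t ht
    obtain ⟨a, _, b⟩ := DB_loc hP0 hP h (t := t) (B := |ℓ| + 1) (fun s hs => hT s (ht.trans hs.1))
    have h1 := abs_sub (x.v3 t) (P * x.v1 t)
    rw [abs_mul, abs_of_nonneg hP0] at h1
    have := abs_nonneg (x.v1 t)
    nlinarith
  by_contra hne
  rcases lt_or_gt_of_ne hne with hneg | hpos
  · obtain ⟨T', hT'⟩ := eventually_atTop.1 (hf.eventually (gt_mem_nhds (show ff ℓ < ff ℓ / 2 by linarith)))
    obtain ⟨t, ht, ht'⟩ := drops1 dW' (T := max T T') (ε := - (ff ℓ / 2)) (by linarith)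
      (fun t ht => by have := hT' t ((le_max_right _ _).trans ht); linarith) (-(30000 * (|ℓ| + 1)))
    have := (abs_le.1 (hb t ((le_max_left _ _).trans ht))).1
    linarith
  · obtain ⟨T', hT'⟩ := eventually_atTop.1 (hf.eventually (lt_mem_nhds (show ff ℓ / 2 < ff ℓ by linarith)))
    obtain ⟨t, ht, ht'⟩ := drops1 (f := fun s => -(x.v3 s - P * x.v1 s)) (fun s => (dW' s).neg)
      (T := max T T') (ε := ff ℓ / 2) (by linarith)
      (fun t ht => by have := hT' t ((le_max_right _ _).trans ht); linarith) (-(30000 * (|ℓ| + 1)))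
    have := (abs_le.1 (hb t ((le_max_left _ _).trans ht))).2
    linarith

/-- no positive function with `u'' ≤ -ε u`. -/
theorem no_concave {u u1 u2 : ℝ → ℝ} (h0 : ∀ t, HasDerivAt u (u1 t) t)
    (h1 : ∀ t, HasDerivAt u1 (u2 t) t) {T ε : ℝ} (hε : 0 < ε) (hu : ∀ t, T ≤ t → 0 < u t)
    (h2 : ∀ t, T ≤ t → u2 t ≤ -(ε * u t)) : False := by
  have a1 : ∀ t, T ≤ t → 0 ≤ u1 t := by
    intro t ht
    by_contra hc
    push Not at hc
    obtain ⟨r, hr, hr'⟩ := drops1 h0 (T := t) (ε := - u1 t) (by linarith) (fun s hs => by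
      have := anti_le h1 hs (fun r hr => by
        have := h2 r (by linarith [hr.1])
        have := hu r (by linarith [hr.1])
        nlinarith)
      linarith) 0
    have := hu r (by linarith)
    linarith
  have a2 : ∀ t, T ≤ t → u T ≤ u t := fun t ht => mono_le h0 ht (fun s hs => a1 s hs.1.le)
  obtain ⟨r, hr, hr'⟩ := drops1 h1 (T := T) (ε := ε * u T) (mul_pos hε (hu T le_rfl)) (fun s hs => by
      have := h2 s hs
      have := a2 s hs
      nlinarith) 0
  have := a1 r hr
  linarith

/-- `X1`: no bounded eventually monotone nontrivial zero-energy solutions. -/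
theorem X1 {P : ℝ} {x : Cur} (h : IsSol P x) {σ : ℝ} (hσ : σ = 1 ∨ σ = -1) {T B : ℝ}
    (hB : ∀ t, T ≤ t → |x.v0 t| ≤ B) (hm : ∀ t, T ≤ t → σ * x.v1 t ≤ 0) : False := by
  have hσ2 : σ * σ = 1 := by rcases hσ with rfl | rfl <;> norm_num
  have dw : ∀ t, HasDerivAt (fun t => σ * x.v0 t) (σ * x.v1 t) t := fun t => (x.d0 t).const_mul σ
  have wmono : ∀ s t, T ≤ s → s ≤ t → σ * x.v0 t ≤ σ * x.v0 s := fun s t hs hst =>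
    anti_le dw hst (fun r hr => hm r (by linarith [hr.1]))
  -- the limit exists
  obtain ⟨ℓ, hl⟩ : ∃ ℓ, Tendsto x.v0 atTop (𝓝 ℓ) := by
    have hanti : Antitone (fun t => σ * x.v0 (max T t)) := by
      intro s t hst
      exact wmono _ _ (le_max_left _ _) (max_le_max le_rfl hst)
    have hbdd : BddBelow (range (fun t => σ * x.v0 (max T t))) := by
      refine ⟨-B, ?_⟩
      rintro _ ⟨t, rfl⟩
      have := abs_le.1 (hB (max T t) (le_max_left _ _))
      rcases hσ with rfl | rfl <;> simp <;> linarith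
    have := tendsto_atTop_ciInf hanti hbdd
    refine ⟨σ * (⨅ t, σ * x.v0 (max T t)), ?_⟩
    have h2 := this.const_mul σ
    refine h2.congr' ?_
    filter_upwards [eventually_ge_atTop T] with t ht
    rw [max_eq_right ht, ← mul_assoc, hσ2, one_mul]
  have hfl := lim_zero h.pos.le h.lt.le h.eq hl
  have hle : ∀ t, T ≤ t → σ * ℓ ≤ σ * x.v0 t := by
    intro t ht
    apply le_of_tendsto (hl.const_mul σ)
    filter_upwards [eventually_ge_atTop t] with s hs
    exact wmono t s ht hs
  have habs : ∀ s t, T ≤ s → s ≤ t → |x.v0 t - ℓ| ≤ |x.v0 s - ℓ| := by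
    intro s t hs hst
    have a1 := hle t (by linarith)
    have a2 := wmono s t hs hst
    have e1 : |x.v0 t - ℓ| = σ * (x.v0 t - ℓ) := by
      rcases hσ with rfl | rfl
      · rw [abs_of_nonneg] <;> linarith
      · rw [abs_of_nonpos] <;> linarith
    rw [e1]
    calc σ * (x.v0 t - ℓ) ≤ σ * (x.v0 s - ℓ) := by linarith
      _ ≤ |σ * (x.v0 s - ℓ)| := le_abs_self _
      _ = |x.v0 s - ℓ| := by rw [abs_mul]; rcases hσ with rfl | rfl <;> simp
  have hdb : ∀ t, T ≤ t → |x.v1 t| ≤ 5000 * |x.v0 t - ℓ| ∧ |x.v2 t| ≤ 5000 * |x.v0 t - ℓ| ∧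
      |x.v3 t| ≤ 20000 * |x.v0 t - ℓ| := fun t ht =>
    DB h.pos.le h.lt.le h.eq hfl (fun s hs => habs t s ht hs.1)
  have h0 : Tendsto (fun t => |x.v0 t - ℓ|) atTop (𝓝 0) := by
    have := (hl.sub_const ℓ).abs
    simpa using this
  have z1 : Tendsto x.v1 atTop (𝓝 0) := by
    apply squeeze_zero_norm' _ (by simpa using h0.const_mul 5000)
    filter_upwards [eventually_ge_atTop T] with t ht using (hdb t ht).1
  have z2 : Tendsto x.v2 atTop (𝓝 0) := by
    apply squeeze_zero_norm' _ (by simpa using h0.const_mul 5000)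
    filter_upwards [eventually_ge_atTop T] with t ht using (hdb t ht).2.1
  have z3 : Tendsto x.v3 atTop (𝓝 0) := by
    apply squeeze_zero_norm' _ (by simpa using h0.const_mul 20000)
    filter_upwards [eventually_ge_atTop T] with t ht using (hdb t ht).2.2
  have hFl : FF ℓ = 0 := by
    have t1 : Tendsto (fun t => HH P x t) atTop
        (𝓝 (0 * 0 - 0 ^ 2 / 2 - P * 0 ^ 2 / 2 - FF ℓ)) :=
      (((z1.mul z3).sub ((z2.pow 2).div_const 2)).sub (((z1.pow 2).const_mul P).div_const 2)).sub
        ((FF_cont.tendsto ℓ).comp hl)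
    have t2 : Tendsto (fun t => HH P x t) atTop (𝓝 0) := by
      simp only [h.H]; exact tendsto_const_nhds
    have := tendsto_nhds_unique t1 t2
    linarith
  have hl0 : ℓ = 0 := by
    rcases ff_eq_zero hfl with h1 | h1
    · exact h1
    · rcases FF_eq_zero hFl with h2 | h2 <;> linarith
  subst hl0
  simp only [sub_zero, mul_zero] at *
  have wpos : ∀ t, T ≤ t → 0 < σ * x.v0 t := by
    intro t ht
    rcases (hle t ht).lt_or_eq with h1 | h1
    · exact h1
    · exfalso
      have hz : x.v0 t = 0 := by
        rcases hσ with rfl | rfl <;> linarith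
      have := hdb t ht
      rw [hz] at this
      simp only [abs_zero, mul_zero] at this
      exact h.nt t ⟨hz, abs_nonpos_iff.1 this.1, abs_nonpos_iff.1 this.2.1, abs_nonpos_iff.1 this.2.2⟩
  -- set up alpha, beta
  obtain ⟨α, β, hα, hβ, hab, hab'⟩ : ∃ α β : ℝ, 0 < α ∧ 0 < β ∧ α ^ 2 + β ^ 2 = 1 ∧
      α ^ 2 - β ^ 2 = P / 2 := by
    have := h.pos
    have := h.lt
    refine ⟨√((2 + P) / 4), √((2 - P) / 4), Real.sqrt_pos.2 (by linarith),
      Real.sqrt_pos.2 (by linarith), ?_, ?_⟩ <;>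
    rw [sq_sqrt (by linarith), sq_sqrt (by linarith)] <;> ring
  let X : ℝ → ℝ := fun t => x.v2 t + 2 * α * x.v1 t + x.v0 t
  let Y : ℝ → ℝ := fun t => x.v3 t + α * x.v2 t - (α ^ 2 - β ^ 2) * x.v1 t - α * x.v0 t
  have dX : ∀ t, HasDerivAt X (α * X t + Y t) t := fun t =>
    hd_cg (((x.d2 t).add ((x.d1 t).const_mul (2 * α))).add (x.d0 t)) (fun _ => rfl) (by
      simp only [X, Y]
      linear_combination (x.v1 t) * hab)
  have dY : ∀ t, HasDerivAt Y (α * Y t - β ^ 2 * X t + (ff (x.v0 t) + x.v0 t)) t := fun t =>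
    hd_cg (((((h.eq t).add ((x.d2 t).const_mul α))).sub ((x.d1 t).const_mul (α ^ 2 - β ^ 2))).sub
      ((x.d0 t).const_mul α)) (fun _ => rfl) (by
      simp only [X, Y]
      have e : β ^ 2 = 1 - α ^ 2 := by linarith
      have e' : P = 4 * α ^ 2 - 2 := by linarith
      rw [e, e']
      ring)
  let E : ℝ → ℝ := fun t => Y t ^ 2 + β ^ 2 * X t ^ 2
  have dE : ∀ t, HasDerivAt E (2 * α * E t + 2 * Y t * (ff (x.v0 t) + x.v0 t)) t := fun t =>
    hd_cg (((dY t).pow 2).add (((dX t).pow 2).const_mul (β ^ 2))) (fun _ => rfl) (by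
      simp only [E]
      push_cast
      ring)
  have zE : Tendsto E atTop (𝓝 0) := by
    have zX : Tendsto X atTop (𝓝 (0 + 2 * α * 0 + 0)) := (z2.add (z1.const_mul (2 * α))).add hl
    have zY : Tendsto Y atTop (𝓝 (0 + α * 0 - (α ^ 2 - β ^ 2) * 0 - α * 0)) :=
      ((z3.add (z2.const_mul α)).sub (z1.const_mul _)).sub (hl.const_mul α)
    have := (zY.pow 2).add ((zX.pow 2).const_mul (β ^ 2))
    simpa using this
  -- small range
  obtain ⟨T₁, hT₁, hsm⟩ : ∃ T₁, T ≤ T₁ ∧ ∀ t, T₁ ≤ t → |x.v0 t| ≤ min 1 (α * β ^ 3 / 2) := by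
    have hp : 0 < min 1 (α * β ^ 3 / 2) := by positivity
    obtain ⟨T', hT'⟩ := eventually_atTop.1 (h0.eventually (gt_mem_nhds hp))
    exact ⟨max T T', le_max_left _ _, fun t ht => (hT' t ((le_max_right _ _).trans ht)).le⟩
  have hff : ∀ t, T₁ ≤ t → ff (x.v0 t) + x.v0 t = x.v0 t ^ 2 := by
    intro t ht
    have := abs_le.1 ((hsm t ht).trans (min_le_left _ _))
    rw [ff_mid (by linarith) (by linarith)]
    ring
  have hE : ∀ t, T₁ ≤ t → α ^ 2 * E t ≤ x.v0 t ^ 4 := by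
    intro t ht
    by_contra hc
    push Not at hc
    have hgrow : ∀ s, t ≤ s → E t - x.v0 t ^ 4 / α ^ 2 ≤ E s - x.v0 t ^ 4 / α ^ 2 := by
      intro s hs
      have g := gron (f := fun r => -(E r - x.v0 t ^ 4 / α ^ 2)) (C := α)
        (fun r => ((dE r).sub_const (x.v0 t ^ 4 / α ^ 2)).neg) hs (by
        intro r hr
        rw [hff r (by linarith [hr.1])]
        have hv : x.v0 r ^ 2 ≤ x.v0 t ^ 2 := by
          rw [← sq_abs (x.v0 r), ← sq_abs (x.v0 t)]
          have := habs t r (by linarith) hr.1.le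
          gcongr
        have hv4 : x.v0 r ^ 4 ≤ x.v0 t ^ 4 := by nlinarith [sq_nonneg (x.v0 r), sq_nonneg (x.v0 t)]
        have e1 : α * (x.v0 t ^ 4 / α ^ 2) = x.v0 t ^ 4 / α := by field_simp
        have e2 : -(2 * Y r * x.v0 r ^ 2) ≤ α * Y r ^ 2 + x.v0 r ^ 4 / α := by
          have : 0 ≤ (α * Y r + x.v0 r ^ 2) ^ 2 / α := by positivity
          have e3 : (α * Y r + x.v0 r ^ 2) ^ 2 / α = α * Y r ^ 2 + 2 * Y r * x.v0 r ^ 2 + x.v0 r ^ 4 / α := by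
            field_simp
            ring
          linarith
        have e4 : x.v0 r ^ 4 / α ≤ x.v0 t ^ 4 / α := by gcongr
        have e5 : α * Y r ^ 2 ≤ α * E r := by
          apply mul_le_mul_of_nonneg_left _ hα.le
          simp only [E]
          have : 0 ≤ β ^ 2 * X r ^ 2 := by positivity
          linarith
        linarith)
      have e1 : 0 < E t - x.v0 t ^ 4 / α ^ 2 := by
        rw [sub_pos, div_lt_iff₀ (by positivity)]
        linarith
      have e2 : 1 ≤ exp (α * (s - t)) := one_le_exp (mul_nonneg hα.le (by linarith))
      nlinarith
    have hlim : E t ≤ 0 := by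
      apply ge_of_tendsto zE
      filter_upwards [eventually_ge_atTop t] with s hs
      linarith [hgrow s hs]
    have : 0 ≤ x.v0 t ^ 4 := by positivity
    nlinarith [mul_pos hα hα]
  -- the concave function
  refine no_concave (u := fun t => σ * (exp (α * t) * x.v0 t))
    (u1 := fun t => σ * (exp (α * t) * (x.v1 t + α * x.v0 t)))
    (u2 := fun t => σ * (exp (α * t) * (x.v2 t + 2 * α * x.v1 t + α ^ 2 * x.v0 t)))
    (fun t => ?_) (fun t => ?_) (T := T₁) (ε := β ^ 2 / 2) (by positivity) (fun t ht => ?_)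
    (fun t ht => ?_)
  · have := ((((hasDerivAt_id t).const_mul α).exp).mul (x.d0 t)).const_mul σ
    refine hd_cg this (fun _ => by simp) ?_
    simp only [id, mul_one, Pi.add_apply, Pi.mul_apply]
    ring
  · have := ((((hasDerivAt_id t).const_mul α).exp).mul ((x.d1 t).add ((x.d0 t).const_mul α))).const_mul σ
    refine hd_cg this (fun _ => by simp) ?_
    simp only [id, mul_one, Pi.add_apply, Pi.mul_apply]
    ring
  · have := wpos t (by linarith)
    have h2 := exp_pos (α * t)
    have e : σ * (exp (α * t) * x.v0 t) = exp (α * t) * (σ * x.v0 t) := by ring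
    rw [e]
    positivity
  · have hw := wpos t (by linarith)
    have h2 := exp_pos (α * t)
    have hwle : σ * x.v0 t ≤ α * β ^ 3 / 2 := by
      have := (hsm t ht).trans (min_le_right _ _)
      have h3 := abs_le.1 this
      rcases hσ with rfl | rfl <;> linarith
    have hXb : α * β * (σ * X t) ≤ (σ * x.v0 t) ^ 2 := by
      have h3 := hE t ht
      have h4 : (α * β * (σ * X t)) ^ 2 ≤ ((σ * x.v0 t) ^ 2) ^ 2 := by
        have e1 : (α * β * (σ * X t)) ^ 2 = (σ * σ) * (α ^ 2 * (β ^ 2 * X t ^ 2)) := by ring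
        have e2 : ((σ * x.v0 t) ^ 2) ^ 2 = (σ * σ) * (σ * σ) * x.v0 t ^ 4 := by ring
        rw [e1, e2, hσ2, one_mul, one_mul, one_mul]
        refine le_trans ?_ h3
        have : β ^ 2 * X t ^ 2 ≤ E t := by
          simp only [E]
          nlinarith [sq_nonneg (Y t)]
        gcongr
      exact le_trans (le_abs_self _) (abs_le_of_sq_le_sq h4 (by positivity))
    have hXs : σ * X t ≤ β ^ 2 / 2 * (σ * x.v0 t) := by
      have h5 : (σ * x.v0 t) ^ 2 ≤ α * β ^ 3 / 2 * (σ * x.v0 t) := by nlinarith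
      have h6 : α * β * (σ * X t) ≤ α * β * (β ^ 2 / 2 * (σ * x.v0 t)) := by
        refine hXb.trans (h5.trans (le_of_eq ?_))
        ring
      exact le_of_mul_le_mul_left h6 (by positivity)
    have e : σ * (exp (α * t) * (x.v2 t + 2 * α * x.v1 t + α ^ 2 * x.v0 t))
        = exp (α * t) * (σ * X t - β ^ 2 * (σ * x.v0 t)) := by
      have : α ^ 2 = 1 - β ^ 2 := by linarith
      simp only [X]
      rw [this]
      ring
    rw [e]
    have e' : -(β ^ 2 / 2 * (σ * (exp (α * t) * x.v0 t)))
      = exp (α * t) * (-(β ^ 2 / 2 * (σ * x.v0 t))) := by ring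
    rw [e']
    apply mul_le_mul_of_nonneg_left _ h2.le
    linarith

/-- `X2`: a solution cannot decrease forever from below `-1`. -/
theorem X2 {P : ℝ} (_hP0 : 0 < P) (hP : P < 2) {x : Cur} (h : SolEq P x) {T : ℝ} (hT : x.v0 T ≤ -1)
    (hm : ∀ t, T ≤ t → x.v1 t ≤ 0) : False := by
  have hD : ∀ t, T ≤ t → x.v0 t ≤ -1 := fun t ht =>
    (anti_le x.d0 ht (fun s hs => hm s hs.1.le)).trans hT
  -- A = k' D - k D' with D = -v0, k = -v2
  let A : ℝ → ℝ := fun t => x.v3 t * x.v0 t - x.v2 t * x.v1 t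
  have dA : ∀ t, HasDerivAt A ((P * x.v2 t + ff (x.v0 t)) * x.v0 t - x.v2 t * x.v2 t) t := fun t =>
    hd_cg (((h t).mul (x.d0 t)).sub ((x.d2 t).mul (x.d1 t))) (fun _ => rfl) (by ring)
  obtain ⟨ε, hε, hPε⟩ : ∃ ε, 0 < ε ∧ P = 2 - 2 * ε := ⟨1 - P / 2, by linarith, by ring⟩
  have hA' : ∀ t, T ≤ t → (P * x.v2 t + ff (x.v0 t)) * x.v0 t - x.v2 t * x.v2 t ≤ -(ε * x.v0 t ^ 2) := by
    intro t ht
    have := hD t ht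
    rw [ff_lo this, hPε]
    have e1 : (-3 * x.v0 t - 1) * x.v0 t ≤ -2 * x.v0 t ^ 2 := by nlinarith
    have hε1 : ε < 1 := by linarith
    nlinarith [mul_nonneg (show 0 ≤ 1 - ε by linarith) (sq_nonneg (x.v2 t - x.v0 t)),
      mul_nonneg hε.le (sq_nonneg (x.v2 t)), sq_nonneg (x.v0 t)]
  have hsq : ∀ t, T ≤ t → 1 ≤ x.v0 t ^ 2 := fun t ht => by nlinarith [hD t ht]
  obtain ⟨t₀, ht₀, hA0⟩ := drops dA (T := T) hε (fun t ht => by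
    have := hA' t ht
    have := hsq t ht
    nlinarith) 0
  -- ρ = v2 / v0
  let ρ : ℝ → ℝ := fun t => x.v2 t / x.v0 t
  have dρ : ∀ t, T ≤ t → HasDerivAt ρ (A t / x.v0 t ^ 2) t := fun t ht =>
    (x.d2 t).div (x.d0 t) (by have := hD t ht; linarith)
  have hρanti : ∀ s t, t₀ ≤ s → s ≤ t → ρ t ≤ ρ s := by
    intro s t hs hst
    have : AntitoneOn ρ (Ici t₀) := by
      apply antitoneOn_of_hasDerivWithinAt_nonpos (convex_Ici t₀) (f' := fun t => A t / x.v0 t ^ 2)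
      · intro r hr
        exact (dρ r (ht₀.trans hr)).continuousAt.continuousWithinAt
      · intro r hr
        rw [interior_Ici] at hr
        exact (dρ r (ht₀.trans hr.le)).hasDerivWithinAt
      · intro r hr
        rw [interior_Ici] at hr
        exact div_nonpos_of_nonpos_of_nonneg (hA0 r hr.le).le (sq_nonneg _)
    exact this hs (hs.trans hst) hst
  have hv2 : ∀ t, T ≤ t → x.v2 t = ρ t * x.v0 t := fun t ht => by
    have := hD t ht
    rw [div_mul_cancel₀]; linarith
  by_cases hneg : ∃ t, t₀ ≤ t ∧ ρ t < 0
  · obtain ⟨t₁, ht₁, hρ⟩ := hneg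
    obtain ⟨r, hr, hr'⟩ := drops1 (f := fun t => - x.v1 t) (fun t => (x.d1 t).neg) (T := t₁)
      (ε := -ρ t₁) (by linarith) (fun t ht => by
        have h1 := hρanti t₁ t ht₁ ht
        rw [hv2 t (by linarith)]
        have := hD t (by linarith)
        nlinarith) 0
    have := hm r (by linarith)
    linarith
  · push Not at hneg
    have hρ0 : 0 ≤ ρ t₀ := hneg t₀ le_rfl
    -- energy bound
    obtain ⟨C, hC, hCb⟩ : ∃ C, 0 < C ∧ ∀ t, t₀ ≤ t → - x.v1 t ≤ C * (- x.v0 t) := by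
      let c₀ := x.v1 t₀ ^ 2 + ρ t₀ + 1
      have hc0 : 0 < c₀ := by positivity
      refine ⟨c₀ + 1, by positivity, fun t ht => ?_⟩
      have g := anti_le (f := fun t => x.v1 t ^ 2 - ρ t₀ * x.v0 t ^ 2)
        (f' := fun t => 2 * x.v1 t * x.v2 t - ρ t₀ * (2 * x.v0 t * x.v1 t))
        (fun t => hd_cg (((x.d1 t).pow 2).sub (((x.d0 t).pow 2).const_mul (ρ t₀))) (fun _ => by simp)
          (by push_cast; ring)) ht (fun s hs => by
          have h1 := hρanti t₀ s le_rfl hs.1.le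
          have h2 := hm s (by linarith [hs.1])
          have h3 := hD s (by linarith [hs.1])
          have h4 : 0 ≤ x.v1 s * x.v0 s := mul_nonneg_of_nonpos_of_nonpos h2 (by linarith)
          rw [hv2 s (by linarith [hs.1])]
          nlinarith)
      have h5 : x.v1 t ^ 2 ≤ c₀ * x.v0 t ^ 2 := by
        have := hsq t (by linarith)
        have h6 : 0 ≤ ρ t₀ * x.v0 t₀ ^ 2 := by positivity
        simp only [c₀]
        nlinarith [sq_nonneg (x.v1 t₀)]
      have h7 := hD t (by linarith)
      have h8 : (- x.v1 t) ^ 2 ≤ ((c₀ + 1) * (- x.v0 t)) ^ 2 := by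
        rw [neg_sq, mul_pow, neg_sq]
        refine h5.trans ?_
        gcongr
        nlinarith
      exact (le_abs_self _).trans (abs_le_of_sq_le_sq h8 (by nlinarith))
    let c := ε / (4 * C)
    have hc : 0 < c := by positivity
    obtain ⟨t₂, ht₂, hA2⟩ := drops (f := fun t => A t + c * x.v0 t ^ 2)
      (f' := fun t => ((P * x.v2 t + ff (x.v0 t)) * x.v0 t - x.v2 t * x.v2 t)
        + c * (2 * x.v0 t * x.v1 t))
      (fun t => hd_cg ((dA t).add (((x.d0 t).pow 2).const_mul c)) (fun _ => by simp)
        (by push_cast; ring)) (T := t₀) (ε := ε / 2) (by positivity) (fun t ht => by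
        have h1 := hA' t (by linarith)
        have h2 := hsq t (by linarith)
        have h3 := hCb t ht
        have h4 := hD t (by linarith)
        have h5 : x.v0 t * x.v1 t ≤ C * x.v0 t ^ 2 := by nlinarith
        have h6 : c * (2 * x.v0 t * x.v1 t) ≤ ε / 2 * x.v0 t ^ 2 := by
          have : c * (2 * x.v0 t * x.v1 t) ≤ c * (2 * (C * x.v0 t ^ 2)) := by
            apply mul_le_mul_of_nonneg_left _ hc.le
            linarith
          refine this.trans (le_of_eq ?_)
          simp only [c]
          field_simp
          ring
        nlinarith) 0
    -- ρ' ≤ -c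
    have hdrop : ∀ t, t₂ ≤ t → ρ t ≤ ρ t₂ - c * (t - t₂) := by
      intro t ht
      have : AntitoneOn (fun t => ρ t + c * t) (Ici t₂) := by
        apply antitoneOn_of_hasDerivWithinAt_nonpos (convex_Ici t₂)
          (f' := fun t => A t / x.v0 t ^ 2 + c * 1)
        · intro r hr
          exact ((dρ r (by linarith [show t₂ ≤ r from hr])).add
            ((hasDerivAt_id r).const_mul c)).continuousAt.continuousWithinAt
        · intro r hr
          rw [interior_Ici] at hr
          exact ((dρ r (by linarith [show t₂ < r from hr])).add
            ((hasDerivAt_id r).const_mul c)).hasDerivWithinAt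
        · intro r hr
          rw [interior_Ici] at hr
          have hr' : t₂ < r := hr
          have h1 := hA2 r hr'.le
          have h2 := hsq r (by linarith)
          have h3 : A r / x.v0 r ^ 2 ≤ -c := by
            rw [div_le_iff₀ (by linarith)]
            linarith
          linarith
      have h2 := this (mem_Ici.2 le_rfl) (show t ∈ Ici t₂ from ht) ht
      simp only at h2
      linarith
    have h3 := hdrop (t₂ + (ρ t₂ + 1) / c) (by
      have := hneg t₂ ht₂
      have : 0 ≤ (ρ t₂ + 1) / c := by positivity
      linarith)
    have h4 : c * ((ρ t₂ + 1) / c) = ρ t₂ + 1 := by field_simp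
    rw [add_sub_cancel_left, h4] at h3
    have := hneg (t₂ + (ρ t₂ + 1) / c) (by
      have := hneg t₂ ht₂
      have : 0 ≤ (ρ t₂ + 1) / c := by positivity
      linarith)
    linarith

/-- `XX`: no eventually monotone solution bounded above. -/
theorem XX {P : ℝ} {x : Cur} (h : IsSol P x) {σ : ℝ} (hσ : σ = 1 ∨ σ = -1) {T : ℝ}
    (hB : ∀ t, T ≤ t → x.v0 t ≤ 3 / 2) (hm : ∀ t, T ≤ t → σ * x.v1 t ≤ 0) : False := by
  rcases hσ with rfl | rfl
  · by_cases hex : ∃ t, T ≤ t ∧ x.v0 t ≤ -1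
    · obtain ⟨t, ht, ht'⟩ := hex
      exact X2 h.pos h.lt h.eq ht' (fun s hs => by linarith [hm s (ht.trans hs)])
    · push Not at hex
      refine X1 h (Or.inl rfl) (T := T) (B := 2) (fun t ht => ?_) hm
      rw [abs_le]
      constructor
      · linarith [hex t ht]
      · linarith [hB t ht]
  · refine X1 h (Or.inr rfl) (T := T) (B := |x.v0 T| + 2) (fun t ht => ?_) hm
    have h1 := mono_le x.d0 ht (fun s hs => by linarith [hm s hs.1.le])
    have := hB t ht
    have := neg_abs_le (x.v0 T)
    have := abs_nonneg (x.v0 T)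
    rw [abs_le]
    constructor <;> linarith




theorem first_dn {g : ℝ → ℝ} (hg : Continuous g) {z w : ℝ} (hzw : z ≤ w) (hz : 0 < g z)
    (hw : g w ≤ 0) : ∃ t, z < t ∧ t ≤ w ∧ g t = 0 ∧ ∀ s ∈ Ico z t, 0 < g s := by
  obtain ⟨t, h1, h2, h3, h4⟩ := first_zero (g := fun s => - g s) hg.neg hzw (by simpa using hz)
    (by simpa using hw)
  exact ⟨t, h1, h2, by linarith, fun s hs => by linarith [h4 s hs]⟩

theorem first_up {g : ℝ → ℝ} (hg : Continuous g) {z w m : ℝ} (hzw : z ≤ w) (hz : g z < m)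
    (hw : m ≤ g w) : ∃ t, z < t ∧ t ≤ w ∧ g t = m ∧ ∀ s ∈ Ico z t, g s < m := by
  obtain ⟨t, h1, h2, h3, h4⟩ := first_zero (g := fun s => g s - m) (hg.sub continuous_const) hzw
    (by simpa using hz) (by simpa using hw)
  exact ⟨t, h1, h2, by linarith, fun s hs => by linarith [h4 s hs]⟩

/-! ### The monotone quantity `N` -/

noncomputable def NN (P : ℝ) (x : Cur) (t : ℝ) : ℝ :=
  x.v1 t * x.v2 t + P * x.v0 t * x.v1 t - x.v0 t * x.v3 t

noncomputable def NN' (P : ℝ) (x : Cur) (t : ℝ) : ℝ :=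
  x.v2 t ^ 2 + P * x.v1 t ^ 2 - x.v0 t * ff (x.v0 t)

theorem SolEq.dN {P : ℝ} {x : Cur} (h : SolEq P x) (t : ℝ) : HasDerivAt (NN P x) (NN' P x t) t := by
  refine hd_cg ((((x.d1 t).mul (x.d2 t)).add (((x.d0 t).const_mul P).mul (x.d1 t))).sub
    ((x.d0 t).mul (h t))) (fun _ => rfl) ?_
  simp only [NN']
  ring

theorem IsSol.N'_nonneg {P : ℝ} {x : Cur} (h : IsSol P x) {t : ℝ} (h1 : x.v0 t ≤ 1) :
    0 ≤ NN' P x t := by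
  have := v_ff_nonpos h1
  have := h.pos
  have : 0 ≤ P * x.v1 t ^ 2 := by positivity
  have : 0 ≤ x.v2 t ^ 2 := by positivity
  simp only [NN']
  linarith

theorem IsSol.crit_v2 {P : ℝ} {x : Cur} (h : IsSol P x) {t : ℝ} (h1 : x.v1 t = 0) :
    x.v2 t ^ 2 = -2 * FF (x.v0 t) := by
  have := h.H' t
  rw [h1] at this
  nlinarith

theorem v2_of_neg {P : ℝ} {x : Cur} (h : IsSol P x) {s t : ℝ} (hst : s < t)
    (hneg : ∀ r ∈ Ioo s t, x.v1 r < 0) (h1 : x.v1 t = 0) (h0 : x.v0 t ≠ 0) (h0' : x.v0 t < 3 / 2) :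
    0 < x.v2 t := by
  have hsq := h.crit_v2 h1
  have hF := FF_neg h0 h0'
  by_contra hc
  push Not at hc
  have hlt : x.v2 t < 0 := by
    rcases hc.lt_or_eq with hc | hc
    · exact hc
    · rw [hc] at hsq; nlinarith
  have hev := (isOpen_Iio.preimage x.c2).mem_nhds (show t ∈ x.v2 ⁻¹' Iio 0 from hlt)
  obtain ⟨ε, hε, hball⟩ := Metric.mem_nhds_iff.1 hev
  set r := max (t - ε / 2) ((s + t) / 2) with hr
  have hr1 : r < t := max_lt (by linarith) (by linarith)
  have hr2 : s < r := lt_of_lt_of_le (by linarith : s < (s + t) / 2) (le_max_right _ _)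
  have hr3 : t - ε / 2 ≤ r := le_max_left _ _
  have := anti_le x.d1 hr1.le (fun q hq => by
    have : q ∈ Metric.ball t ε := by
      rw [Metric.mem_ball, Real.dist_eq, abs_lt]
      constructor <;> linarith [hq.1, hq.2]
    exact (mem_Iio.1 (hball this)).le)
  have := hneg r ⟨hr2, hr1⟩
  linarith

theorem v2_of_pos {P : ℝ} {x : Cur} (h : IsSol P x) {s t : ℝ} (hst : s < t)
    (hneg : ∀ r ∈ Ioo s t, 0 < x.v1 r) (h1 : x.v1 t = 0) (h0 : x.v0 t ≠ 0) (h0' : x.v0 t < 3 / 2) :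
    x.v2 t < 0 := by
  have hsq := h.crit_v2 h1
  have hF := FF_neg h0 h0'
  by_contra hc
  push Not at hc
  have hlt : 0 < x.v2 t := by
    rcases hc.lt_or_eq with hc | hc
    · exact hc
    · rw [← hc] at hsq; nlinarith
  have hev := (isOpen_Ioi.preimage x.c2).mem_nhds (show t ∈ x.v2 ⁻¹' Ioi 0 from hlt)
  obtain ⟨ε, hε, hball⟩ := Metric.mem_nhds_iff.1 hev
  set r := max (t - ε / 2) ((s + t) / 2) with hr
  have hr1 : r < t := max_lt (by linarith) (by linarith)
  have hr2 : s < r := lt_of_lt_of_le (by linarith : s < (s + t) / 2) (le_max_right _ _)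
  have hr3 : t - ε / 2 ≤ r := le_max_left _ _
  have := mono_le x.d1 hr1.le (fun q hq => by
    have : q ∈ Metric.ball t ε := by
      rw [Metric.mem_ball, Real.dist_eq, abs_lt]
      constructor <;> linarith [hq.1, hq.2]
    exact (mem_Ioi.1 (hball this)).le)
  have := hneg r ⟨hr2, hr1⟩
  linarith

/-! ### E+ step -/

theorem estep_a {P : ℝ} {x : Cur} (h : IsSol P x) {s w : ℝ} (hsw : s ≤ w)
    (h0' : x.v0 s ≤ 1) (h1 : x.v1 s = 0) (h2 : x.v2 s < 0) (h3 : x.v3 s ≤ 0)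
    (hp : ∀ t ∈ Icc s w, 0 ≤ x.v0 t) : ∀ t ∈ Icc s w, x.v2 t ≤ x.v2 s ∧ x.v3 t ≤ 0 ∧ x.v1 t ≤ 0 ∧
      x.v0 t ≤ 1 := by
  -- generic consequence
  have gen : ∀ t, s ≤ t → t ≤ w → (∀ r ∈ Ico s t, x.v2 r < 0) → ∀ r ∈ Icc s t,
      x.v2 r ≤ x.v2 s ∧ x.v3 r ≤ 0 ∧ x.v1 r ≤ 0 ∧ x.v0 r ≤ 1 := by
    intro t hst htw hneg
    have A1 : ∀ r ∈ Icc s t, x.v1 r ≤ 0 := fun r hr => by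
      have := anti_le x.d1 hr.1 (fun q hq => (hneg q ⟨hq.1.le, hq.2.trans_le hr.2⟩).le)
      linarith
    have A0 : ∀ r ∈ Icc s t, x.v0 r ≤ 1 := fun r hr => by
      have := anti_le x.d0 hr.1 (fun q hq => A1 q ⟨hq.1.le, hq.2.le.trans hr.2⟩)
      linarith
    have A3 : ∀ r ∈ Icc s t, x.v3 r ≤ 0 := fun r hr => by
      have := anti_le h.eq hr.1 (fun q hq => by
        have q1 := ff_nonpos (hp q ⟨hq.1.le, hq.2.le.trans (hr.2.trans htw)⟩)
          (A0 q ⟨hq.1.le, hq.2.le.trans hr.2⟩)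
        have q2 := hneg q ⟨hq.1.le, hq.2.trans_le hr.2⟩
        have := h.pos
        nlinarith)
      linarith
    intro r hr
    refine ⟨?_, A3 r hr, A1 r hr, A0 r hr⟩
    exact anti_le x.d2 hr.1 (fun q hq => A3 q ⟨hq.1.le, hq.2.le.trans hr.2⟩)
  have hneg : ∀ r ∈ Icc s w, x.v2 r < 0 := by
    by_contra hc
    push Not at hc
    obtain ⟨r, hr, hr'⟩ := hc
    obtain ⟨t, ht1, ht2, ht3, ht4⟩ := first_zero x.c2 hr.1 h2 hr'
    have := (gen t ht1.le (ht2.trans hr.2) ht4 t ⟨ht1.le, le_rfl⟩).1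
    linarith
  exact gen w hsw le_rfl (fun r hr => hneg r ⟨hr.1, hr.2.le⟩)

theorem estep {P : ℝ} {x : Cur} (h : IsSol P x) {s : ℝ} (h0 : 0 < x.v0 s)
    (h0' : x.v0 s ≤ 1) (h1 : x.v1 s = 0) (h2 : x.v2 s < 0) (h3 : x.v3 s ≤ 0) :
    ∃ z t, s < z ∧ z < t ∧ x.v0 z = 0 ∧ (∀ r ∈ Icc s z, 0 ≤ x.v0 r ∧ x.v2 r ≤ x.v2 s ∧ x.v3 r ≤ 0 ∧
      x.v1 r ≤ 0 ∧ x.v0 r ≤ 1) ∧ (∀ r ∈ Ioo s t, x.v1 r < 0) ∧ x.v1 t = 0 ∧ x.v0 t < 0 ∧ 0 < x.v2 t := by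
  have hz : ∃ w, s ≤ w ∧ x.v0 w ≤ 0 := by
    by_contra hc
    push Not at hc
    have key : ∀ t, s ≤ t → x.v1 t ≤ x.v2 s * (t - s) := fun t ht => by
      have := incr_le x.d1 ht (m := x.v2 s) (fun r hr =>
        (estep_a h ht h0' h1 h2 h3 (fun q hq => (hc q hq.1).le) r ⟨hr.1.le, hr.2.le⟩).1)
      linarith
    obtain ⟨t, ht, ht'⟩ := drops1 x.d0 (T := s + 1) (ε := - x.v2 s) (by linarith) (fun t ht => by
      have := key t (by linarith)
      nlinarith) 0
    linarith [hc t (by linarith)]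
  obtain ⟨w, hw, hw'⟩ := hz
  obtain ⟨z, hz1, hz2, hz3, hz4⟩ := first_dn x.c0 hw h0 hw'
  have hz5 : x.v0 z = 0 := by linarith
  have hpos : ∀ r ∈ Icc s z, 0 ≤ x.v0 r := by
    intro r hr
    rcases hr.2.lt_or_eq with h' | h'
    · linarith [hz4 r ⟨hr.1, h'⟩]
    · rw [h', hz5]
  have hA := estep_a h hz1.le h0' h1 h2 h3 hpos
  have hlt : ∀ r, s < r → r ≤ z → x.v1 r < 0 := fun r hr hr' => by
    have := anti_lt x.d1 hr (fun q hq => (hA q ⟨hq.1.le, hq.2.le.trans hr'⟩).1.trans_lt h2)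
    linarith
  have hex : ∃ w, z ≤ w ∧ 0 ≤ x.v1 w := by
    by_contra hc
    push Not at hc
    refine XX h (Or.inl rfl) (T := z) (fun t ht => ?_) (fun t ht => by linarith [hc t ht])
    have := anti_le x.d0 ht (fun q hq => (hc q hq.1.le).le)
    linarith
  obtain ⟨w, hw, hw'⟩ := hex
  obtain ⟨t, ht1, ht2, ht3, ht4⟩ := first_zero x.c1 hw (hlt z hz1 le_rfl) hw'
  have hall : ∀ r ∈ Ioo s t, x.v1 r < 0 := fun r hr => by
    rcases le_total r z with h' | h'
    · exact hlt r hr.1 h'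
    · exact ht4 r ⟨h', hr.2⟩
  have hv : x.v0 t < 0 := by
    have := anti_lt x.d0 ht1 (fun q hq => ht4 q ⟨hq.1.le, hq.2⟩)
    linarith
  exact ⟨z, t, hz1, ht1, hz5, fun r hr => ⟨hpos r hr, hA r hr⟩, hall, ht3, hv,
    v2_of_neg h (hz1.trans ht1) hall ht3 hv.ne (by linarith)⟩

/-! ### Deep minima -/

theorem deep {P : ℝ} {x : Cur} (h : IsSol P x) {s : ℝ} (h0 : x.v0 s ≤ -(3 / 5))
    (h1 : x.v1 s = 0) (h2 : 0 < x.v2 s) (h3 : 0 ≤ x.v3 s) : ∀ t, s < t → 0 < x.v1 t := by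
  have hP := h.pos
  have gen : ∀ t, s ≤ t → (∀ r ∈ Icc s t, x.v0 r ≤ 0) → (∀ r ∈ Ico s t, 0 < x.v2 r) → ∀ r ∈ Icc s t,
      x.v2 s ≤ x.v2 r ∧ 0 ≤ x.v3 r := by
    intro t hst hv hneg
    have A3 : ∀ r ∈ Icc s t, 0 ≤ x.v3 r := fun r hr => by
      have := mono_le h.eq hr.1 (fun q hq => by
        have q1 : 0 ≤ ff (x.v0 q) := by
          have := hv q ⟨hq.1.le, hq.2.le.trans hr.2⟩
          rcases this.lt_or_eq with h' | h'
          · exact (ff_pos_neg h').le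
          · rw [h', ff_zero]
        have q2 := hneg q ⟨hq.1.le, hq.2.trans_le hr.2⟩
        nlinarith)
      linarith
    exact fun r hr => ⟨mono_le x.d2 hr.1 (fun q hq => A3 q ⟨hq.1.le, hq.2.le.trans hr.2⟩), A3 r hr⟩
  have gen2 : ∀ t, s ≤ t → (∀ r ∈ Icc s t, x.v0 r ≤ 0) → ∀ r ∈ Icc s t,
      x.v2 s ≤ x.v2 r ∧ 0 ≤ x.v3 r := by
    intro t hst hv
    have hneg : ∀ r ∈ Icc s t, 0 < x.v2 r := by
      by_contra hc
      push Not at hc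
      obtain ⟨r, hr, hr'⟩ := hc
      obtain ⟨q, hq1, hq2, hq3, hq4⟩ := first_dn x.c2 hr.1 h2 hr'
      have := (gen q hq1.le (fun r' hr'' => hv r' ⟨hr''.1, hr''.2.trans (hq2.trans hr.2)⟩)
        (fun r' hr'' => by linarith [hq4 r' hr'']) q ⟨hq1.le, le_rfl⟩).1
      linarith
    exact gen t hst hv (fun r hr => hneg r ⟨hr.1, hr.2.le⟩)
  have key : ∀ t, s ≤ t → (∀ r ∈ Icc s t, x.v0 r ≤ 0) → x.v2 s * (t - s) ≤ x.v1 t := fun t ht hv => by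
    have := incr_ge x.d1 ht (m := x.v2 s) (fun r hr => (gen2 t ht hv r ⟨hr.1.le, hr.2.le⟩).1)
    linarith
  have hz : ∃ w, s ≤ w ∧ 0 ≤ x.v0 w := by
    by_contra hc
    push Not at hc
    obtain ⟨t, ht, ht'⟩ := drops1 (f := fun t => - x.v0 t) (fun t => (x.d0 t).neg) (T := s + 1)
      (ε := x.v2 s) h2 (fun t ht => by
      have := key t (by linarith) (fun q hq => (hc q hq.1).le)
      nlinarith) 0
    linarith [hc t (by linarith)]
  obtain ⟨w, hw, hw'⟩ := hz
  obtain ⟨z, hz1, hz2, hz3, hz4⟩ := first_zero x.c0 hw (by linarith) hw'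
  have hneg : ∀ r ∈ Icc s z, x.v0 r ≤ 0 := by
    intro r hr
    rcases hr.2.lt_or_eq with h' | h'
    · linarith [hz4 r ⟨hr.1, h'⟩]
    · rw [h', hz3]
  have hA := gen2 z hz1.le hneg
  have hlt : ∀ r, s < r → r ≤ z → 0 < x.v1 r := fun r hr hr' => by
    have := key r hr.le (fun q hq => hneg q ⟨hq.1, hq.2.trans hr'⟩)
    nlinarith
  set p := x.v1 z with hp
  have hp0 : 0 < p := hlt z hz1 le_rfl
  have hpk : 1 / 4 < p * x.v3 z := by
    have e1 := h.H' z
    rw [hz3, FF_zero, ← hp] at e1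
    have e2 := h.crit_v2 h1
    have e3 := FF_le h0
    have e4 := (hA z ⟨hz1.le, le_rfl⟩).1
    have e5 : 0 < P * p ^ 2 := by positivity
    nlinarith
  have hk : 0 < x.v3 z := by
    by_contra hc
    push Not at hc
    nlinarith
  have h3pos : ∀ t, z ≤ t → 0 < x.v3 t := by
    by_contra hc
    push Not at hc
    obtain ⟨r, hr, hr'⟩ := hc
    obtain ⟨t, ht1, ht2, ht3, ht4⟩ := first_dn x.c3 hr hk hr'
    have B2 : ∀ q ∈ Icc z t, 0 < x.v2 q := fun q hq => by
      have := mono_le x.d2 hq.1 (fun r hr => by linarith [ht4 r ⟨hr.1.le, hr.2.trans_le hq.2⟩])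
      linarith [(hA z ⟨hz1.le, le_rfl⟩).1]
    have B1 : ∀ q ∈ Icc z t, p ≤ x.v1 q := fun q hq =>
      mono_le x.d1 hq.1 (fun r hr => (B2 r ⟨hr.1.le, hr.2.le.trans hq.2⟩).le)
    have t3 : x.v3 t = 0 := by linarith
    rcases le_or_gt (x.v0 t) 1 with h' | h'
    · have := mono_le (f := fun t => p * x.v3 t + x.v0 t * (1 / 4))
        (f' := fun t => p * (P * x.v2 t + ff (x.v0 t)) + x.v1 t * (1 / 4))
        (fun t => ((h.eq t).const_mul p).add ((x.d0 t).mul_const (1 / 4))) ht1.le (fun q hq => by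
          have b1 := B1 q ⟨hq.1.le, hq.2.le⟩
          have b2 := B2 q ⟨hq.1.le, hq.2.le⟩
          have b3 := ff_ge' (x.v0 q)
          have : 0 < p * (P * x.v2 q) := by positivity
          nlinarith)
      simp only [t3, hz3] at this
      linarith
    · obtain ⟨y, hy1, hy2, hy3, hy4⟩ := first_up x.c0 (m := 1) ht1.le
        (by simp [hz3]) (by linarith)
      have hy5 : x.v0 y = 1 := by linarith
      have hyt : y < t := by
        rcases hy2.lt_or_eq with h'' | h''
        · exact h''
        · rw [h''] at hy5; linarith
      have := mono_le h.eq hyt.le (fun q hq => by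
        have c1 := mono_le x.d0 hq.1.le (fun r hr => by
          linarith [B1 r ⟨by linarith [hr.1], by linarith [hr.2, hq.2]⟩])
        have c2 := ff_nonneg_ge (show 1 ≤ x.v0 q by linarith)
        have c3 := B2 q ⟨by linarith [hq.1], hq.2.le⟩
        nlinarith)
      linarith [ht4 y ⟨hy1.le, hyt⟩]
  intro t ht
  rcases le_total t z with h' | h'
  · exact hlt t ht h'
  · have B2 : ∀ q, z ≤ q → 0 < x.v2 q := fun q hq => by
      have := mono_le x.d2 hq (fun r hr => (h3pos r hr.1.le).le)
      linarith [(hA z ⟨hz1.le, le_rfl⟩).1]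
    have := mono_le x.d1 h' (fun r hr => (B2 r hr.1.le).le)
    linarith

/-! ### Touch -/

theorem touch {P : ℝ} {x : Cur} (h : IsSol P x) {s : ℝ} (h0 : x.v0 s = 1)
    (h1 : x.v1 s = 0) (h2 : x.v2 s < 0) (h3 : x.v3 s ≤ 0) :
    ∃ t, s < t ∧ (∀ r ∈ Ioo s t, x.v1 r < 0) ∧ x.v1 t = 0 ∧ x.v0 t < 0 ∧
      ∀ r, t < r → 0 < x.v1 r := by
  have hP := h.pos
  obtain ⟨z, t, sz, zt, vz, hA, hneg, v1t, v0t, v2t⟩ := estep h (by rw [h0]; norm_num) h0.le h1 h2 h3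
  refine ⟨t, sz.trans zt, hneg, v1t, v0t, ?_⟩
  have hq : x.v2 s ≤ -(577 / 1000) := by
    have := h.crit_v2 h1
    rw [h0, FF_mid (by norm_num) (by norm_num)] at this
    nlinarith
  have hAz := hA z ⟨sz.le, le_rfl⟩
  have hpz : x.v1 z ≤ -1 := by
    have := mono_le (f := fun t => x.v1 t ^ 2 + 2 * (577 / 1000) * x.v0 t)
      (f' := fun t => (2 : ℕ) * x.v1 t ^ (2 - 1) * x.v2 t + 2 * (577 / 1000) * x.v1 t)
      (fun t => ((x.d1 t).pow 2).add ((x.d0 t).const_mul _)) sz.le (fun r hr => by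
        obtain ⟨-, b2, -, b1, -⟩ := hA r ⟨hr.1.le, hr.2.le⟩
        norm_num
        nlinarith)
    simp only [h0, h1, vz] at this
    nlinarith [hAz.2.2.2.1]
  have deepv : x.v0 t ≤ -(3 / 5) := by
    by_contra hc
    push Not at hc
    have mon : ∀ r ∈ Icc z t, -(3 / 5) ≤ x.v0 r ∧ x.v0 r ≤ 0 := fun r hr => by
      have a1 := anti_le x.d0 hr.1 (fun q hq => (hneg q ⟨by linarith [hq.1], by linarith [hq.2, hr.2]⟩).le)
      have a2 := anti_le x.d0 hr.2 (fun q hq => (hneg q ⟨by linarith [hq.1, hr.1], by linarith [hq.2]⟩).le)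
      constructor <;> linarith
    have v2neg : ∀ r ∈ Icc z t, r ≤ z + 3 / 5 → x.v2 r < 0 := by
      by_contra hcc
      push Not at hcc
      obtain ⟨r, hr, hr5, hr'⟩ := hcc
      obtain ⟨q, hq1, hq2, hq3, hq4⟩ := first_zero x.c2 hr.1 (by linarith [hAz.2.1]) hr'
      have B1 : ∀ u ∈ Icc z q, x.v1 u ≤ x.v1 z := fun u hu =>
        anti_le x.d1 hu.1 (fun w hw => (hq4 w ⟨hw.1.le, hw.2.trans_le hu.2⟩).le)
      have B3 : ∀ u ∈ Icc z q, x.v3 u ≤ 24 / 25 * (3 / 5) := fun u hu => by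
        have := incr_le (f := fun t => x.v3 t - P * x.v1 t) (f' := fun s => P * x.v2 s + ff (x.v0 s) - P * x.v2 s)
          (fun s => (h.eq s).sub ((x.d1 s).const_mul P)) (m := 24 / 25) hu.1 (fun w hw => by
            obtain ⟨c1, c2⟩ := mon w ⟨hw.1.le, by linarith [hw.2, hu.2, hr.2]⟩
            rw [ff_mid (by linarith) (by linarith)]
            nlinarith)
        have b1 := B1 u hu
        have : P * x.v1 u ≤ P * x.v1 z := by nlinarith
        have : u - z ≤ 3 / 5 := by linarith [hu.2]
        linarith [hAz.2.2.1]
      have := incr_le x.d2 hq1.le (m := 24 / 25 * (3 / 5)) (fun w hw => B3 w ⟨hw.1.le, hw.2.le⟩)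
      have : q - z ≤ 3 / 5 := by linarith
      nlinarith [hAz.2.1]
    rcases le_total t (z + 3 / 5) with h' | h'
    · have := anti_le x.d1 zt.le (fun r hr => (v2neg r ⟨hr.1.le, hr.2.le⟩ (by linarith [hr.2])).le)
      linarith
    · have B1 : ∀ u ∈ Icc z (z + 3 / 5), x.v1 u ≤ -1 := fun u hu =>
        (anti_le x.d1 hu.1 (fun r hr => (v2neg r ⟨hr.1.le, by linarith [hr.2, hu.2]⟩
          (by linarith [hr.2, hu.2])).le)).trans hpz
      have := incr_le x.d0 (show z ≤ z + 3 / 5 by linarith) (m := -1) (fun w hw => B1 w ⟨hw.1.le, hw.2.le⟩)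
      have := (anti_le x.d0 h' (fun q hq => (hneg q ⟨by linarith [hq.1], hq.2⟩).le))
      linarith
  refine deep h deepv v1t v2t ?_
  have hN := mono_le h.eq.dN (sz.trans zt).le (fun r hr => h.N'_nonneg (by
    have := anti_le x.d0 hr.1.le (fun q hq => (hneg q ⟨hq.1, hq.2.trans hr.2⟩).le)
    linarith))
  simp only [NN, h1, h0, v1t] at hN
  by_contra hc
  push Not at hc
  nlinarith




/-! ### Sequences of alternating critical points -/

theorem sg_cases (i : ℕ) : ((-1 : ℝ) ^ i = 1) ∨ ((-1 : ℝ) ^ i = -1) := neg_one_pow_eq_or ℝ i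

theorem sg_sq (i : ℕ) : ((-1 : ℝ) ^ i) * ((-1 : ℝ) ^ i) = 1 := by
  rcases sg_cases i with h | h <;> rw [h] <;> norm_num

theorem sg_succ (i : ℕ) : (-1 : ℝ) ^ (i + 1) = -(-1 : ℝ) ^ i := by rw [pow_succ]; ring

structure SeqT (x : Cur) (n : ℕ) (t : ℕ → ℝ) : Prop where
  t0 : t 0 = 0
  c1 : ∀ i ≤ n, x.v1 (t i) = 0
  c0 : ∀ i ≤ n, 0 < (-1 : ℝ) ^ i * x.v0 (t i)
  c2 : ∀ i ≤ n, (-1 : ℝ) ^ i * x.v2 (t i) < 0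
  lt : ∀ i < n, t i < t (i + 1)
  sg : ∀ i < n, ∀ r ∈ Ioo (t i) (t (i + 1)), (-1 : ℝ) ^ i * x.v1 r < 0

noncomputable def tt (x : Cur) : ℕ → ℝ
  | 0 => 0
  | i + 1 => sInf {r | tt x i < r ∧ x.v1 r = 0}

theorem tt_succ {x : Cur} {i : ℕ} {t : ℝ} (h : tt x i < t) (h1 : x.v1 t = 0)
    (h2 : ∀ r ∈ Ioo (tt x i) t, x.v1 r ≠ 0) : tt x (i + 1) = t := by
  have : IsLeast {r | tt x i < r ∧ x.v1 r = 0} t := by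
    refine ⟨⟨h, h1⟩, fun r hr => ?_⟩
    by_contra hc
    push Not at hc
    exact h2 r ⟨hr.1, hc⟩ hr.2
  exact this.csInf_eq

theorem SeqT.eq_tt {x : Cur} {n : ℕ} {t : ℕ → ℝ} (h : SeqT x n t) : ∀ i ≤ n, tt x i = t i := by
  intro i
  induction i with
  | zero => intro _; rw [h.t0]; rfl
  | succ k ih =>
    intro hk
    have e := ih (by omega)
    refine tt_succ (by rw [e]; exact h.lt k (by omega)) (h.c1 _ hk) (fun r hr hr' => ?_)
    rw [e] at hr
    have := h.sg k (by omega) r hr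
    rw [hr'] at this
    linarith

def Alt (x : Cur) (n : ℕ) : Prop := SeqT x n (tt x)

theorem SeqT.alt {x : Cur} {n : ℕ} {t : ℕ → ℝ} (h : SeqT x n t) : Alt x n := by
  have e := h.eq_tt
  constructor
  · rfl
  · intro i hi; rw [e i hi]; exact h.c1 i hi
  · intro i hi; rw [e i hi]; exact h.c0 i hi
  · intro i hi; rw [e i hi]; exact h.c2 i hi
  · intro i hi; rw [e i hi.le, e (i + 1) hi]; exact h.lt i hi
  · intro i hi; rw [e i hi.le, e (i + 1) hi]; exact h.sg i hi

theorem Alt.mono {x : Cur} {n m : ℕ} (h : Alt x n) (hm : m ≤ n) : Alt x m :=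
  ⟨rfl, fun i hi => h.c1 i (hi.trans hm), fun i hi => h.c0 i (hi.trans hm),
    fun i hi => h.c2 i (hi.trans hm), fun i hi => h.lt i (hi.trans_le hm),
    fun i hi => h.sg i (hi.trans_le hm)⟩

theorem alt_zero {x : Cur} (h0 : 0 < x.v0 0) (h1 : x.v1 0 = 0) (h2 : x.v2 0 < 0) : Alt x 0 := by
  constructor
  · rfl
  · intro i hi; obtain rfl : i = 0 := by omega
    exact h1
  · intro i hi; obtain rfl : i = 0 := by omega
    simpa [tt] using h0
  · intro i hi; obtain rfl : i = 0 := by omega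
    simpa [tt] using h2
  · intro i hi; omega
  · intro i hi; omega

theorem Alt.succ {x : Cur} {n : ℕ} (h : Alt x n) {t : ℝ} (ht : tt x n < t) (h1 : x.v1 t = 0)
    (h0 : (-1 : ℝ) ^ n * x.v0 t < 0) (h2 : 0 < (-1 : ℝ) ^ n * x.v2 t)
    (hs : ∀ r ∈ Ioo (tt x n) t, (-1 : ℝ) ^ n * x.v1 r < 0) : Alt x (n + 1) ∧ tt x (n + 1) = t := by
  have e : tt x (n + 1) = t := tt_succ ht h1 (fun r hr hr' => by
    have := hs r hr
    rw [hr'] at this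
    linarith)
  refine ⟨?_, e⟩
  have key : ∀ i ≤ n + 1, i ≤ n ∨ i = n + 1 := fun i hi => by omega
  have key' : ∀ i < n + 1, i < n ∨ i = n := fun i hi => by omega
  constructor
  · rfl
  · intro i hi; rcases key i hi with hi | rfl
    · exact h.c1 i hi
    · rw [e, h1]
  · intro i hi; rcases key i hi with hi | rfl
    · exact h.c0 i hi
    · rw [e, sg_succ]; linarith
  · intro i hi; rcases key i hi with hi | rfl
    · exact h.c2 i hi
    · rw [e, sg_succ]; linarith
  · intro i hi; rcases key' i hi with hi | rfl
    · exact h.lt i hi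
    · rw [e]; exact ht
  · intro i hi; rcases key' i hi with hi | rfl
    · exact h.sg i hi
    · rw [e]; exact hs

noncomputable def kap (x : Cur) (i : ℕ) : ℝ := (-1 : ℝ) ^ i * x.v3 (tt x i)
noncomputable def hgt (x : Cur) (i : ℕ) : ℝ := x.v0 (tt x i)

theorem Alt.lt_of {x : Cur} {n : ℕ} (h : Alt x n) {i j : ℕ} (hij : i < j) (hj : j ≤ n) :
    tt x i < tt x j := by
  induction j with
  | zero => omega
  | succ k ih =>
    rcases Nat.lt_succ_iff_lt_or_eq.1 hij with hik | rfl
    · exact (ih hik (by omega)).trans (h.lt k (by omega))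
    · exact h.lt i (by omega)

theorem Alt.le_of {x : Cur} {n : ℕ} (h : Alt x n) {i j : ℕ} (hij : i ≤ j) (hj : j ≤ n) :
    tt x i ≤ tt x j := by
  rcases hij.eq_or_lt with rfl | h'
  · exact le_rfl
  · exact (h.lt_of h' hj).le

theorem Alt.nonneg {x : Cur} {n : ℕ} (h : Alt x n) {i : ℕ} (hi : i ≤ n) : 0 ≤ tt x i :=
  h.le_of (Nat.zero_le i) hi

/-- locate a point -/
theorem Alt.locate {x : Cur} {n : ℕ} (h : Alt x n) {m : ℕ} (hm : m < n) {r : ℝ}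
    (hr : r ∈ Icc (tt x m) (tt x n)) :
    ∃ i, m ≤ i ∧ i < n ∧ r ∈ Icc (tt x i) (tt x (i + 1)) := by
  induction n with
  | zero => omega
  | succ k ih =>
    rcases le_total (tt x k) r with h' | h'
    · exact ⟨k, by omega, by omega, h', hr.2⟩
    · rcases (Nat.lt_succ_iff_lt_or_eq.1 hm) with hk | rfl
      · obtain ⟨i, h1, h2, h3⟩ := ih (h.mono (by omega)) hk ⟨hr.1, h'⟩
        exact ⟨i, h1, by omega, h3⟩
      · exact ⟨m, le_rfl, by omega, hr.1, hr.2⟩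

theorem Alt.sg_le {x : Cur} {n : ℕ} (h : Alt x n) {i : ℕ} (hi : i < n) {r : ℝ}
    (hr : r ∈ Icc (tt x i) (tt x (i + 1))) : (-1 : ℝ) ^ i * x.v1 r ≤ 0 := by
  rcases hr.1.eq_or_lt with h1 | h1
  · rw [← h1, h.c1 i hi.le]; simp
  rcases hr.2.eq_or_lt with h2 | h2
  · rw [h2, h.c1 (i + 1) hi]; simp
  exact (h.sg i hi r ⟨h1, h2⟩).le

theorem Alt.even_pos {x : Cur} {n : ℕ} (h : Alt x n) {i : ℕ} (hi : i ≤ n) (he : Even i) :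
    0 < hgt x i ∧ x.v2 (tt x i) < 0 := by
  have h0 := h.c0 i hi
  have h2 := h.c2 i hi
  rw [he.neg_one_pow] at h0 h2
  exact ⟨by simpa [hgt] using h0, by simpa using h2⟩

theorem Alt.odd_neg {x : Cur} {n : ℕ} (h : Alt x n) {i : ℕ} (hi : i ≤ n) (he : Odd i) :
    hgt x i < 0 ∧ 0 < x.v2 (tt x i) := by
  have h0 := h.c0 i hi
  have h2 := h.c2 i hi
  rw [he.neg_one_pow] at h0 h2
  exact ⟨by simp only [hgt]; linarith, by linarith⟩

theorem kap_even {x : Cur} {i : ℕ} (he : Even i) : kap x i = x.v3 (tt x i) := by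
  rw [kap, he.neg_one_pow, one_mul]

theorem kap_odd {x : Cur} {i : ℕ} (he : Odd i) : kap x i = - x.v3 (tt x i) := by
  rw [kap, he.neg_one_pow]; ring

theorem kap_eq_zero {x : Cur} {i : ℕ} : kap x i = 0 ↔ x.v3 (tt x i) = 0 := by
  rcases sg_cases i with h | h <;> simp [kap, h]

theorem Alt.hgt_lt {P : ℝ} {x : Cur} (hx : IsSol P x) {n : ℕ} (h : Alt x n) {i : ℕ} (hi : i ≤ n) :
    hgt x i < 3 / 2 := by
  have h2 := h.c2 i hi
  have e := hx.crit_v2 (h.c1 i hi)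
  have hne : x.v2 (tt x i) ≠ 0 := by
    intro h'; rw [h'] at h2; simp at h2
  have hF : FF (hgt x i) < 0 := by
    have : 0 < x.v2 (tt x i) ^ 2 := by positivity
    simp only [hgt]
    linarith
  rcases lt_trichotomy (hgt x i) (3 / 2) with hlt | hlt | hlt
  · exact hlt
  · rw [hlt, FF_mid (by norm_num) (by norm_num)] at hF
    norm_num at hF
  · linarith [FF_pos hlt]

/-- between consecutive critical points the value lies between. -/
theorem Alt.between {x : Cur} {n : ℕ} (h : Alt x n) {i : ℕ} (hi : i < n) {r : ℝ}
    (hr : r ∈ Icc (tt x i) (tt x (i + 1))) :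
    min (hgt x i) (hgt x (i + 1)) ≤ x.v0 r ∧ x.v0 r ≤ max (hgt x i) (hgt x (i + 1)) := by
  have hs : ∀ q ∈ Icc (tt x i) (tt x (i + 1)), (-1 : ℝ) ^ i * x.v1 q ≤ 0 := fun q hq => h.sg_le hi hq
  rcases sg_cases i with e | e
  · rw [e] at hs
    have a := anti_le x.d0 hr.1 (fun q hq => by
      have := hs q ⟨hq.1.le, hq.2.le.trans hr.2⟩; linarith)
    have b := anti_le x.d0 hr.2 (fun q hq => by
      have := hs q ⟨hr.1.trans hq.1.le, hq.2.le⟩; linarith)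
    exact ⟨(min_le_right _ _).trans b, a.trans (le_max_left _ _)⟩
  · rw [e] at hs
    have a := mono_le x.d0 hr.1 (fun q hq => by
      have := hs q ⟨hq.1.le, hq.2.le.trans hr.2⟩; linarith)
    have b := mono_le x.d0 hr.2 (fun q hq => by
      have := hs q ⟨hr.1.trans hq.1.le, hq.2.le⟩; linarith)
    exact ⟨(min_le_left _ _).trans a, b.trans (le_max_right _ _)⟩

theorem Alt.v0_le {x : Cur} {n : ℕ} (h : Alt x n) {m : ℕ} (hm : m ≤ n) {B : ℝ} (hB0 : 0 ≤ B)
    (hB : ∀ i, m ≤ i → i ≤ n → Even i → hgt x i ≤ B) {r : ℝ} (hr : r ∈ Icc (tt x m) (tt x n)) :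
    x.v0 r ≤ B := by
  have hB' : ∀ i, m ≤ i → i ≤ n → hgt x i ≤ B := fun i h1 h2 => by
    rcases Nat.even_or_odd i with he | he
    · exact hB i h1 h2 he
    · linarith [(h.odd_neg h2 he).1]
  rcases hm.eq_or_lt with rfl | hm
  · have : r = tt x m := le_antisymm hr.2 hr.1
    rw [this]; exact hB' m le_rfl le_rfl
  obtain ⟨i, h1, h2, h3⟩ := h.locate hm hr
  exact (h.between h2 h3).2.trans (max_le (hB' i h1 h2.le) (hB' (i + 1) (by omega) h2))

theorem Alt.v0_le32 {P : ℝ} {x : Cur} (hx : IsSol P x) {n : ℕ} (h : Alt x n) {r : ℝ}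
    (hr : r ∈ Icc 0 (tt x n)) : x.v0 r ≤ 3 / 2 :=
  h.v0_le (Nat.zero_le n) (by norm_num) (fun _ _ hi _ => (h.hgt_lt hx hi).le) hr

/-- depth bound for minima -/
theorem Alt.odd_gt {P : ℝ} {x : Cur} (hx : IsSol P x) {n : ℕ} (h : Alt x n) {i : ℕ} (hi : i + 1 ≤ n)
    (ho : Odd i) : -(3 / 5) < hgt x i := by
  by_contra hc
  push Not at hc
  have h2 := (h.odd_neg (by omega) ho).2
  have h1 := h.c1 i (by omega)
  rcases le_total 0 (x.v3 (tt x i)) with h3 | h3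
  · have := deep hx hc h1 h2 h3 _ (h.lt_of (Nat.lt_succ_self i) hi)
    rw [h.c1 (i + 1) hi] at this
    linarith
  · have hpos : 0 < tt x i := h.lt_of (i := 0) ho.pos (by omega)
    have := deep (hx.rev 0) (s := - tt x i) (by simpa [Cur.rev, hgt] using hc) (by simpa [Cur.rev] using h1)
      (by simpa [Cur.rev] using h2) (by simpa [Cur.rev] using h3) 0 (by linarith)
    have e := h.c1 0 (by omega)
    simp only [Cur.rev, sub_self] at this
    simp only [tt] at e
    rw [e] at this
    simp at this

theorem touch_fwd {P : ℝ} {x : Cur} (hx : IsSol P x) {i : ℕ} (h : Alt x (i + 2)) (he : Even i)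
    (h0 : hgt x i = 1) (hk : kap x i ≤ 0) : False := by
  obtain ⟨t, h1, h2, h3, -, h5⟩ := touch hx h0 (h.c1 i (by omega)) (h.even_pos (by omega) he).2
    (by rwa [kap_even he] at hk)
  have a1 := h.lt_of (i := i) (j := i + 1) (by omega) (by omega)
  have a2 := h.lt_of (i := i + 1) (j := i + 2) (by omega) (by omega)
  have b1 := h.c1 (i + 1) (by omega)
  have b2 := h.c1 (i + 2) (by omega)
  have c1 : t ≤ tt x (i + 1) := by
    by_contra hc
    push Not at hc
    linarith [h2 _ ⟨a1, hc⟩]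
  linarith [h5 (tt x (i + 2)) (by linarith)]

theorem touch_rev {P : ℝ} {x : Cur} (hx : IsSol P x) {i n : ℕ} (h : Alt x n) (hi : i ≤ n) (h2 : 2 ≤ i)
    (he : Even i) (h0 : hgt x i = 1) (hk : 0 ≤ kap x i) : False := by
  obtain ⟨t, h1, h2, h3, -, h5⟩ := touch (hx.rev 0) (s := - tt x i) (by simpa [Cur.rev, hgt] using h0)
    (by simpa [Cur.rev] using (h.c1 i (by omega)))
    (by simpa [Cur.rev] using (h.even_pos (by omega) he).2)
    (by simpa [Cur.rev] using (by rwa [kap_even he] at hk : 0 ≤ x.v3 (tt x i)))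
  have a1 := h.lt_of (i := i - 1) (j := i) (by omega) (by omega)
  have a2 := h.lt_of (i := i - 2) (j := i - 1) (by omega) (by omega)
  have b1 := h.c1 (i - 1) (by omega)
  have b2 := h.c1 (i - 2) (by omega)
  have c1 : t ≤ - tt x (i - 1) := by
    by_contra hc
    push Not at hc
    have := h2 _ ⟨by linarith, hc⟩
    simp [Cur.rev, b1] at this
  have := h5 (- tt x (i - 2)) (by linarith)
  simp [Cur.rev, b2] at this

/-! ### N at critical points -/

theorem NN_crit {P : ℝ} {x : Cur} {n : ℕ} (h : Alt x n) {i : ℕ} (hi : i ≤ n) :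
    NN P x (tt x i) = - (((-1 : ℝ) ^ i * x.v0 (tt x i)) * kap x i) := by
  have := sg_sq i
  rw [NN, h.c1 i hi, kap]
  linear_combination (x.v0 (tt x i) * x.v3 (tt x i)) * this

theorem kap_neg_of_le_one {P : ℝ} {x : Cur} (hx : IsSol P x) (h3 : x.v3 0 = 0) {n : ℕ} (h : Alt x n)
    {i : ℕ} (hi : i ≤ n) (h1i : 1 ≤ i) (hle : ∀ r ∈ Icc 0 (tt x i), x.v0 r ≤ 1) : kap x i < 0 := by
  have e0 : NN P x (tt x 0) = 0 := by
    rw [NN_crit h (Nat.zero_le n)]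
    simp [kap, tt, h3]
  have hP := hx.pos
  have h01 : tt x 1 ≤ tt x i := h.le_of h1i hi
  have a : NN P x (tt x 0) < NN P x (tt x 1) := mono_lt hx.eq.dN (h.lt_of one_pos (by omega)) (fun r hr => by
    have r1 := h.sg 0 (by omega) r hr
    have r2 : x.v1 r ≠ 0 := by intro h'; rw [h'] at r1; simp at r1
    have r3 := v_ff_nonpos (hle r ⟨hr.1.le, hr.2.le.trans h01⟩)
    have : 0 < P * x.v1 r ^ 2 := by positivity
    have : 0 ≤ x.v2 r ^ 2 := by positivity
    simp only [NN']
    linarith)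
  have b := mono_le hx.eq.dN h01 (fun r hr => hx.N'_nonneg (hle r ⟨by
    have := h.nonneg (i := 1) (by omega)
    linarith [hr.1], hr.2.le⟩))
  have c := NN_crit (P := P) h hi
  have d := h.c0 i hi
  by_contra hc
  push Not at hc
  nlinarith

/-! ### Gap -/

theorem gap {P : ℝ} {x : Cur} (hx : IsSol P x) {s t : ℝ} (hst : s < t) (hs : x.v1 s = 0)
    (ht : x.v1 t = 0) (hv : x.v0 s * x.v0 t < 0) : 1 / 3 ≤ t - s := by
  by_contra hc
  push Not at hc
  set Δ := t - s with hΔ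
  have hΔ0 : 0 < Δ := by linarith
  have hP := hx.pos
  have hP2 := hx.lt
  have b2 : ∀ q, x.v1 q = 0 → |x.v2 q| ≤ 2 * |x.v0 q| := fun q hq => by
    have e := hx.crit_v2 hq
    have f := FF_ge (x.v0 q)
    have : x.v2 q ^ 2 ≤ (2 * |x.v0 q|) ^ 2 := by
      rw [mul_pow, sq_abs]; nlinarith
    exact abs_le_of_sq_le_sq this (by positivity)
  obtain ⟨m, hm, hmax⟩ := (isCompact_Icc (a := s) (b := t)).exists_isMaxOn ⟨s, le_rfl, hst.le⟩
    (continuous_abs.comp x.c3).continuousOn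
  set M := |x.v3 m| with hM
  have hM0 : 0 ≤ M := abs_nonneg _
  have h3 : ∀ q ∈ Icc s t, |x.v3 q| ≤ M := fun q hq => hmax hq
  -- zero of v0
  obtain ⟨ξ, hξ, hξ0⟩ : ∃ ξ ∈ Icc s t, x.v0 ξ = 0 := by
    have hc := x.c0.continuousOn (s := Icc s t)
    rcases lt_or_ge (x.v0 s) 0 with h | h
    · have : 0 < x.v0 t := by by_contra h'; push Not at h'; nlinarith
      exact intermediate_value_Icc hst.le hc ⟨h.le, this.le⟩
    · have : x.v0 t < 0 := by by_contra h'; push Not at h'; nlinarith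
      exact intermediate_value_Icc' hst.le hc ⟨this.le, h⟩
  obtain ⟨η, hη, hη0⟩ := exists_hasDerivAt_eq_slope x.v1 x.v2 hst
    (fun t _ => (x.d1 t).continuousAt.continuousWithinAt) (fun t _ => x.d1 t)
  rw [hs, ht, sub_self, zero_div] at hη0
  have e2 : ∀ q ∈ Icc s t, |x.v2 q| ≤ M * Δ := fun q hq => by
    have := bd_incr x.d2 h3 hΔ.symm.le η q ⟨hη.1.le, hη.2.le⟩ hq
    rwa [hη0, abs_zero, zero_add] at this
  have e1 : ∀ q ∈ Icc s t, |x.v1 q| ≤ M * Δ * Δ := fun q hq => by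
    have := bd_incr x.d1 e2 hΔ.symm.le s q ⟨le_rfl, hst.le⟩ hq
    rwa [hs, abs_zero, zero_add] at this
  have e0 : ∀ q ∈ Icc s t, |x.v0 q| ≤ M * Δ * Δ * Δ := fun q hq => by
    have := bd_incr x.d0 e1 hΔ.symm.le ξ q hξ hq
    rwa [hξ0, abs_zero, zero_add] at this
  obtain ⟨ζ, hζ, hζ0⟩ := exists_hasDerivAt_eq_slope x.v2 x.v3 hst
    (fun t _ => (x.d2 t).continuousAt.continuousWithinAt) (fun t _ => x.d2 t)
  have e3 : |x.v3 ζ| ≤ 4 * (M * Δ * Δ) := by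
    rw [hζ0, abs_div, abs_of_pos hΔ0, div_le_iff₀ hΔ0]
    have q1 := b2 s hs
    have q2 := b2 t ht
    have q3 := e0 s ⟨le_rfl, hst.le⟩
    have q4 := e0 t ⟨hst.le, le_rfl⟩
    have q5 := abs_sub (x.v2 t) (x.v2 s)
    nlinarith
  have e4 : ∀ q ∈ Icc s t, |P * x.v2 q + ff (x.v0 q)| ≤ 2 * (M * Δ) + 3 * (M * Δ * Δ * Δ) := fun q hq => by
    have q1 := e2 q hq
    have q2 := e0 q hq
    have q3 := ff_abs (x.v0 q)
    calc |P * x.v2 q + ff (x.v0 q)| ≤ |P * x.v2 q| + |ff (x.v0 q)| := abs_add_le _ _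
      _ ≤ 2 * (M * Δ) + 3 * (M * Δ * Δ * Δ) := by
        rw [abs_mul, abs_of_pos hP]
        have := abs_nonneg (x.v2 q)
        nlinarith
  have e5 := bd_incr hx.eq e4 hΔ.symm.le ζ m ⟨hζ.1.le, hζ.2.le⟩ hm
  rw [← hM] at e5
  have hMpos : 0 < M := by
    rcases hM0.eq_or_lt with h | h
    · have := e0 s ⟨le_rfl, hst.le⟩
      rw [← h] at this
      simp at this
      rw [this] at hv
      simp at hv
    · exact h
  have f2 : Δ * Δ ≤ 1 / 9 := by nlinarith
  have f4 : (Δ * Δ) * (Δ * Δ) ≤ 1 / 81 := by nlinarith [mul_nonneg hΔ0.le hΔ0.le]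
  have : M ≤ M * (6 * (Δ * Δ) + 3 * ((Δ * Δ) * (Δ * Δ))) := by linarith
  nlinarith

theorem Alt.gap {P : ℝ} {x : Cur} (hx : IsSol P x) {n : ℕ} (h : Alt x n) {i : ℕ} (hi : i < n) :
    1 / 3 ≤ tt x (i + 1) - tt x i := by
  refine Pulse.gap hx (h.lt i hi) (h.c1 i hi.le) (h.c1 (i + 1) hi) ?_
  have a := h.c0 i hi.le
  have b := h.c0 (i + 1) hi
  rw [sg_succ] at b
  have := sg_sq i
  rcases sg_cases i with e | e <;> rw [e] at a b <;> nlinarith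

theorem Alt.tt_ge {P : ℝ} {x : Cur} (hx : IsSol P x) {n : ℕ} (h : Alt x n) {i : ℕ} (hi : i ≤ n) :
    (i : ℝ) / 3 ≤ tt x i := by
  induction i with
  | zero => simp [tt]
  | succ k ih =>
    have := ih (by omega)
    have := h.gap hx (i := k) (by omega)
    push_cast
    linarith




/-! ### Convergence along moving times -/

theorem Conv.tendsto {ι : Type} {l : Filter ι} {x : ι → Cur} {y : Cur} (h : Conv l x y) {t : ι → ℝ}
    {s : ℝ} (ht : Tendsto t l (𝓝 s)) (h0 : ∀ᶠ k in l, 0 ≤ t k) :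
    Tendsto (fun k => (x k).v0 (t k)) l (𝓝 (y.v0 s)) ∧
    Tendsto (fun k => (x k).v1 (t k)) l (𝓝 (y.v1 s)) ∧
    Tendsto (fun k => (x k).v2 (t k)) l (𝓝 (y.v2 s)) ∧
    Tendsto (fun k => (x k).v3 (t k)) l (𝓝 (y.v3 s)) := by
  have hT : ∀ᶠ k in l, t k ∈ Icc 0 (s + 1) := by
    filter_upwards [h0, ht.eventually (gt_mem_nhds (show s < s + 1 by linarith))] with k a b
    exact ⟨a, b.le⟩
  have key : ∀ (f : Cur → ℝ → ℝ), Continuous (f y) →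
      (∀ T ε : ℝ, 0 < ε → ∀ᶠ k in l, ∀ t ∈ Icc 0 T, |f (x k) t - f y t| < ε) →
      Tendsto (fun k => f (x k) (t k)) l (𝓝 (f y s)) := by
    intro f hf hc
    have h1 : Tendsto (fun k => f y (t k)) l (𝓝 (f y s)) := (hf.tendsto s).comp ht
    have h2 : Tendsto (fun k => f (x k) (t k) - f y (t k)) l (𝓝 0) := by
      rw [Metric.tendsto_nhds]
      intro ε hε
      filter_upwards [hT, hc (s + 1) ε hε] with k a b
      simpa [Real.dist_eq] using b _ a
    simpa using h2.add h1
  refine ⟨key Cur.v0 y.c0 ?_, key Cur.v1 y.c1 ?_, key Cur.v2 y.c2 ?_, key Cur.v3 y.c3 ?_⟩ <;>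
    intro T ε hε <;> filter_upwards [h T ε hε] with k hk t ht
  exacts [(hk t ht).1, (hk t ht).2.1, (hk t ht).2.2.1, (hk t ht).2.2.2]

theorem Conv.mono {ι : Type} {l l' : Filter ι} {x : ι → Cur} {y : Cur} (h : Conv l x y) (hl : l' ≤ l) :
    Conv l' x y := fun T ε hε => hl (h T ε hε)

theorem Conv.comp {ι κ : Type} {l : Filter ι} {l' : Filter κ} {x : ι → Cur} {y : Cur} (h : Conv l x y)
    {u : κ → ι} (hu : Tendsto u l' l) : Conv l' (fun k => x (u k)) y :=
  fun T ε hε => hu.eventually (h T ε hε)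

theorem cpt_neg {f : ℝ → ℝ} (hf : Continuous f) {a b : ℝ} (h : ∀ t ∈ Icc a b, f t < 0) :
    ∃ m, 0 < m ∧ ∀ t ∈ Icc a b, f t < -m := by
  rcases lt_or_ge b a with hab | hab
  · exact ⟨1, one_pos, fun t ht => by linarith [ht.1, ht.2]⟩
  obtain ⟨c, hc, hmax⟩ := isCompact_Icc.exists_isMaxOn ⟨a, le_rfl, hab⟩ hf.continuousOn
  refine ⟨- f c / 2, by linarith [h c hc], fun t ht => ?_⟩
  have : f t ≤ f c := hmax ht
  linarith [h c hc]

theorem near_neg {f : ℝ → ℝ} (hf : Continuous f) {s : ℝ} (h : f s < 0) :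
    ∃ δ, 0 < δ ∧ ∀ t, |t - s| ≤ δ → f t < 0 := by
  have hev := (isOpen_Iio.preimage hf).mem_nhds (show s ∈ f ⁻¹' Iio 0 from h)
  obtain ⟨ε, hε, hball⟩ := Metric.mem_nhds_iff.1 hev
  refine ⟨ε / 2, by linarith, fun t ht => hball ?_⟩
  rw [Metric.mem_ball, Real.dist_eq]
  linarith

/-! ### Perturbation -/

theorem perturb_step {ι : Type} {l : Filter ι} {x : ι → Cur} {y : Cur} (h : Conv l x y) {n : ℕ}
    (hy : Alt y (n + 1)) (hn : ∀ᶠ k in l, Alt (x k) n)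
    (ht : Tendsto (fun k => tt (x k) n) l (𝓝 (tt y n))) :
    (∀ᶠ k in l, Alt (x k) (n + 1)) ∧ Tendsto (fun k => tt (x k) (n + 1)) l (𝓝 (tt y (n + 1))) := by
  set s := tt y n with hs
  set r := tt y (n + 1) with hr
  set σ := (-1 : ℝ) ^ n with hσ
  have hσ1 : |σ| = 1 := by rcases sg_cases n with e | e <;> rw [hσ, e] <;> norm_num
  have hsr : s < r := hy.lt n (by omega)
  have hs0 : 0 ≤ s := hy.nonneg (by omega)
  have y1s : y.v1 s = 0 := hy.c1 n (by omega)
  have y1r : y.v1 r = 0 := hy.c1 (n + 1) le_rfl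
  have y2s : σ * y.v2 s < 0 := hy.c2 n (by omega)
  have y2r : -(σ * y.v2 r) < 0 := by
    have := hy.c2 (n + 1) le_rfl
    rw [sg_succ] at this
    linarith
  have y0r : σ * y.v0 r < 0 := by
    have := hy.c0 (n + 1) le_rfl
    rw [sg_succ] at this
    linarith
  have ysg : ∀ q ∈ Ioo s r, σ * y.v1 q < 0 := hy.sg n (by omega)
  have key : ∀ ε, 0 < ε → ∀ᶠ k in l, Alt (x k) (n + 1) ∧ |tt (x k) (n + 1) - r| ≤ ε := by
    intro ε hε
    obtain ⟨δ1, hδ1, H1⟩ := near_neg (y.c2.const_mul σ) y2s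
    obtain ⟨δ2, hδ2, H2⟩ := near_neg (f := fun q => -(σ * y.v2 q)) (y.c2.const_mul σ).neg y2r
    obtain ⟨δ3, hδ3, H3⟩ := near_neg (y.c0.const_mul σ) y0r
    obtain ⟨δ, hδ, g1, g2, g3, g4, g5⟩ : ∃ δ, 0 < δ ∧ δ ≤ δ1 ∧ δ ≤ δ2 ∧ δ ≤ δ3 ∧ δ ≤ ε ∧ δ < (r - s) / 2 := by
      refine ⟨min (min δ1 δ2) (min (min δ3 ε) ((r - s) / 3)), ?_, ?_, ?_, ?_, ?_, ?_⟩
      · have : 0 < (r - s) / 3 := by linarith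
        positivity
      · exact (min_le_left _ _).trans (min_le_left _ _)
      · exact (min_le_left _ _).trans (min_le_right _ _)
      · exact (min_le_right _ _).trans ((min_le_left _ _).trans (min_le_left _ _))
      · exact (min_le_right _ _).trans ((min_le_left _ _).trans (min_le_right _ _))
      · exact ((min_le_right _ _).trans (min_le_right _ _)).trans_lt (by linarith)
    obtain ⟨m1, hm1, M1⟩ := cpt_neg (y.c2.const_mul σ) (a := s - δ) (b := s + δ)
      (fun t ht => H1 t (abs_le.2 ⟨by linarith [ht.1], by linarith [ht.2]⟩))
    obtain ⟨m2, hm2, M2⟩ := cpt_neg (f := fun q => -(σ * y.v2 q)) (y.c2.const_mul σ).neg (a := r - δ) (b := r + δ)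
      (fun t ht => H2 t (abs_le.2 ⟨by linarith [ht.1], by linarith [ht.2]⟩))
    obtain ⟨m3, hm3, M3⟩ := cpt_neg (y.c0.const_mul σ) (a := r - δ) (b := r + δ)
      (fun t ht => H3 t (abs_le.2 ⟨by linarith [ht.1], by linarith [ht.2]⟩))
    obtain ⟨m4, hm4, M4⟩ := cpt_neg (y.c1.const_mul σ) (a := s + δ) (b := r - δ)
      (fun t ht => ysg t ⟨by linarith [ht.1], by linarith [ht.2]⟩)
    have hend : 0 < σ * y.v1 (r + δ) := by
      have := mono_lt (f := fun t => σ * y.v1 t) (f' := fun t => σ * y.v2 t)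
        (fun t => (y.d1 t).const_mul σ) (show r < r + δ by linarith) (fun q hq => by
          have := M2 q ⟨by linarith [hq.1], hq.2.le⟩
          linarith)
      simp only [y1r, mul_zero] at this
      exact this
    set m := min (min m1 m2) (min (min m3 m4) (σ * y.v1 (r + δ))) with hm
    have hm0 : 0 < m := by positivity
    have l1 : m ≤ m1 := (min_le_left _ _).trans (min_le_left _ _)
    have l2 : m ≤ m2 := (min_le_left _ _).trans (min_le_right _ _)
    have l3 : m ≤ m3 := (min_le_right _ _).trans ((min_le_left _ _).trans (min_le_left _ _))
    have l4 : m ≤ m4 := (min_le_right _ _).trans ((min_le_left _ _).trans (min_le_right _ _))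
    have l5 : m ≤ σ * y.v1 (r + δ) := (min_le_right _ _).trans (min_le_right _ _)
    filter_upwards [hn, h (r + δ) m hm0, Metric.tendsto_nhds.1 ht δ hδ] with k hk hc hd
    rw [Real.dist_eq, abs_lt] at hd
    have hk0 : 0 ≤ tt (x k) n := hk.nonneg le_rfl
    have tr : ∀ u v : ℝ, |u - v| < m → σ * u < σ * v + m ∧ σ * v < σ * u + m := fun u v huv => by
      have : |σ * u - σ * v| < m := by rw [← mul_sub, abs_mul, hσ1, one_mul]; exact huv
      rw [abs_lt] at this
      constructor <;> linarith [this.1, this.2]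
    -- signs of x k
    have S2s : ∀ q, 0 ≤ q → q ∈ Icc (s - δ) (s + δ) → σ * (x k).v2 q < 0 := fun q h0 hq => by
      have := (tr _ _ (hc q ⟨h0, by linarith [hq.2]⟩).2.2.1).1
      linarith [M1 q hq]
    have S2r : ∀ q ∈ Icc (r - δ) (r + δ), 0 < σ * (x k).v2 q := fun q hq => by
      have := (tr _ _ (hc q ⟨by linarith [hq.1], hq.2⟩).2.2.1).2
      linarith [M2 q hq]
    have S0r : ∀ q ∈ Icc (r - δ) (r + δ), σ * (x k).v0 q < 0 := fun q hq => by
      have := (tr _ _ (hc q ⟨by linarith [hq.1], hq.2⟩).1).1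
      linarith [M3 q hq]
    have S1 : ∀ q ∈ Icc (s + δ) (r - δ), σ * (x k).v1 q < 0 := fun q hq => by
      have := (tr _ _ (hc q ⟨by linarith [hq.1], by linarith [hq.2]⟩).2.1).1
      linarith [M4 q hq]
    have Send : 0 < σ * (x k).v1 (r + δ) := by
      have := (tr _ _ (hc (r + δ) ⟨by linarith, le_rfl⟩).2.1).2
      linarith
    have S1s : ∀ q ∈ Ioc (tt (x k) n) (s + δ), σ * (x k).v1 q < 0 := fun q hq => by
      have := anti_lt (f := fun t => σ * (x k).v1 t) (f' := fun t => σ * (x k).v2 t)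
        (fun t => ((x k).d1 t).const_mul σ) hq.1 (fun u hu => S2s u (by linarith [hu.1])
          ⟨by linarith [hu.1], by linarith [hu.2, hq.2]⟩)
      simp only [hk.c1 n le_rfl, mul_zero] at this
      exact this
    obtain ⟨t, t1, t2, t3, t4⟩ := first_zero ((x k).c1.const_mul σ) (z := r - δ) (w := r + δ) (by linarith)
      (S1 _ ⟨by linarith, le_rfl⟩) Send.le
    have hz : (x k).v1 t = 0 := by
      rcases mul_eq_zero.1 t3 with h' | h'
      · rw [h'] at hσ1; simp at hσ1
      · exact h'
    obtain ⟨A, B⟩ := hk.succ (t := t) (by linarith) hz (S0r t ⟨t1.le, t2⟩) (S2r t ⟨t1.le, t2⟩)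
      (fun q hq => by
        rcases le_total q (s + δ) with h' | h'
        · exact S1s q ⟨hq.1, h'⟩
        rcases le_total q (r - δ) with h'' | h''
        · exact S1 q ⟨h', h''⟩
        · exact t4 q ⟨h'', hq.2⟩)
    refine ⟨A, ?_⟩
    rw [B, abs_le]
    constructor <;> linarith
  refine ⟨(key 1 one_pos).mono (fun k hk => hk.1), ?_⟩
  rw [Metric.tendsto_nhds]
  intro ε hε
  filter_upwards [key (ε / 2) (by linarith)] with k hk
  rw [Real.dist_eq]
  linarith [hk.2]

theorem perturb {ι : Type} {l : Filter ι} {x : ι → Cur} {y : Cur} (h : Conv l x y) {n : ℕ}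
    (h0 : ∀ᶠ k in l, Alt (x k) 0) (hy : Alt y n) :
    (∀ᶠ k in l, Alt (x k) n) ∧ ∀ i ≤ n, Tendsto (fun k => tt (x k) i) l (𝓝 (tt y i)) := by
  induction n with
  | zero =>
    refine ⟨h0, fun i hi => ?_⟩
    obtain rfl : i = 0 := by omega
    exact tendsto_const_nhds
  | succ k ih =>
    obtain ⟨a, b⟩ := ih (hy.mono (by omega))
    obtain ⟨c, d⟩ := perturb_step h hy a (b k le_rfl)
    refine ⟨c, fun i hi => ?_⟩
    rcases Nat.le_succ_iff.1 hi with h' | rfl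
    · exact b i h'
    · exact d

theorem perturb_lim {ι : Type} {l : Filter ι} {x : ι → Cur} {y : Cur} (h : Conv l x y) {n : ℕ}
    (h0 : ∀ᶠ k in l, Alt (x k) 0) (hy : Alt y n) {i : ℕ} (hi : i ≤ n) :
    Tendsto (fun k => hgt (x k) i) l (𝓝 (hgt y i)) ∧ Tendsto (fun k => kap (x k) i) l (𝓝 (kap y i)) := by
  obtain ⟨a, b⟩ := perturb h h0 hy
  have := h.tendsto (b i hi) (by filter_upwards [a] with k hk using hk.nonneg hi)
  exact ⟨this.1, this.2.2.2.const_mul _⟩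

/-! ### Reflection -/

theorem symm_of {P : ℝ} {x : Cur} (hx : IsSol P x) {T : ℝ} (h1 : x.v1 T = 0) (h3 : x.v3 T = 0) (t : ℝ) :
    x.v0 (2 * T - t) = x.v0 t ∧ x.v1 (2 * T - t) = - x.v1 t ∧ x.v2 (2 * T - t) = x.v2 t ∧
      x.v3 (2 * T - t) = - x.v3 t := by
  have e : x.rev (2 * T) = x := by
    refine SolEq.unique hx.pos.le hx.lt.le (hx.eq.rev _) hx.eq T ?_ ?_ ?_ ?_ <;>
      simp only [Cur.rev, show 2 * T - T = T by ring, h1, h3, neg_zero]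
  have a0 := congrArg (fun y => y.v0 t) e
  have a1 := congrArg (fun y => y.v1 t) e
  have a2 := congrArg (fun y => y.v2 t) e
  have a3 := congrArg (fun y => y.v3 t) e
  simp only [Cur.rev] at a0 a1 a2 a3
  exact ⟨a0, by linarith, a2, by linarith⟩

theorem reflect {P : ℝ} {x : Cur} (hx : IsSol P x) {n : ℕ} (h : Alt x n) (hk : kap x n = 0) :
    Alt x (2 * n) ∧ (∀ i ≤ n, tt x (n + i) = 2 * tt x n - tt x (n - i)) := by
  have sy := symm_of hx (h.c1 n le_rfl) (kap_eq_zero.1 hk)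
  set T := tt x n with hT
  let t : ℕ → ℝ := fun i => if i ≤ n then tt x i else 2 * T - tt x (2 * n - i)
  have tle : ∀ i, i ≤ n → t i = tt x i := fun i hi => by simp [t, hi]
  have tge : ∀ i, n ≤ i → t i = 2 * T - tt x (2 * n - i) := fun i hi => by
    rcases hi.eq_or_lt with rfl | hi
    · simp only [t, le_rfl, if_true, show 2 * n - n = n by omega, ← hT]; ring
    · simp [t, not_le.2 hi]
  have sgn : ∀ i ≤ 2 * n, (-1 : ℝ) ^ (2 * n - i) = (-1 : ℝ) ^ i := fun i hi => by
    have : (-1 : ℝ) ^ (2 * n - i) * (-1 : ℝ) ^ i = 1 := by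
      rw [← pow_add, show 2 * n - i + i = 2 * n by omega, pow_mul]; norm_num
    rcases sg_cases i with e | e <;> rw [e] at this ⊢ <;> linarith
  have S : SeqT x (2 * n) t := by
    constructor
    · rw [tle 0 (by omega)]; rfl
    · intro i hi
      rcases le_total i n with h' | h'
      · rw [tle i h']; exact h.c1 i h'
      · rw [tge i h', (sy _).2.1, h.c1 _ (by omega), neg_zero]
    · intro i hi
      rcases le_total i n with h' | h'
      · rw [tle i h']; exact h.c0 i h'
      · rw [tge i h', (sy _).1, ← sgn i hi]; exact h.c0 _ (by omega)
    · intro i hi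
      rcases le_total i n with h' | h'
      · rw [tle i h']; exact h.c2 i h'
      · rw [tge i h', (sy _).2.2.1, ← sgn i hi]; exact h.c2 _ (by omega)
    · intro i hi
      rcases lt_or_ge i n with h' | h'
      · rw [tle i h'.le, tle (i + 1) h']; exact h.lt i h'
      · rw [tge i h', tge (i + 1) (by omega)]
        have := h.lt_of (i := 2 * n - (i + 1)) (j := 2 * n - i) (by omega) (by omega)
        linarith
    · intro i hi r hr
      rcases lt_or_ge i n with h' | h'
      · rw [tle i h'.le, tle (i + 1) h'] at hr; exact h.sg i h' r hr
      · rw [tge i h', tge (i + 1) (by omega)] at hr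
        have e1 : 2 * n - i = (2 * n - (i + 1)) + 1 := by omega
        have := h.sg (2 * n - (i + 1)) (by omega) (2 * T - r) ⟨by linarith [hr.2], by
          rw [← e1]; linarith [hr.1]⟩
        rw [(sy r).2.1, sgn (i + 1) (by omega), sg_succ] at this
        linarith
  refine ⟨S.alt, fun i hi => ?_⟩
  rw [S.eq_tt (n + i) (by omega), tge (n + i) (by omega), show 2 * n - (n + i) = n - i by omega]

theorem reflect_kap {P : ℝ} {x : Cur} (hx : IsSol P x) {n : ℕ} (h : Alt x n) (hk : kap x n = 0)
    {i : ℕ} (hi : i ≤ n) : kap x (n + i) = - kap x (n - i) ∧ hgt x (n + i) = hgt x (n - i) := by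
  obtain ⟨-, e⟩ := reflect hx h hk
  have sy := symm_of hx (h.c1 n le_rfl) (kap_eq_zero.1 hk)
  have sgn : (-1 : ℝ) ^ (n + i) = (-1 : ℝ) ^ (n - i) := by
    rw [show n + i = (n - i) + 2 * i by omega, pow_add, pow_mul]; norm_num
  constructor
  · rw [kap, kap, e i hi, (sy _).2.2.2, sgn]; ring
  · rw [hgt, hgt, e i hi, (sy _).1]

/-! ### Shift -/

theorem shift_alt {x : Cur} {n m : ℕ} (h : Alt x (n + m)) (he : Even n) :
    Alt (x.shift (tt x n)) m ∧ (∀ i ≤ m, tt (x.shift (tt x n)) i = tt x (n + i) - tt x n) := by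
  have sgn : ∀ i, (-1 : ℝ) ^ (n + i) = (-1 : ℝ) ^ i := fun i => by rw [pow_add, he.neg_one_pow, one_mul]
  have S : SeqT (x.shift (tt x n)) m (fun i => tt x (n + i) - tt x n) := by
    constructor
    · simp
    · intro i hi; simpa [Cur.shift] using h.c1 (n + i) (by omega)
    · intro i hi; simpa [Cur.shift, sgn] using h.c0 (n + i) (by omega)
    · intro i hi; simpa [Cur.shift, sgn] using h.c2 (n + i) (by omega)
    · intro i hi
      have := h.lt (n + i) (by omega)
      rw [← add_assoc]
      linarith
    · intro i hi r hr
      have := h.sg (n + i) (by omega) (r + tt x n) ⟨by linarith [hr.1], by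
        have := hr.2; rw [← add_assoc] at this; linarith⟩
      simpa [Cur.shift, sgn] using this
  exact ⟨S.alt, S.eq_tt⟩

theorem shift_kap {x : Cur} {n m : ℕ} (h : Alt x (n + m)) (he : Even n) {i : ℕ} (hi : i ≤ m) :
    kap (x.shift (tt x n)) i = kap x (n + i) ∧ hgt (x.shift (tt x n)) i = hgt x (n + i) := by
  obtain ⟨-, e⟩ := shift_alt h he
  have sgn : (-1 : ℝ) ^ (n + i) = (-1 : ℝ) ^ i := by rw [pow_add, he.neg_one_pow, one_mul]
  constructor
  · rw [kap, e i hi, kap, sgn]; simp [Cur.shift]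
  · rw [hgt, e i hi, hgt]; simp [Cur.shift]

theorem shift_eq_xa {P : ℝ} {x : Cur} (hx : IsSol P x) {n : ℕ} (h : Alt x n) (he : Even n)
    (hk : kap x n = 0) : x.shift (tt x n) = xa P (hgt x n) := by
  obtain ⟨h, e0, e1, e2, e3⟩ := (⟨(xa_spec P (hgt x n)), h⟩ : _ ∧ Alt x n).symm
  obtain ⟨f, f0, f1, f2, f3⟩ := xa_spec P (hgt x n)
  refine SolEq.unique hx.pos.le hx.lt.le (hx.eq.shift _) f 0 ?_ ?_ ?_ ?_
  · rw [f0]; simp [Cur.shift, hgt]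
  · rw [f1]; simpa [Cur.shift] using h.c1 n le_rfl
  · rw [f2]
    have q := h.even_pos le_rfl he
    have lt := h.hgt_lt hx le_rfl
    have c := hx.crit_v2 (h.c1 n le_rfl)
    rw [← hgt, FF_mid (by linarith) (by linarith)] at c
    have : (- x.v2 (tt x n)) ^ 2 = (hgt x n * √(1 - 2 * hgt x n / 3)) ^ 2 := by
      rw [mul_pow, sq_sqrt (by linarith)]; linear_combination c
    have := (sq_eq_sq₀ (by linarith) (mul_nonneg q.1.le (sqrt_nonneg _))).1 this
    simp only [Cur.shift, zero_add]
    linarith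
  · rw [f3]; simpa [Cur.shift] using kap_eq_zero.1 hk




theorem near_pos {f : ℝ → ℝ} (hf : Continuous f) {s : ℝ} (h : 0 < f s) :
    ∃ δ, 0 < δ ∧ ∀ t, |t - s| ≤ δ → 0 < f t := by
  obtain ⟨δ, h1, h2⟩ := near_neg (f := fun t => - f t) hf.neg (by linarith)
  exact ⟨δ, h1, fun t ht => by linarith [h2 t ht]⟩

theorem LSf {x : Cur} {τ q δ : ℝ} (h1 : x.v1 q = 0) (h2 : x.v2 q = 0)
    (h3 : ∀ t ∈ Ioo q (q + δ), 0 < τ * x.v3 t) : ∀ t ∈ Ioo q (q + δ), 0 < τ * x.v1 t := by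
  have a : ∀ t ∈ Ioo q (q + δ), 0 < τ * x.v2 t := fun t ht => by
    have := mono_lt (fun t => (x.d2 t).const_mul τ) ht.1 (fun r hr => h3 r ⟨hr.1, hr.2.trans ht.2⟩)
    rwa [h2, mul_zero] at this
  intro t ht
  have := mono_lt (fun t => (x.d1 t).const_mul τ) ht.1 (fun r hr => a r ⟨hr.1, hr.2.trans ht.2⟩)
  rwa [h1, mul_zero] at this

theorem LSb {x : Cur} {τ q δ : ℝ} (h1 : x.v1 q = 0) (h2 : x.v2 q = 0)
    (h3 : ∀ t ∈ Ioo (q - δ) q, 0 < τ * x.v3 t) : ∀ t ∈ Ioo (q - δ) q, 0 < τ * x.v1 t := by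
  have a : ∀ t ∈ Ioo (q - δ) q, τ * x.v2 t < 0 := fun t ht => by
    have := mono_lt (fun t => (x.d2 t).const_mul τ) ht.2 (fun r hr => h3 r ⟨ht.1.trans hr.1, hr.2⟩)
    rwa [h2, mul_zero] at this
  intro t ht
  have := anti_lt (fun t => (x.d1 t).const_mul τ) ht.2 (fun r hr => a r ⟨ht.1.trans hr.1, hr.2⟩)
  rwa [h1, mul_zero] at this

theorem LSf' {x : Cur} {τ q : ℝ} (h1 : x.v1 q = 0) (h2 : x.v2 q = 0) (h3 : 0 < τ * x.v3 q) :
    ∃ δ, 0 < δ ∧ ∀ t ∈ Ioo q (q + δ), 0 < τ * x.v1 t := by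
  obtain ⟨δ, hδ, h⟩ := near_pos (x.c3.const_mul τ) h3
  exact ⟨δ, hδ, LSf h1 h2 (fun t ht => h t (abs_le.2 ⟨by linarith [ht.1], by linarith [ht.2]⟩))⟩

theorem LSb' {x : Cur} {τ q : ℝ} (h1 : x.v1 q = 0) (h2 : x.v2 q = 0) (h3 : 0 < τ * x.v3 q) :
    ∃ δ, 0 < δ ∧ ∀ t ∈ Ioo (q - δ) q, 0 < τ * x.v1 t := by
  obtain ⟨δ, hδ, h⟩ := near_pos (x.c3.const_mul τ) h3
  exact ⟨δ, hδ, LSb h1 h2 (fun t ht => h t (abs_le.2 ⟨by linarith [ht.1], by linarith [ht.2]⟩))⟩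

theorem v3_incr {P : ℝ} {x : Cur} (h : SolEq P x) {q : ℝ} (h2 : x.v2 q = 0) (h0 : x.v0 q = 3 / 2)
    (h3 : x.v3 q = 0) : ∃ δ, 0 < δ ∧ (∀ t ∈ Ioo q (q + δ), 0 < x.v3 t) ∧
      ∀ t ∈ Ioo (q - δ) q, x.v3 t < 0 := by
  have hc : Continuous fun t => P * x.v2 t + ff (x.v0 t) :=
    (x.c2.const_mul P).add (ff_cont.comp x.c0)
  obtain ⟨δ, hδ, hh⟩ := near_pos hc (s := q) (by
    rw [h2, h0, ff_mid (by norm_num) (by norm_num)]; norm_num)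
  refine ⟨δ, hδ, fun t ht => ?_, fun t ht => ?_⟩
  · have := mono_lt h ht.1 (fun r hr => hh r (abs_le.2 ⟨by linarith [hr.1], by linarith [hr.2, ht.2]⟩))
    linarith
  · have := mono_lt h ht.2 (fun r hr => hh r (abs_le.2 ⟨by linarith [hr.1, ht.1], by linarith [hr.2]⟩))
    linarith

theorem top_fwd {P : ℝ} {x : Cur} (h : SolEq P x) {q : ℝ} (h1 : x.v1 q = 0) (h2 : x.v2 q = 0)
    (h0 : x.v0 q = 3 / 2) (h3 : 0 ≤ x.v3 q) : ∃ δ, 0 < δ ∧ ∀ t ∈ Ioo q (q + δ), 0 < x.v1 t := by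
  rcases h3.eq_or_lt with h3 | h3
  · obtain ⟨δ, hδ, a, -⟩ := v3_incr h h2 h0 h3.symm
    refine ⟨δ, hδ, fun t ht => ?_⟩
    have := LSf (τ := 1) h1 h2 (fun t ht => by simpa using a t ht) t ht
    simpa using this
  · obtain ⟨δ, hδ, a⟩ := LSf' (τ := 1) h1 h2 (by simpa using h3)
    exact ⟨δ, hδ, fun t ht => by simpa using a t ht⟩

/-- no degenerate interior point with value zero in a limit -/
theorem no_deg {P : ℝ} {x : ℕ → Cur} {y : Cur} (hc : Conv atTop x y) (hx : ∀ k, IsSol P (x k))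
    {q σ η : ℝ} (hσ : |σ| = 1) (hη : 0 < η) (hq : η < q) (h0 : y.v0 q = 0) (h1 : y.v1 q = 0)
    (h2 : y.v2 q = 0) (h3 : σ * y.v3 q < 0)
    (hs : ∀ᶠ k in atTop, ∀ t ∈ Icc (q - η) (q + η), σ * (x k).v1 t < 0) : False := by
  have hP := (hx 0).pos
  have hP2 := (hx 0).lt
  have hσ2 : σ * σ = 1 := by rw [← abs_mul_abs_self, hσ]; norm_num
  obtain ⟨δ1, hδ1, H1⟩ := near_neg ((y.c3.const_mul σ).sub (y.c1.const_mul σ)) (s := q)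
    (by simp only [Pi.sub_apply, h1]; linarith)
  obtain ⟨δ2, hδ2, H2⟩ := near_neg (f := fun t => y.v0 t - 1) (y.c0.sub continuous_const) (s := q)
    (by rw [h0]; norm_num)
  obtain ⟨δ3, hδ3, H3⟩ := near_neg (y.c3.const_mul σ) (s := q) h3
  set δ := min (min δ1 δ2) (min δ3 η) with hδd
  have hδ : 0 < δ := by positivity
  have g1 : δ ≤ δ1 := (min_le_left _ _).trans (min_le_left _ _)
  have g2 : δ ≤ δ2 := (min_le_left _ _).trans (min_le_right _ _)
  have g3 : δ ≤ δ3 := (min_le_right _ _).trans (min_le_left _ _)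
  have g4 : δ ≤ η := (min_le_right _ _).trans (min_le_right _ _)
  have hab : ∀ t ∈ Icc (q - δ) (q + δ), |t - q| ≤ δ := fun t ht =>
    abs_le.2 ⟨by linarith [ht.1], by linarith [ht.2]⟩
  obtain ⟨m1, hm1, M1⟩ := cpt_neg (f := fun t => σ * y.v3 t - σ * y.v1 t)
    ((y.c3.const_mul σ).sub (y.c1.const_mul σ)) (a := q - δ) (b := q + δ)
    (fun t ht => H1 t ((hab t ht).trans g1))
  have L : 0 < σ * y.v2 (q - δ) := by
    have := anti_lt (fun t => (y.d2 t).const_mul σ) (show q - δ < q by linarith) (fun t ht =>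
      H3 t ((hab t ⟨ht.1.le, by linarith [ht.2]⟩).trans g3))
    rwa [h2, mul_zero] at this
  have R : σ * y.v2 (q + δ) < 0 := by
    have := anti_lt (fun t => (y.d2 t).const_mul σ) (show q < q + δ by linarith) (fun t ht =>
      H3 t ((hab t ⟨by linarith [ht.1], ht.2.le⟩).trans g3))
    rwa [h2, mul_zero] at this
  set m := min (min (m1 / 2) (1 / 2)) (min (σ * y.v2 (q - δ)) (-(σ * y.v2 (q + δ)))) with hmd
  have hm : 0 < m := by
    have : 0 < -(σ * y.v2 (q + δ)) := by linarith
    positivity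
  have l1 : m ≤ m1 / 2 := (min_le_left _ _).trans (min_le_left _ _)
  have l2 : m ≤ 1 / 2 := (min_le_left _ _).trans (min_le_right _ _)
  have l3 : m ≤ σ * y.v2 (q - δ) := (min_le_right _ _).trans (min_le_left _ _)
  have l4 : m ≤ -(σ * y.v2 (q + δ)) := (min_le_right _ _).trans (min_le_right _ _)
  obtain ⟨k, hk1, hk2⟩ := ((hc (q + δ) m hm).and hs).exists
  have tr : ∀ u v : ℝ, |u - v| < m → σ * u < σ * v + m ∧ σ * v < σ * u + m := fun u v huv => by
    have : |σ * u - σ * v| < m := by rw [← mul_sub, abs_mul, hσ, one_mul]; exact huv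
    rw [abs_lt] at this
    constructor <;> linarith [this.1, this.2]
  have kL := (tr _ _ (hk1 (q - δ) ⟨by linarith, by linarith⟩).2.2.1).2
  have kR := (tr _ _ (hk1 (q + δ) ⟨by linarith, by linarith⟩).2.2.1).1
  obtain ⟨p, hp1, hp2, hp3, -⟩ := first_dn ((x k).c2.const_mul σ) (z := q - δ) (w := q + δ)
    (by linarith) (by linarith) (by linarith)
  have hz : (x k).v2 p = 0 := by
    rcases mul_eq_zero.1 hp3 with h' | h'
    · rw [h'] at hσ; simp at hσ
    · exact h'
  have hpm : p ∈ Icc 0 (q + δ) := ⟨by linarith, hp2⟩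
  have hpd : p ∈ Icc (q - δ) (q + δ) := ⟨hp1.le, hp2⟩
  have c3 := (tr _ _ (hk1 p hpm).2.2.2).1
  have c1 := (tr _ _ (hk1 p hpm).2.1).2
  have c0 := (abs_lt.1 (hk1 p hpm).1).2
  have d := M1 p hpd
  have d0 := H2 p ((hab p hpd).trans g2)
  have e1 := hk2 p ⟨by linarith [hpd.1], by linarith [hpd.2]⟩
  have hH := (hx k).H' p
  rw [hz] at hH
  have hF : FF ((x k).v0 p) ≤ 0 := by
    by_cases h' : (x k).v0 p = 0
    · rw [h', FF_zero]
    · exact (FF_neg h' (by linarith)).le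
  -- A = -σ v1 > 0, B = -σ v3 > A
  have hAB : (σ * (x k).v1 p) * (σ * (x k).v3 p) = (x k).v1 p * (x k).v3 p := by
    linear_combination ((x k).v1 p * (x k).v3 p) * hσ2
  have hAA : (σ * (x k).v1 p) * (σ * (x k).v1 p) = (x k).v1 p ^ 2 := by
    linear_combination ((x k).v1 p ^ 2) * hσ2
  have hB : σ * (x k).v3 p < σ * (x k).v1 p := by linarith
  nlinarith

theorem Lp {P : ℝ} {x : ℕ → Cur} {y : Cur} (hc : Conv atTop x y) (hx : ∀ k, IsSol P (x k))
    (hy : IsSol P y) {i : ℕ} (hyi : Alt y i)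
    (hk : ∀ k, Alt (x k) (i + 1) ∧ (kap (x k) (i + 1) ≤ 0 ∨ Alt (x k) (i + 2))) : Alt y (i + 1) := by
  by_contra hcon
  -- pass to a subsequence
  have hs0 := (perturb hc (Eventually.of_forall fun k => (hk k).1.mono (by omega)) hyi).2 i le_rfl
  set s := tt y i with hsd
  set σ := (-1 : ℝ) ^ i with hσd
  have hσ : |σ| = 1 := by rcases sg_cases i with e | e <;> rw [hσd, e] <;> norm_num
  have hσc : σ = 1 ∨ σ = -1 := sg_cases i
  have hspos : 0 ≤ s := hyi.nonneg le_rfl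
  by_cases hb : ∃ R, ∃ᶠ k in atTop, tt (x k) (i + 1) ∈ Icc 0 R
  swap
  · push Not at hb
    have hlarge : ∀ R, ∀ᶠ k in atTop, R < tt (x k) (i + 1) := fun R => by
      have := hb R
      filter_upwards [this] with k h'
      by_contra hcc
      push Not at hcc
      exact h' ⟨(hk k).1.nonneg le_rfl, hcc⟩
    refine XX hy hσc (T := s + 1) (fun t ht => ?_) (fun t ht => ?_)
    · refine le_of_tendsto (hc.tendsto (tendsto_const_nhds (x := t)) (Eventually.of_forall fun _ => by linarith)).1 ?_
      filter_upwards [hlarge t] with k h'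
      exact (hk k).1.v0_le32 (hx k) ⟨by linarith, h'.le⟩
    · refine le_of_tendsto ((hc.tendsto (tendsto_const_nhds (x := t)) (Eventually.of_forall fun _ => by linarith)).2.1.const_mul σ) ?_
      filter_upwards [hlarge t, hs0.eventually (gt_mem_nhds (show s < s + 1 by linarith))] with k h' h''
      exact ((hk k).1.sg i (by omega) t ⟨by linarith, h'⟩).le
  obtain ⟨R, hR⟩ := hb
  obtain ⟨r, hr, φ, hφ, hlim⟩ := isCompact_Icc.tendsto_subseq' hR
  have hc' := hc.comp hφ.tendsto_atTop
  have hs' : Tendsto (fun k => tt (x (φ k)) i) atTop (𝓝 s) := hs0.comp hφ.tendsto_atTop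
  have hr' : Tendsto (fun k => tt (x (φ k)) (i + 1)) atTop (𝓝 r) := hlim
  have hsr : s + 1 / 3 ≤ r := by
    refine le_of_tendsto_of_tendsto' (hs'.add_const (1 / 3)) hr' (fun k => ?_)
    linarith [(hk (φ k)).1.gap (hx _) (i := i) (by omega)]
  have hrk0 : ∀ᶠ k in atTop, 0 ≤ tt (x (φ k)) (i + 1) :=
    Eventually.of_forall fun k => (hk (φ k)).1.nonneg le_rfl
  obtain ⟨w0, w1, w2, w3⟩ := hc'.tendsto hr' hrk0
  have r1 : y.v1 r = 0 := by
    refine tendsto_nhds_unique w1 ?_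
    simp only [(hk _).1.c1 (i + 1) le_rfl]
    exact tendsto_const_nhds
  have r0 : σ * y.v0 r ≤ 0 := le_of_tendsto' (w0.const_mul σ) (fun k => by
    have := (hk (φ k)).1.c0 (i + 1) le_rfl
    rw [sg_succ] at this
    linarith)
  have r2 : 0 ≤ σ * y.v2 r := ge_of_tendsto' (w2.const_mul σ) (fun k => by
    have := (hk (φ k)).1.c2 (i + 1) le_rfl
    rw [sg_succ] at this
    linarith)
  have evIn : ∀ a b, s < a → b < r → ∀ᶠ k in atTop, ∀ t ∈ Icc a b, σ * (x (φ k)).v1 t < 0 := by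
    intro a b ha hb
    filter_upwards [hs'.eventually (gt_mem_nhds ha), hr'.eventually (lt_mem_nhds hb)] with k h1 h2 t ht
    exact (hk (φ k)).1.sg i (by omega) t ⟨by linarith [ht.1], by linarith [ht.2]⟩
  have mon : ∀ t ∈ Ioo s r, σ * y.v1 t ≤ 0 := fun t ht => by
    refine le_of_tendsto ((hc'.tendsto (tendsto_const_nhds (x := t)) (Eventually.of_forall fun _ => by
      linarith [ht.1])).2.1.const_mul σ) ?_
    filter_upwards [evIn t t ht.1 ht.2] with k hk
    exact (hk t ⟨le_rfl, le_rfl⟩).le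
  have up : ∀ t, 0 ≤ t → t < r → y.v0 t ≤ 3 / 2 := fun t h0 ht => by
    refine le_of_tendsto (hc'.tendsto (tendsto_const_nhds (x := t)) (Eventually.of_forall fun _ => h0)).1 ?_
    filter_upwards [hr'.eventually (lt_mem_nhds ht)] with k h'
    exact (hk _).1.v0_le32 (hx _) ⟨h0, h'.le⟩
  have hs32 : y.v0 s < 3 / 2 := hyi.hgt_lt hy le_rfl
  have FFz : ∀ q, y.v1 q = 0 → y.v2 q = 0 → y.v0 q = 0 ∨ y.v0 q = 3 / 2 := fun q h1 h2 => by
    apply FF_eq_zero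
    have := hy.crit_v2 h1
    rw [h2] at this
    linarith
  -- interior strictness
  have strict : ∀ q ∈ Ioo s r, σ * y.v1 q < 0 := by
    intro q hq
    rcases (mon q hq).lt_or_eq with h' | h'
    · exact h'
    exfalso
    have q1 : y.v1 q = 0 := by
      rcases mul_eq_zero.1 h' with h' | h'
      · rw [h'] at hσ; simp at hσ
      · exact h'
    have q2 : y.v2 q = 0 := by
      have hmax : IsLocalMax (fun t => σ * y.v1 t) q := by
        filter_upwards [isOpen_Ioo.mem_nhds hq] with t ht
        rw [q1, mul_zero]; exact mon t ht
      have := hmax.hasDerivAt_eq_zero ((y.d1 q).const_mul σ)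
      rcases mul_eq_zero.1 this with hzz | hzz
      · rw [hzz] at hσ; simp at hσ
      · exact hzz
    -- v3 has sign
    have q3 : σ * y.v3 q ≤ 0 := by
      by_contra hcc
      push Not at hcc
      obtain ⟨δ, hδ, hh⟩ := LSf' q1 q2 hcc
      set t := min (q + δ / 2) ((q + r) / 2)
      have t1 : t < q + δ := (min_le_left _ _).trans_lt (by linarith)
      have t2 : t < r := (min_le_right _ _).trans_lt (by linarith [hq.2])
      have t3 : q < t := lt_min (by linarith) (by linarith [hq.2])
      linarith [hh t ⟨t3, t1⟩, mon t ⟨hq.1.trans t3, t2⟩]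
    rcases FFz q q1 q2 with q0 | q0
    · have q3' : σ * y.v3 q < 0 := by
        rcases q3.lt_or_eq with h | h
        · exact h
        · exfalso
          rcases mul_eq_zero.1 h with h | h
          · rw [h] at hσ; simp at hσ
          · exact hy.nt q ⟨q0, q1, q2, h⟩
      set η := min ((q - s) / 2) ((r - q) / 2) with hη
      have e1 : η ≤ (q - s) / 2 := min_le_left _ _
      have e2 : η ≤ (r - q) / 2 := min_le_right _ _
      have e3 : 0 < η := lt_min (by linarith [hq.1]) (by linarith [hq.2])
      exact no_deg hc' (fun k => hx _) hσ e3 (by linarith [hq.1]) q0 q1 q2 q3'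
        (evIn _ _ (by linarith [hq.1]) (by linarith [hq.2]))
    · rcases hσc with e | e
      · have := anti_le y.d0 hq.1.le (fun t ht => by
          have := mon t ⟨ht.1, ht.2.trans hq.2⟩
          rw [e] at this; linarith)
        linarith
      · rw [e] at q3
        obtain ⟨δ, hδ, hh⟩ := top_fwd hy.eq q1 q2 q0 (by linarith)
        set t := min (q + δ / 2) ((q + r) / 2)
        have t1 : t < q + δ := (min_le_left _ _).trans_lt (by linarith)
        have t2 : t < r := (min_le_right _ _).trans_lt (by linarith [hq.2])
        have t3 : q < t := lt_min (by linarith) (by linarith [hq.2])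
        have := mono_lt y.d0 t3 (fun u hu => hh u ⟨hu.1, hu.2.trans t1⟩)
        linarith [up t (by linarith [hq.1]) t2]
  -- at r
  have r2' : y.v2 r ≠ 0 := by
    intro q2
    have noback : ∀ δ, 0 < δ → (∀ t ∈ Ioo (r - δ) r, 0 < σ * y.v1 t) → False := by
      intro δ hδ hh
      set t := max (r - δ / 2) ((s + r) / 2)
      have t1 : r - δ < t := lt_of_lt_of_le (by linarith) (le_max_left _ _)
      have t2 : s < t := lt_of_lt_of_le (by linarith) (le_max_right _ _)
      have t3 : t < r := max_lt (by linarith) (by linarith)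
      linarith [hh t ⟨t1, t3⟩, mon t ⟨t2, t3⟩]
    have q3 : σ * y.v3 r ≤ 0 := by
      by_contra hcc
      push Not at hcc
      obtain ⟨δ, hδ, hh⟩ := LSb' r1 q2 hcc
      exact noback δ hδ hh
    have q3' : σ * y.v3 r < 0 := by
      rcases q3.lt_or_eq with h | h
      · exact h
      exfalso
      have h3 : y.v3 r = 0 := by
        rcases mul_eq_zero.1 h with h | h
        · rw [h] at hσ; simp at hσ
        · exact h
      rcases FFz r r1 q2 with q0 | q0
      · exact hy.nt r ⟨q0, r1, q2, h3⟩
      · have e : σ = -1 := by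
          rcases hσc with e | e
          · rw [e, q0] at r0; linarith
          · exact e
        obtain ⟨δ, hδ, -, a⟩ := v3_incr hy.eq q2 q0 h3
        exact noback δ hδ (LSb r1 q2 (fun t ht => by rw [e]; linarith [a t ht]))
    have hkap : ∀ᶠ k in atTop, Alt (x (φ k)) (i + 2) := by
      filter_upwards [(w3.const_mul σ).eventually (gt_mem_nhds q3')] with k hk'
      rcases (hk (φ k)).2 with h | h
      · rw [kap, sg_succ] at h
        linarith
      · exact h
    obtain ⟨δ, hδ, hh⟩ := LSf' (τ := -σ) r1 q2 (by linarith)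
    set t := min (r + δ / 2) (r + 1 / 6)
    have t1 : t < r + δ := (min_le_left _ _).trans_lt (by linarith)
    have t2 : t < r + 1 / 4 := (min_le_right _ _).trans_lt (by linarith)
    have t3 : r < t := lt_min (by linarith) (by linarith)
    have h1 := hh t ⟨t3, t1⟩
    have h2 : 0 ≤ σ * y.v1 t := by
      refine ge_of_tendsto ((hc'.tendsto (tendsto_const_nhds (x := t)) (Eventually.of_forall fun _ => by
        linarith)).2.1.const_mul σ) ?_
      filter_upwards [hkap, hr'.eventually (gt_mem_nhds t3),
        hr'.eventually (lt_mem_nhds (show r - 1 / 12 < r by linarith))] with k h4 h5 h6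
      have h7 := h4.gap (hx _) (i := i + 1) (by omega)
      have := h4.sg (i + 1) (by omega) t ⟨h5, by linarith⟩
      rw [sg_succ] at this
      linarith
    linarith
  have hσne : σ ≠ 0 := by intro h; rw [h] at hσ; simp at hσ
  have r2p : 0 < σ * y.v2 r := lt_of_le_of_ne r2 (fun h => by
    rcases mul_eq_zero.1 h.symm with h | h
    · exact hσne h
    · exact r2' h)
  have r0p : σ * y.v0 r < 0 := lt_of_le_of_ne r0 (fun h => by
    rcases mul_eq_zero.1 h with h | h
    · exact hσne h
    · have := hy.crit_v2 r1
      rw [h, FF_zero] at this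
      apply r2'
      simpa using this)
  exact hcon (hyi.succ (t := r) (by linarith) r1 r0p r2p strict).1



/-- Multiply a curve by a constant. -/
noncomputable def Cur.scale (x : Cur) (c : ℝ) : Cur where
  v0 t := c * x.v0 t
  v1 t := c * x.v1 t
  v2 t := c * x.v2 t
  v3 t := c * x.v3 t
  d0 t := (x.d0 t).const_mul c
  d1 t := (x.d1 t).const_mul c
  d2 t := (x.d2 t).const_mul c
  c3 := continuous_const.mul x.c3

theorem tt_scale (x : Cur) {c : ℝ} (hc : c ≠ 0) (i : ℕ) : tt (x.scale c) i = tt x i := by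
  induction i with
  | zero => rfl
  | succ i ih => simp only [tt, ih]; simp [Cur.scale, hc]

theorem alt_scale {x : Cur} {c : ℝ} (hc : 0 < c) {n : ℕ} (h : Alt (x.scale c) n) : Alt x n := by
  have e := fun i => tt_scale x hc.ne' i
  refine ⟨rfl, fun i hi => ?_, fun i hi => ?_, fun i hi => ?_, fun i hi => ?_, fun i hi r hr => ?_⟩
  · have := h.c1 i hi; rw [e] at this; simpa [Cur.scale, hc.ne'] using this
  · have := h.c0 i hi; rw [e] at this; simp only [Cur.scale] at this
    by_contra hh; push Not at hh; nlinarith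
  · have := h.c2 i hi; rw [e] at this; simp only [Cur.scale] at this
    by_contra hh; push Not at hh; nlinarith
  · have := h.lt i hi; rwa [e, e] at this
  · have := h.sg i hi r (by rw [e, e]; exact hr); simp only [Cur.scale] at this
    by_contra hh; push Not at hh; nlinarith

/-- The linearised profile. -/
noncomputable def ylin (α β : ℝ) (hβ : 0 < β) (hab : α ^ 2 + β ^ 2 = 1) : Cur where
  v0 t := cosh (α * t) * cos (β * t) - α / β * (sinh (α * t) * sin (β * t))
  v1 t := -(1 / β) * (cosh (α * t) * sin (β * t))
  v2 t := -(cosh (α * t) * cos (β * t)) - α / β * (sinh (α * t) * sin (β * t))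
  v3 t := -(2 * α) * (sinh (α * t) * cos (β * t)) + (β - α ^ 2 / β) * (cosh (α * t) * sin (β * t))
  d0 t := by
    have hl1 : HasDerivAt (fun t => α * t) α t := by simpa using (hasDerivAt_id t).const_mul α
    have hl2 : HasDerivAt (fun t => β * t) β t := by simpa using (hasDerivAt_id t).const_mul β
    have := (hl1.cosh.mul hl2.cos).sub ((hl1.sinh.mul hl2.sin).const_mul (α / β))
    refine hd_cg this (fun _ => rfl) ?_
    have h1 : α ^ 2 = 1 - β ^ 2 := by linarith
    field_simp
    linear_combination (cosh (α * t) * sin (β * t)) * h1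
  d1 t := by
    have hl1 : HasDerivAt (fun t => α * t) α t := by simpa using (hasDerivAt_id t).const_mul α
    have hl2 : HasDerivAt (fun t => β * t) β t := by simpa using (hasDerivAt_id t).const_mul β
    have := (hl1.cosh.mul hl2.sin).const_mul (-(1 / β))
    refine hd_cg this (fun _ => rfl) ?_
    field_simp
    ring
  d2 t := by
    have hl1 : HasDerivAt (fun t => α * t) α t := by simpa using (hasDerivAt_id t).const_mul α
    have hl2 : HasDerivAt (fun t => β * t) β t := by simpa using (hasDerivAt_id t).const_mul β
    have := (hl1.cosh.mul hl2.cos).neg.sub ((hl1.sinh.mul hl2.sin).const_mul (α / β))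
    refine hd_cg this (fun _ => rfl) ?_
    field_simp
    ring
  c3 := by
    have := continuous_cosh
    have := continuous_sinh
    fun_prop

theorem ylin_eq {P α β : ℝ} (hβ : 0 < β) (hab : α ^ 2 + β ^ 2 = 1) (hP : P = 2 * (α ^ 2 - β ^ 2)) (t : ℝ) :
    HasDerivAt (ylin α β hβ hab).v3
      (P * (ylin α β hβ hab).v2 t + - (ylin α β hβ hab).v0 t) t := by
  have hl1 : HasDerivAt (fun t => α * t) α t := by simpa using (hasDerivAt_id t).const_mul α
  have hl2 : HasDerivAt (fun t => β * t) β t := by simpa using (hasDerivAt_id t).const_mul β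
  have := ((hl1.sinh.mul hl2.cos).const_mul (-(2 * α))).add
    ((hl1.cosh.mul hl2.sin).const_mul (β - α ^ 2 / β))
  refine hd_cg this (fun _ => rfl) ?_
  simp only [ylin]
  have h1 : α ^ 2 = 1 - β ^ 2 := by linarith
  subst hP
  field_simp
  linear_combination (cosh (α * t) * cos (β * t) * β - α * sinh (α * t) * sin (β * t)) * hab

theorem ylin_alt {α β : ℝ} (hα : 0 < α) (hβ : 0 < β) (hab : α ^ 2 + β ^ 2 = 1) (n : ℕ) :
    Alt (ylin α β hβ hab) n ∧ ∀ i ≤ n, 1 ≤ i → kap (ylin α β hβ hab) i < 0 := by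
  have hb : ∀ i : ℕ, β * (i * π / β) = i * π := fun i => by field_simp
  have key : SeqT (ylin α β hβ hab) n (fun i => i * π / β) := by
    refine ⟨by simp, fun i hi => ?_, fun i hi => ?_, fun i hi => ?_, fun i hi => ?_, fun i hi r hr => ?_⟩
    · simp [ylin, hb, sin_nat_mul_pi]
    · simp only [ylin, hb, sin_nat_mul_pi, cos_nat_mul_pi]
      have := cosh_pos (α * (i * π / β))
      have := sg_sq i
      nlinarith
    · simp only [ylin, hb, sin_nat_mul_pi, cos_nat_mul_pi]
      have := cosh_pos (α * (i * π / β))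
      have := sg_sq i
      nlinarith
    · simp only [Nat.cast_add, Nat.cast_one]
      have := pi_pos
      gcongr
      linarith
    · have h1 := sin_sub_nat_mul_pi (β * r) i
      have h2 : 0 < sin (β * r - i * π) := by
        apply sin_pos_of_pos_of_lt_pi
        · have := hr.1; rw [div_lt_iff₀ hβ] at this; linarith
        · have := hr.2; rw [lt_div_iff₀ hβ] at this; push_cast at this; linarith
      rw [h1] at h2
      simp only [ylin]
      have := mul_pos (mul_pos (one_div_pos.2 hβ) (cosh_pos (α * r))) h2
      nlinarith
  refine ⟨key.alt, fun i hi h1 => ?_⟩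
  rw [kap, key.eq_tt i hi]
  simp only [ylin, hb, sin_nat_mul_pi, cos_nat_mul_pi]
  have h2 : 0 < sinh (α * (i * π / β)) := by
    rw [sinh_pos_iff]
    have := pi_pos
    have : (0 : ℝ) < i := by exact_mod_cast h1
    positivity
  have := sg_sq i
  have h3 := mul_pos hα h2
  have : (-1 : ℝ) ^ i * (-(2 * α) * (sinh (α * (i * π / β)) * (-1) ^ i) + (β - α ^ 2 / β) *
    (cosh (α * (i * π / β)) * 0)) = -2 * (α * sinh (α * (i * π / β))) * ((-1) ^ i * (-1) ^ i) := by ring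
  rw [this, sg_sq]
  linarith

theorem xa_alt0 {P a : ℝ} (ha : 0 < a) (ha' : a < 3 / 2) : Alt (xa P a) 0 := by
  obtain ⟨-, h0, h1, h2, -⟩ := xa_spec P a
  refine alt_zero (by rw [h0]; exact ha) h1 ?_
  rw [h2]
  have : 0 < √(1 - 2 * a / 3) := Real.sqrt_pos.2 (by linarith)
  have := mul_pos ha this
  linarith

theorem lemS {P : ℝ} (hP0 : 0 < P) (hP : P < 2) (n : ℕ) : ∀ᶠ a in 𝓝[>] (0 : ℝ),
    Alt (xa P a) n ∧ (∀ i, 1 ≤ i → i ≤ n → kap (xa P a) i < 0) ∧ ∀ i ≤ n, hgt (xa P a) i < 1 := by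
  set α := √((2 + P) / 4) with hα
  set β := √((2 - P) / 4) with hβ
  have hα2 : α ^ 2 = (2 + P) / 4 := Real.sq_sqrt (by linarith)
  have hβ2 : β ^ 2 = (2 - P) / 4 := Real.sq_sqrt (by linarith)
  have hα0 : 0 < α := Real.sqrt_pos.2 (by linarith)
  have hβ0 : 0 < β := Real.sqrt_pos.2 (by linarith)
  have hab : α ^ 2 + β ^ 2 = 1 := by rw [hα2, hβ2]; ring
  have hPe : P = 2 * (α ^ 2 - β ^ 2) := by rw [hα2, hβ2]; ring
  set y := ylin α β hβ0 hab with hy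
  have hpos : ∀ᶠ a in 𝓝[>] (0 : ℝ), 0 < a := eventually_mem_nhdsWithin
  have hsm : ∀ δ : ℝ, 0 < δ → ∀ᶠ a in 𝓝[>] (0 : ℝ), a < δ := fun δ hδ =>
    nhdsWithin_le_nhds (Iio_mem_nhds hδ)
  have hid : Tendsto (fun a : ℝ => a) (𝓝[>] 0) (𝓝 0) := nhdsWithin_le_nhds
  have hconv : Conv (𝓝[>] (0 : ℝ)) (fun a => (xa P a).scale a⁻¹) y := by
    refine conv_of_compare hP0.le hP.le _ y (fun a t => a⁻¹ * ff ((xa P a).v0 t)) (fun a t => -y.v0 t)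
      ?_ ?_ ?_ ?_ ?_ ?_ ?_
    · refine Eventually.of_forall fun a t => ?_
      exact hd_cg (((xa_spec P a).1 t).const_mul a⁻¹) (fun _ => rfl) (by simp only [Cur.scale]; ring)
    · intro a t; exact ylin_eq hβ0 hab hPe t
    · intro T δ hδ
      obtain ⟨B, hB⟩ := (isCompact_Icc (a := (0 : ℝ)) (b := T)).exists_bound_of_continuousOn y.c0.continuousOn
      have hB1 : 0 < |B| + 1 := by positivity
      filter_upwards [hpos, hsm (1 / (|B| + 1)) (by positivity), hsm (δ / (|B| + 1) ^ 2) (by positivity)]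
        with a ha h1 h2 t ht
      rw [lt_div_iff₀ hB1] at h1
      rw [lt_div_iff₀ (by positivity)] at h2
      have hyb : |y.v0 t| ≤ |B| + 1 := by
        have := hB t ht; rw [Real.norm_eq_abs] at this; linarith [le_abs_self B]
      set w := y.v0 t
      set u := (xa P a).v0 t
      have h3 : |a * w| ≤ 1 := by rw [abs_mul, abs_of_pos ha]; nlinarith
      have h4 : ff (a * w) = (a * w) ^ 2 - a * w := ff_mid (by linarith [(abs_le.1 h3).1]) (by linarith [(abs_le.1 h3).2])
      have h5 := ff_lip' u (a * w)
      have e : a⁻¹ * ff u - -w = a⁻¹ * (ff u - ff (a * w)) + a * w ^ 2 := by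
        rw [h4]; field_simp; ring
      rw [e]
      refine (abs_add_le _ _).trans (add_le_add ?_ ?_)
      · rw [abs_mul, abs_of_pos (inv_pos.2 ha)]
        simp only [Cur.scale]
        have : a⁻¹ * u - w = a⁻¹ * (u - a * w) := by field_simp
        rw [this, abs_mul, abs_of_pos (inv_pos.2 ha)]
        have := mul_le_mul_of_nonneg_left h5 (inv_pos.2 ha).le
        linarith
      · rw [abs_of_nonneg (by positivity), ← sq_abs w]
        have : |w| ^ 2 ≤ (|B| + 1) ^ 2 := by gcongr
        nlinarith
    · refine tendsto_const_nhds.congr' ?_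
      filter_upwards [hpos] with a ha
      simp [Cur.scale, (xa_spec P a).2.1, ha.ne', hy, ylin]
    · refine tendsto_const_nhds.congr' ?_
      filter_upwards [hpos] with a ha
      simp [Cur.scale, (xa_spec P a).2.2.1, hy, ylin]
    · have h1 : Tendsto (fun a : ℝ => -√(1 - 2 * a / 3)) (𝓝[>] 0) (𝓝 (-√(1 - 2 * 0 / 3))) := by
        refine Tendsto.mono_left (Continuous.tendsto (f := fun a : ℝ => -√(1 - 2 * a / 3)) (by fun_prop) 0) nhdsWithin_le_nhds
      have e : y.v2 0 = -√(1 - 2 * 0 / 3) := by simp [hy, ylin]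
      rw [e]
      refine h1.congr' ?_
      filter_upwards [hpos] with a ha
      simp only [Cur.scale, (xa_spec P a).2.2.2.1]
      field_simp
    · refine tendsto_const_nhds.congr' ?_
      filter_upwards [hpos] with a ha
      simp [Cur.scale, (xa_spec P a).2.2.2.2, hy, ylin]
  have h0 : ∀ᶠ a in 𝓝[>] (0 : ℝ), Alt ((xa P a).scale a⁻¹) 0 := by
    filter_upwards [hpos, hsm (3 / 2) (by norm_num)] with a ha ha'
    have h := xa_alt0 (P := P) ha ha'
    have hi := inv_pos.2 ha
    refine alt_zero ?_ ?_ ?_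
    · have := h.c0 0 le_rfl; simp only [tt, pow_zero, one_mul] at this; exact mul_pos hi this
    · have := h.c1 0 le_rfl; simp only [tt] at this; simp [Cur.scale, this]
    · have := h.c2 0 le_rfl; simp only [tt, pow_zero, one_mul] at this; exact mul_neg_of_pos_of_neg hi this
  obtain ⟨hya, hyk⟩ := ylin_alt hα0 hβ0 hab n
  have hA := (perturb hconv h0 hya).1
  have hev : ∀ i, i ≤ n → ∀ᶠ a in 𝓝[>] (0 : ℝ), (1 ≤ i → kap (xa P a) i < 0) ∧ hgt (xa P a) i < 1 := by
    intro i hi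
    obtain ⟨l1, l2⟩ := perturb_lim hconv h0 hya hi
    have hk : ∀ᶠ a in 𝓝[>] (0 : ℝ), (1 ≤ i → kap (xa P a) i < 0) := by
      by_cases h1 : 1 ≤ i
      · filter_upwards [hpos, l2.eventually_lt_const (hyk i hi h1)] with a ha hh _
        have : kap ((xa P a).scale a⁻¹) i = a⁻¹ * kap (xa P a) i := by
          simp only [kap, tt_scale _ (inv_pos.2 ha).ne']; simp only [Cur.scale]; ring
        rw [this] at hh
        by_contra hc; push Not at hc
        have := mul_nonneg (inv_pos.2 ha).le hc; linarith
      · exact Eventually.of_forall fun a h => absurd h h1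
    have l3 := hid.mul l1
    rw [zero_mul] at l3
    filter_upwards [hk, hpos, l3.eventually_lt_const one_pos] with a h1 ha h2
    refine ⟨h1, ?_⟩
    have : a * hgt ((xa P a).scale a⁻¹) i = hgt (xa P a) i := by
      simp only [hgt, tt_scale _ (inv_pos.2 ha).ne']; simp only [Cur.scale]; field_simp
    rwa [this] at h2
  have hall : ∀ᶠ a in 𝓝[>] (0 : ℝ), ∀ i ∈ Finset.range (n + 1), (1 ≤ i → kap (xa P a) i < 0) ∧ hgt (xa P a) i < 1 :=
    (Finset.eventually_all _).2 fun i hi => hev i (by simpa [Nat.lt_succ_iff] using hi)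
  filter_upwards [hA, hall, hpos] with a h1 h2 ha
  exact ⟨alt_scale (inv_pos.2 ha) h1, fun i h3 h4 => (h2 i (by simp; omega)).1 h3,
    fun i h4 => (h2 i (by simp; omega)).2⟩



theorem alt_bd {P : ℝ} {x : Cur} (hx : IsSol P x) (hA : ∀ n, Alt x n) {t : ℝ} (ht : 0 ≤ t) :
    -(3 / 5) ≤ x.v0 t ∧ x.v0 t ≤ 3 / 2 := by
  obtain ⟨n, hn⟩ := exists_nat_gt (3 * t)
  have h1 := (hA n).tt_ge hx le_rfl
  have hr : t ∈ Icc (tt x 0) (tt x n) := ⟨ht, by linarith⟩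
  have hn0 : 0 < n := by
    rcases Nat.eq_zero_or_pos n with h | h
    · subst h; simp at hn; linarith
    · exact h
  refine ⟨?_, (hA n).v0_le32 hx hr⟩
  obtain ⟨i, -, hi, hri⟩ := (hA n).locate hn0 hr
  have h2 := ((hA n).between hi hri).1
  refine le_trans ?_ h2
  have h3 : ∀ j, -(3 / 5) ≤ hgt x j := fun j => by
    rcases Nat.even_or_odd j with h | h
    · have := ((hA j).even_pos le_rfl h).1; linarith
    · exact ((hA (j + 1)).odd_gt hx le_rfl h).le
  exact le_min (h3 _) (h3 _)

theorem alt_zero_after {P : ℝ} {x : Cur} (hx : IsSol P x) (hA : ∀ n, Alt x n) (t : ℝ) :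
    ∃ r, t ≤ r ∧ x.v0 r = 0 := by
  obtain ⟨n, hn⟩ := exists_nat_gt (3 * t)
  have h1 := (hA (2 * n)).tt_ge hx le_rfl
  push_cast at h1
  have h2 := ((hA (2 * n)).even_pos le_rfl (by simp)).1
  have h3 := ((hA (2 * n + 1)).odd_neg le_rfl (by simp)).1
  have h4 := (hA (2 * n + 1)).lt_of (Nat.lt_succ_self (2 * n)) le_rfl
  obtain ⟨r, hr, -, h0, -⟩ := first_dn x.c0 h4.le h2 h3.le
  refine ⟨r, ?_, h0⟩
  have : (0 : ℝ) ≤ n := Nat.cast_nonneg n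
  linarith

theorem alt_bd3 {P : ℝ} {x : Cur} (hx : IsSol P x) (hA : ∀ n, Alt x n) {t : ℝ} (ht : 0 ≤ t) :
    |x.v1 t| ≤ 7500 ∧ |x.v2 t| ≤ 7500 ∧ |x.v3 t| ≤ 30000 := by
  have := DB_loc hx.pos.le hx.lt.le hx.eq (t := t) (B := 3 / 2) (fun s hs => by
    have := alt_bd hx hA (t := s) (by linarith [hs.1])
    rw [abs_le]; constructor <;> linarith)
  norm_num at this
  exact this

/-- the modified Lyapunov function -/
noncomputable def GG (P : ℝ) (x : Cur) (t : ℝ) : ℝ := NN P x t + 1 / 4 * (x.v2 t * x.v3 t)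

theorem GG_deriv {P : ℝ} {x : Cur} (hx : IsSol P x) (t : ℝ) : HasDerivAt (GG P x)
    (NN' P x t + 1 / 4 * (x.v3 t * x.v3 t + x.v2 t * (P * x.v2 t + ff (x.v0 t)))) t :=
  hd_cg ((hx.eq.dN t).add (((x.d2 t).mul (hx.eq t)).const_mul (1 / 4))) (fun _ => rfl) rfl

theorem GG_est {P : ℝ} {x : Cur} (hx : IsSol P x) {t : ℝ} (h0 : -(3 / 5) ≤ x.v0 t) (h1 : x.v0 t ≤ 1) :
    P / 40 * (x.v0 t ^ 2 + x.v1 t ^ 2 + x.v2 t ^ 2 + x.v3 t ^ 2) ≤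
      NN' P x t + 1 / 4 * (x.v3 t * x.v3 t + x.v2 t * (P * x.v2 t + ff (x.v0 t))) := by
  have hH := hx.H' t
  rw [FF_mid (by linarith) (by linarith)] at hH
  unfold NN'
  rw [ff_mid (by linarith) (by linarith)]
  generalize x.v0 t = a at *
  generalize x.v1 t = b at *
  generalize x.v2 t = c at *
  generalize x.v3 t = d at *
  have hP := hx.pos
  have hP2 := hx.lt
  have e1 : a ^ 2 ≤ 3 * c ^ 2 + 9 * b ^ 2 + 3 * d ^ 2 := by
    have : a ^ 2 / 6 ≤ a ^ 2 / 2 - a ^ 3 / 3 := by nlinarith [mul_nonneg (sq_nonneg a) (sub_nonneg.2 h1)]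
    nlinarith [sq_nonneg (b + d), sq_nonneg b]
  have e2 : a ^ 2 + b ^ 2 + c ^ 2 + d ^ 2 ≤ 10 * b ^ 2 + 4 * c ^ 2 + 4 * d ^ 2 := by linarith
  have e3 : P / 40 * (a ^ 2 + b ^ 2 + c ^ 2 + d ^ 2) ≤ P / 40 * (10 * b ^ 2 + 4 * c ^ 2 + 4 * d ^ 2) := by gcongr
  have e4 : P * c ^ 2 ≤ 2 * c ^ 2 := by gcongr
  have e5 : P * d ^ 2 ≤ 2 * d ^ 2 := by gcongr
  have e6 : 0 ≤ P * b ^ 2 := by positivity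
  have e7 : 0 ≤ P * c ^ 2 := by positivity
  have e8 : 0 ≤ a ^ 2 * (1 - a) := mul_nonneg (sq_nonneg a) (by linarith)
  have e9 : 0 ≤ a ^ 2 * (1 - a) * (a + 3 / 5) := mul_nonneg e8 (by linarith)
  nlinarith [sq_nonneg (c + (a ^ 2 - a))]

theorem GG_abs {P : ℝ} {x : Cur} (hx : IsSol P x) (t : ℝ) :
    |GG P x t| ≤ 2 * (x.v0 t ^ 2 + x.v1 t ^ 2 + x.v2 t ^ 2 + x.v3 t ^ 2) := by
  unfold GG NN
  generalize x.v0 t = a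
  generalize x.v1 t = b
  generalize x.v2 t = c
  generalize x.v3 t = d
  have hP := hx.pos
  have hP2 := hx.lt
  have e1 : |b * c| ≤ (b ^ 2 + c ^ 2) / 2 := by rw [abs_le]; constructor <;> nlinarith [sq_nonneg (b + c), sq_nonneg (b - c)]
  have e2 : |a * d| ≤ (a ^ 2 + d ^ 2) / 2 := by rw [abs_le]; constructor <;> nlinarith [sq_nonneg (a + d), sq_nonneg (a - d)]
  have e3 : |a * b| ≤ (a ^ 2 + b ^ 2) / 2 := by rw [abs_le]; constructor <;> nlinarith [sq_nonneg (a + b), sq_nonneg (a - b)]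
  have e4 : |c * d| ≤ (c ^ 2 + d ^ 2) / 2 := by rw [abs_le]; constructor <;> nlinarith [sq_nonneg (c + d), sq_nonneg (c - d)]
  have e5 : |P * (a * b)| ≤ a ^ 2 + b ^ 2 := by
    rw [abs_mul, abs_of_pos hP]; nlinarith [abs_nonneg (a * b)]
  rw [abs_le] at *
  constructor <;> nlinarith [sq_nonneg a, sq_nonneg b, sq_nonneg c, sq_nonneg d]

theorem decay_sq {P : ℝ} {x : Cur} (hx : IsSol P x) (hA : ∀ n, Alt x n) {T : ℝ} (hT0 : 0 ≤ T)
    (hT : ∀ t, T ≤ t → x.v0 t ≤ 1) : ∃ K k : ℝ, 0 < k ∧ ∀ t, T ≤ t → x.v0 t ^ 2 ≤ K * exp (-k * t) := by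
  have hP := hx.pos
  set k := P / 80 with hk
  have hk0 : 0 < k := by positivity
  set S := fun t => x.v0 t ^ 2 + x.v1 t ^ 2 + x.v2 t ^ 2 + x.v3 t ^ 2 with hS
  set G' := fun t => NN' P x t + 1 / 4 * (x.v3 t * x.v3 t + x.v2 t * (P * x.v2 t + ff (x.v0 t))) with hG'
  have hd : ∀ t, HasDerivAt (GG P x) (G' t) t := GG_deriv hx
  have hest : ∀ t, T ≤ t → P / 40 * S t ≤ G' t := fun t ht =>
    GG_est hx (alt_bd hx hA (hT0.trans ht)).1 (hT t ht)
  have hab : ∀ t, T ≤ t → k * |GG P x t| ≤ G' t := fun t ht => by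
    have := GG_abs hx t
    have h2 := hest t ht
    have : k * |GG P x t| ≤ k * (2 * S t) := by gcongr
    have e : k * (2 * S t) = P / 40 * S t := by rw [hk]; ring
    linarith
  have hbd : ∀ t, T ≤ t → GG P x t ≤ 10 ^ 10 := fun t ht => by
    have h0 := alt_bd hx hA (hT0.trans ht)
    obtain ⟨h1, h2, h3⟩ := alt_bd3 hx hA (hT0.trans ht)
    have h4 := (le_abs_self _).trans (GG_abs hx t)
    have := sq_le_sq' (abs_le.1 h1).1 (abs_le.1 h1).2
    have := sq_le_sq' (abs_le.1 h2).1 (abs_le.1 h2).2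
    have := sq_le_sq' (abs_le.1 h3).1 (abs_le.1 h3).2
    have : x.v0 t ^ 2 ≤ (3 / 2) ^ 2 := sq_le_sq' (by linarith) h0.2
    linarith
  have hneg : ∀ t, T ≤ t → GG P x t ≤ 0 := by
    intro t ht
    by_contra hc
    push Not at hc
    have hgrow : ∀ b, t ≤ b → GG P x t * exp (k * (b - t)) ≤ GG P x b := fun b hb => by
      have := gron (f := fun t => - GG P x t) (fun t => (hd t).neg) hb (C := k) (fun s hs => by
        have h1 := hab s (ht.trans hs.1.le)
        have := le_abs_self (GG P x s)
        nlinarith)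
      linarith
    have h1 := hgrow (t + 10 ^ 10 / (GG P x t * k)) (by have := mul_pos hc hk0; have : 0 < 10 ^ 10 / (GG P x t * k) := by positivity
                                                        linarith)
    have h2 := hbd (t + 10 ^ 10 / (GG P x t * k)) (by have := mul_pos hc hk0; have : 0 < 10 ^ 10 / (GG P x t * k) := by positivity
                                                      linarith)
    have h3 := add_one_le_exp (k * (t + 10 ^ 10 / (GG P x t * k) - t))
    have h4 : GG P x t * (k * (t + 10 ^ 10 / (GG P x t * k) - t)) = 10 ^ 10 := by
      have := hc.ne'; have := hk0.ne'; field_simp; ring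
    nlinarith
  have hdec : ∀ t, T ≤ t → -GG P x t ≤ -GG P x T * exp (-k * (t - T)) := fun t ht => by
    have := gron (f := fun t => - GG P x t) (fun t => (hd t).neg) ht (C := -k) (fun s hs => by
      have h1 := hab s hs.1.le
      have := neg_abs_le (GG P x s)
      nlinarith)
    simpa using this
  refine ⟨40 / P * (-GG P x T * exp (k * T)), k, hk0, fun t ht => ?_⟩
  obtain ⟨r, hr, hr0⟩ := alt_zero_after hx hA t
  have hmono := mono_le (f := fun t => x.v0 t ^ 2 + 40 / P * GG P x t)
    (fun s => ((x.d0 s).pow 2).add ((hd s).const_mul (40 / P))) hr (fun s hs => by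
      have h1 := hest s (ht.trans hs.1.le)
      have : 40 / P * (P / 40 * S s) ≤ 40 / P * G' s := by gcongr
      have e : 40 / P * (P / 40 * S s) = S s := by field_simp
      rw [e] at this
      simp only [hS] at this
      norm_num
      nlinarith [sq_nonneg (x.v0 s + x.v1 s), sq_nonneg (x.v2 s), sq_nonneg (x.v3 s)])
  simp only [hr0] at hmono
  have h5 := hneg r (ht.trans hr)
  have h6 : 40 / P * GG P x r ≤ 0 := mul_nonpos_of_nonneg_of_nonpos (by positivity) h5
  have h7 : 40 / P * -GG P x t ≤ 40 / P * (-GG P x T * exp (-k * (t - T))) := by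
    have := hdec t ht; gcongr
  have e : exp (-k * (t - T)) = exp (k * T) * exp (-k * t) := by rw [← exp_add]; congr 1; ring
  rw [e] at h7
  have h8 : x.v0 t ^ 2 ≤ 40 / P * -GG P x t := by linarith
  calc x.v0 t ^ 2 ≤ _ := h8
    _ ≤ _ := h7
    _ = _ := by ring

theorem decay {P : ℝ} {x : Cur} (hx : IsSol P x) (hA : ∀ n, Alt x n) {T : ℝ}
    (hT : ∀ t, T ≤ t → x.v0 t ≤ 1) :
    ∃ C k : ℝ, 0 < C ∧ 0 < k ∧ ∀ t, 0 ≤ t → |x.v0 t| ≤ C * exp (-k * t) := by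
  obtain ⟨K, k, hk, h⟩ := decay_sq hx hA (T := max T 0) (le_max_right _ _)
    (fun t ht => hT t ((le_max_left _ _).trans ht))
  set T' := max T 0
  set K' := |K| + 9 / 4 * exp (k * T') with hK'
  have hKp : 0 < K' := by positivity
  refine ⟨√K', k / 2, Real.sqrt_pos.2 hKp, by positivity, fun t ht => ?_⟩
  have h1 : x.v0 t ^ 2 ≤ K' * exp (-k * t) := by
    rcases le_total T' t with h2 | h2
    · refine (h t h2).trans ?_
      have : K ≤ K' := by have := le_abs_self K; have := exp_pos (k * T'); rw [hK']; linarith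
      gcongr
    · have h3 := alt_bd hx hA ht
      have h4 : x.v0 t ^ 2 ≤ (3 / 2) ^ 2 := sq_le_sq' (by linarith) h3.2
      have h5 : 1 ≤ exp (k * T') * exp (-k * t) := by
        rw [← exp_add]; apply one_le_exp; nlinarith
      have h6 : 0 ≤ |K| * exp (-k * t) := by positivity
      rw [hK']; nlinarith
  apply abs_le_of_sq_le_sq _ (by positivity)
  rw [mul_pow, Real.sq_sqrt hKp.le, ← exp_nat_mul]
  have e : exp (((2 : ℕ) : ℝ) * (-(k / 2) * t)) = exp (-k * t) := by congr 1; push_cast; ring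
  rw [e]; exact h1

theorem decay_tendsto {P : ℝ} {x : Cur} (hx : IsSol P x) (hA : ∀ n, Alt x n) {T : ℝ}
    (hT : ∀ t, T ≤ t → x.v0 t ≤ 1) : Tendsto x.v0 atTop (𝓝 0) := by
  obtain ⟨C, k, hC, hk, h⟩ := decay hx hA hT
  have h1 : Tendsto (fun t => C * exp (-k * t)) atTop (𝓝 0) := by
    have : Tendsto (fun t : ℝ => -k * t) atTop atBot :=
      Tendsto.const_mul_atTop_of_neg (by linarith) tendsto_id
    simpa using (tendsto_exp_atBot.comp this).const_mul C
  refine squeeze_zero_norm' ?_ h1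
  filter_upwards [eventually_ge_atTop 0] with t ht
  exact h t ht

theorem no_all_neg {P : ℝ} {x : Cur} (hx : IsSol P x) (hA : ∀ n, Alt x n)
    (hT : ∀ t, tt x 1 ≤ t → x.v0 t ≤ 1) (hk : kap x 1 ≤ 0) : False := by
  have h0 := decay_tendsto hx hA hT
  have hlt : tt x 1 < tt x 2 := (hA 2).lt_of (by norm_num) le_rfl
  have h1 : 0 ≤ NN P x (tt x 1) := by
    rw [NN_crit (hA 1) le_rfl]
    have := (hA 1).c0 1 le_rfl
    nlinarith
  have h2 : NN P x (tt x 1) < NN P x (tt x 2) := mono_lt (hx.eq.dN) hlt (fun t ht => by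
    have h3 := (hA 2).sg 1 (by norm_num) t ht
    have h4 := hT t ht.1.le
    have h5 : x.v0 t * ff (x.v0 t) ≤ 0 := v_ff_nonpos h4
    have h6 : x.v1 t ≠ 0 := fun h => by rw [h] at h3; simp at h3
    have : 0 < x.v1 t ^ 2 := by positivity
    have := mul_pos hx.pos this
    unfold NN'
    nlinarith [sq_nonneg (x.v2 t)])
  have h3 : ∀ n, 2 ≤ n → NN P x (tt x 2) ≤ |hgt x n| * 30000 := fun n hn => by
    have h4 : NN P x (tt x 2) ≤ NN P x (tt x n) := mono_le (hx.eq.dN) ((hA n).le_of hn le_rfl)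
      (fun t ht => hx.N'_nonneg (hT t (hlt.le.trans ht.1.le)))
    refine h4.trans ?_
    rw [NN_crit (hA n) le_rfl]
    refine (le_abs_self _).trans ?_
    rw [kap, abs_neg, abs_mul, abs_mul, abs_mul, abs_pow, abs_neg, abs_one, one_pow, one_mul, one_mul]
    have := (alt_bd3 hx hA ((hA n).nonneg le_rfl)).2.2
    unfold hgt
    gcongr
  have htt : Tendsto (fun n => tt x n) atTop atTop := by
    refine tendsto_atTop_mono (fun n => (hA n).tt_ge hx le_rfl) ?_
    exact (tendsto_natCast_atTop_atTop).atTop_div_const (by norm_num)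
  have h4 : Tendsto (fun n => |hgt x n| * 30000) atTop (𝓝 (|0| * 30000)) :=
    (h0.comp htt).abs.mul_const _
  simp at h4
  have := ge_of_tendsto h4 (eventually_atTop.2 ⟨2, h3⟩)
  linarith

/-- zero of `kap` contradicts decay -/
theorem kap_ne_zero {P : ℝ} {x : Cur} (hx : IsSol P x) (hA : ∀ n, Alt x n) (h3 : x.v3 0 = 0)
    {T : ℝ} (hT : ∀ t, T ≤ t → x.v0 t ≤ 1) {i : ℕ} (hi : 1 ≤ i) : kap x i ≠ 0 := by
  intro hk
  have h0 := decay_tendsto hx hA hT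
  have hti : 0 < tt x i := by have := (hA i).lt_of (i := 0) (by omega) le_rfl; simpa [tt] using this
  have e1 := fun t => (symm_of hx ((hA i).c1 i le_rfl) (kap_eq_zero.1 hk) t).1
  have h10 : x.v1 0 = 0 := (hA 0).c1 0 le_rfl
  have e2 := fun t => (symm_of hx (T := 0) h10 h3 t).1
  have per : ∀ n : ℕ, x.v0 (n * (2 * tt x i)) = x.v0 0 := by
    intro n
    induction n with
    | zero => simp
    | succ n ih =>
      rw [← ih, ← e2 (n * (2 * tt x i)), ← e1]
      congr 1; push_cast; ring
  have htt : Tendsto (fun n : ℕ => (n : ℝ) * (2 * tt x i)) atTop atTop :=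
    tendsto_natCast_atTop_atTop.atTop_mul_const (by linarith)
  have h4 := h0.comp htt
  have h5 : Tendsto (fun n : ℕ => x.v0 0) atTop (𝓝 0) := h4.congr per
  have h6 := tendsto_nhds_unique h5 tendsto_const_nhds
  have := ((hA 0).even_pos le_rfl (by simp)).1
  simp only [hgt, tt] at this
  linarith



theorem near {P : ℝ} (hP0 : 0 < P) (hP : P < 2) {b : ℝ} (hb : 0 < b) (hb' : b < 3 / 2) {n : ℕ}
    (h : Alt (xa P b) n) : (∀ᶠ a in 𝓝 b, Alt (xa P a) n) ∧
      ∀ i ≤ n, Tendsto (fun a => hgt (xa P a) i) (𝓝 b) (𝓝 (hgt (xa P b) i)) ∧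
        Tendsto (fun a => kap (xa P a) i) (𝓝 b) (𝓝 (kap (xa P b) i)) := by
  have hc : Conv (𝓝 b) (fun a => xa P a) (xa P b) := xa_conv hP0.le hP.le tendsto_id
  have h0 : ∀ᶠ a in 𝓝 b, Alt (xa P a) 0 := by
    filter_upwards [Ioo_mem_nhds hb hb'] with a ha
    exact xa_alt0 ha.1 ha.2
  exact ⟨(perturb hc h0 h).1, fun i hi => perturb_lim hc h0 h hi⟩

theorem hgt_zero (P a : ℝ) : hgt (xa P a) 0 = a := (xa_spec P a).2.1

theorem kap_zero (P a : ℝ) : kap (xa P a) 0 = 0 := by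
  simp [kap, tt, (xa_spec P a).2.2.2.2]

/-- The parameter `A_j`. -/
structure AJ (P : ℝ) (j : ℕ) (A : ℝ) : Prop where
  pos : 0 < A
  le : A ≤ 1
  alt : ∀ a, 0 < a → a ≤ A → Alt (xa P a) (2 * j)
  hle : ∀ a, 0 < a → a ≤ A → ∀ i ≤ 2 * j, Even i → hgt (xa P a) i ≤ 1
  hlt : ∀ a, 0 < a → a < A → ∀ i ≤ 2 * j, Even i → hgt (xa P a) i < 1
  top : hgt (xa P A) (2 * j) = 1

theorem kneg {P : ℝ} (hP0 : 0 < P) (hP : P < 2) {a : ℝ} (ha : 0 < a) (ha' : a ≤ 1) {n : ℕ}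
    (h : Alt (xa P a) n) (hh : ∀ i ≤ n, Even i → hgt (xa P a) i ≤ 1) :
    ∀ i, 1 ≤ i → i ≤ n → kap (xa P a) i < 0 := fun i h1 hi =>
  kap_neg_of_le_one (xa_isSol hP0 hP ha (by linarith)) (xa_spec P a).2.2.2.2 h hi h1
    (fun _ hr => (h.mono hi).v0_le (m := 0) (by omega) zero_le_one (fun l _ hl he => hh l (by omega) he) hr)

theorem AJ.step {P : ℝ} (hP0 : 0 < P) (hP : P < 2) {j : ℕ} {A : ℝ} (h : AJ P j A) {a : ℝ} (ha : 0 < a)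
    (ha' : a ≤ A) : Alt (xa P a) (2 * j + 1) ∧ ∀ i, 1 ≤ i → i ≤ 2 * j + 1 → kap (xa P a) i < 0 := by
  have hx := xa_isSol hP0 hP ha (by linarith [h.le])
  have h1 := h.alt a ha ha'
  have hk : (xa P a).v3 (tt (xa P a) (2 * j)) ≤ 0 := by
    rw [← kap_even (by simp)]
    rcases Nat.eq_zero_or_pos j with h0 | h0
    · subst h0; simp [kap_zero]
    · exact (kneg hP0 hP ha (ha'.trans h.le) h1 (h.hle a ha ha') (2 * j) (by omega) le_rfl).le
  have he : Even (2 * j) := by simp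
  obtain ⟨e1, e2⟩ := h1.even_pos le_rfl he
  obtain ⟨z, t, hz, hzt, -, -, hs, h1t, h0t, h2t⟩ := estep hx e1 (h.hle a ha ha' _ le_rfl he)
    (h1.c1 _ le_rfl) e2 hk
  have hA : Alt (xa P a) (2 * j + 1) := (h1.succ (hz.trans hzt) h1t (by rw [he.neg_one_pow]; linarith)
    (by rw [he.neg_one_pow]; linarith) (by rw [he.neg_one_pow]; simpa using hs)).1
  refine ⟨hA, kneg hP0 hP ha (ha'.trans h.le) hA (fun i hi hei => h.hle a ha ha' i ?_ hei)⟩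
  rcases Nat.lt_or_ge i (2 * j + 1) with h' | h'
  · omega
  · have : i = 2 * j + 1 := by omega
    subst this; exact absurd hei (by simp)

theorem AJ.not_alt {P : ℝ} (hP0 : 0 < P) (hP : P < 2) {j : ℕ} {A : ℝ} (h : AJ P j A) :
    ¬ Alt (xa P A) (2 * j + 2) := by
  intro hA
  have hx := xa_isSol hP0 hP h.pos (by linarith [h.le])
  refine touch_fwd hx hA (by simp) h.top ?_
  rcases Nat.eq_zero_or_pos j with h0 | h0
  · subst h0; simp [kap_zero]
  · exact (kneg hP0 hP h.pos h.le (h.alt A h.pos le_rfl) (h.hle A h.pos le_rfl) (2 * j) (by omega) le_rfl).le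

theorem AJ.next {P : ℝ} (hP0 : 0 < P) (hP : P < 2) {j : ℕ} {A : ℝ} (h : AJ P j A) :
    ∃ A', AJ P (j + 1) A' := by
  set B := {a | 0 < a ∧ a ≤ A ∧ ¬ (Alt (xa P a) (2 * j + 2) ∧ hgt (xa P a) (2 * j + 2) < 1)} with hB
  have hAB : A ∈ B := ⟨h.pos, le_rfl, fun hh => h.not_alt hP0 hP hh.1⟩
  have hBb : BddBelow B := ⟨0, fun a ha => ha.1.le⟩
  set b := sInf B with hb
  have hbA : b ≤ A := csInf_le hBb hAB
  have hb0 : 0 < b := by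
    obtain ⟨δ, hδ, hh⟩ := mem_nhdsGT_iff_exists_Ioo_subset.1 (lemS hP0 hP (2 * j + 2))
    refine lt_of_lt_of_le hδ (le_csInf ⟨A, hAB⟩ fun a ha => ?_)
    by_contra hc
    push Not at hc
    have := hh ⟨ha.1, hc⟩
    exact ha.2.2 ⟨this.1, this.2.2 _ le_rfl⟩
  have hgood : ∀ a, 0 < a → a < b → Alt (xa P a) (2 * j + 2) ∧ hgt (xa P a) (2 * j + 2) < 1 := by
    intro a ha hab
    by_contra hc
    exact absurd (csInf_le hBb (show a ∈ B from ⟨ha, by linarith, hc⟩)) (by linarith)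
  have hle : ∀ a, 0 < a → a < b → ∀ i ≤ 2 * j + 2, Even i → hgt (xa P a) i < 1 := by
    intro a ha hab i hi he
    rcases Nat.lt_or_ge (2 * j) i with h' | h'
    · have : i = 2 * j + 2 := by
        rcases he with ⟨r, hr⟩; omega
      subst this; exact (hgood a ha hab).2
    · exact h.hlt a ha (by linarith) i h' he
  obtain ⟨u, -, hu, hut⟩ := exists_seq_strictMono_tendsto' hb0
  have hbs := xa_isSol hP0 hP hb0 (by linarith [h.le])
  have hAb : Alt (xa P b) (2 * j + 2) := by
    refine Lp (xa_conv hP0.le hP.le hut) (fun k => xa_isSol hP0 hP (hu k).1 (by linarith [h.le, (hu k).2])) hbs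
      (h.step hP0 hP hb0 hbA).1 (fun k => ?_)
    have h1 := (hgood (u k) (hu k).1 (hu k).2).1
    exact ⟨h1, Or.inl (kneg hP0 hP (hu k).1 (by linarith [h.le, (hu k).2]) h1
      (fun i hi he => (hle _ (hu k).1 (hu k).2 i hi he).le) _ (by omega) le_rfl).le⟩
  obtain ⟨hn1, hn2⟩ := near hP0 hP hb0 (by linarith [h.le]) hAb
  have hbA' : b < A := lt_of_le_of_ne hbA (fun e => h.not_alt hP0 hP (e ▸ hAb))
  have hle1 : hgt (xa P b) (2 * j + 2) ≤ 1 :=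
    le_of_tendsto ((hn2 _ le_rfl).1.comp hut) (Eventually.of_forall fun k => (hgood _ (hu k).1 (hu k).2).2.le)
  have htop : hgt (xa P b) (2 * j + 2) = 1 := by
    refine le_antisymm hle1 ?_
    by_contra hc
    push Not at hc
    have hev := hn1.and ((hn2 _ le_rfl).1.eventually_lt_const hc)
    obtain ⟨ε, hε, hh⟩ := Metric.eventually_nhds_iff.1 hev
    obtain ⟨a, haB, hab⟩ := exists_lt_of_csInf_lt ⟨A, hAB⟩ (show sInf B < b + ε by linarith)
    refine haB.2.2 (hh ?_)
    rw [Real.dist_eq, abs_lt]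
    have := csInf_le hBb haB
    constructor <;> linarith
  refine ⟨b, hb0, hbA.trans h.le, fun a ha hab => ?_, fun a ha hab i hi he => ?_, fun a ha hab => ?_, htop⟩
  · rcases lt_or_eq_of_le hab with h' | h'
    · exact (hgood a ha h').1
    · subst h'; exact hAb
  · rcases lt_or_eq_of_le hab with h' | h'
    · exact (hle a ha h' i hi he).le
    · rcases Nat.lt_or_ge (2 * j) i with h'' | h''
      · have : i = 2 * j + 2 := by
          rcases he with ⟨r, hr⟩; omega
        subst this; rw [h']; exact hle1
      · exact h.hle a ha (by linarith) i h'' he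
  · exact hle a ha hab

theorem AJ.ex {P : ℝ} (hP0 : 0 < P) (hP : P < 2) (j : ℕ) : ∃ A, AJ P j A := by
  induction j with
  | zero =>
    refine ⟨1, one_pos, le_rfl, fun a ha ha' => xa_alt0 ha (by linarith), fun a ha ha' i hi he => ?_,
      fun a ha ha' i hi he => ?_, hgt_zero P 1⟩
    · have : i = 0 := by omega
      subst this; rw [hgt_zero]; exact ha'
    · have : i = 0 := by omega
      subst this; rw [hgt_zero]; exact ha'
  | succ j ih => obtain ⟨A, hA⟩ := ih; exact hA.next hP0 hP



theorem near_all {P : ℝ} (hP0 : 0 < P) (hP : P < 2) {b : ℝ} (hb : 0 < b) (hb' : b < 3 / 2) {n : ℕ}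
    (h : Alt (xa P b) n) : ∀ᶠ a in 𝓝 b, Alt (xa P a) n ∧ ∀ i ≤ n,
      (0 < kap (xa P b) i → 0 < kap (xa P a) i) ∧ (kap (xa P b) i < 0 → kap (xa P a) i < 0) ∧
      (hgt (xa P b) i < 1 → hgt (xa P a) i < 1) ∧ (1 < hgt (xa P b) i → 1 < hgt (xa P a) i) := by
  obtain ⟨h1, h2⟩ := near hP0 hP hb hb' h
  have h3 : ∀ i ∈ Finset.range (n + 1), ∀ᶠ a in 𝓝 b,
      (0 < kap (xa P b) i → 0 < kap (xa P a) i) ∧ (kap (xa P b) i < 0 → kap (xa P a) i < 0) ∧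
      (hgt (xa P b) i < 1 → hgt (xa P a) i < 1) ∧ (1 < hgt (xa P b) i → 1 < hgt (xa P a) i) := by
    intro i hi
    obtain ⟨l1, l2⟩ := h2 i (by simpa [Nat.lt_succ_iff] using hi)
    refine Filter.Eventually.and ?_ (Filter.Eventually.and ?_ (Filter.Eventually.and ?_ ?_))
    · by_cases hc : 0 < kap (xa P b) i
      · filter_upwards [l2.eventually_const_lt hc] with a ha _ using ha
      · exact Eventually.of_forall fun a h => absurd h hc
    · by_cases hc : kap (xa P b) i < 0
      · filter_upwards [l2.eventually_lt_const hc] with a ha _ using ha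
      · exact Eventually.of_forall fun a h => absurd h hc
    · by_cases hc : hgt (xa P b) i < 1
      · filter_upwards [l1.eventually_lt_const hc] with a ha _ using ha
      · exact Eventually.of_forall fun a h => absurd h hc
    · by_cases hc : 1 < hgt (xa P b) i
      · filter_upwards [l1.eventually_const_lt hc] with a ha _ using ha
      · exact Eventually.of_forall fun a h => absurd h hc
  filter_upwards [h1, (Finset.eventually_all _).2 h3] with a h4 h5
  exact ⟨h4, fun i hi => h5 i (by simp; omega)⟩

/-- partial data: the first sign change of `kap` after index `n` has not yet occurred before `n+m` -/
structure Qm (P : ℝ) (n m : ℕ) (a : ℝ) : Prop where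
  alt : Alt (xa P a) (n + m)
  D : ∀ i, n ≤ i → i < n + m → 0 < kap (xa P a) i
  ht : ∀ i, n < i → i < n + m → Even i → hgt (xa P a) i < 1

/-- the first index with nonpositive `kap` after `n` is `n+m`, with all heights before below `1` -/
structure Rm (P : ℝ) (n m : ℕ) (a : ℝ) : Prop where
  q : Qm P n m a
  last : kap (xa P a) (n + m) ≤ 0
  z : kap (xa P a) (n + m) = 0 → 1 ≤ m → Even (n + m) → hgt (xa P a) (n + m) < 1

theorem Rm.uniq {P : ℝ} {n m m' : ℕ} {a : ℝ} (h : Rm P n m a) (h' : Rm P n m' a) : m = m' := by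
  rcases Nat.lt_trichotomy m m' with h1 | h1 | h1
  · have := h'.q.D (n + m) (by omega) (by omega); have := h.last; linarith
  · exact h1
  · have := h.q.D (n + m') (by omega) (by omega); have := h'.last; linarith

theorem Rm.isopen_aux {P : ℝ} (hP0 : 0 < P) (hP : P < 2) {j : ℕ} {A : ℝ} (hA : AJ P j A) {m : ℕ} {a : ℝ}
    (ha : 0 < a) (haA : a < A) (h : Rm P (2 * j + 2) m a) : ∀ᶠ a' in 𝓝 a, Rm P (2 * j + 2) m a' ∨
      (kap (xa P a) (2 * j + 2 + m) = 0 ∧ ((1 ≤ m ∧ Rm P (2 * j + 2) (m + 1) a') ∨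
        (m = 0 ∧ (Rm P (2 * j + 2) (2 * j + 2) a' ∨ Rm P (2 * j + 2) (2 * j + 2 + 1) a')))) := by
  have hx := xa_isSol hP0 hP ha (by linarith [hA.le])
  have ha32 : a < 3 / 2 := by linarith [hA.le]
  obtain ⟨hA1, hA2⟩ := hA.step hP0 hP ha haA.le
  have hA3 := hA.hlt a ha haA
  have hnev : Even (2 * j + 2) := ⟨j + 1, by ring⟩
  generalize hN : 2 * j + 2 = n at *
  rcases lt_or_eq_of_le h.last with hneg | h0
  · filter_upwards [near_all hP0 hP ha ha32 h.q.alt] with a' h1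
    refine Or.inl ⟨⟨h1.1, fun i h2 h3 => ((h1.2 i (by omega)).1 (h.q.D i h2 h3)),
      fun i h2 h3 h4 => ((h1.2 i (by omega)).2.2.1 (h.q.ht i h2 h3 h4))⟩, ?_, ?_⟩
    · exact ((h1.2 _ le_rfl).2.1 hneg).le
    · intro h2; have := (h1.2 _ le_rfl).2.1 hneg; linarith
  · rcases Nat.eq_zero_or_pos m with hm | hm
    · subst hm
      simp only [Nat.add_zero] at *
      have hq := h.q.alt
      simp only [Nat.add_zero] at hq
      have h1 := (reflect hx hq h0).1
      have hk := fun i hi => reflect_kap hx hq h0 (i := i) hi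
      have hk0 : kap (xa P a) (2 * n) = 0 := by
        have := (hk n le_rfl).1
        rw [Nat.sub_self, kap_zero, neg_zero] at this
        rw [two_mul]; exact this
      have hpos : ∀ i, n < i → i < 2 * n → 0 < kap (xa P a) i := fun i h2 h3 => by
        have h4 := (hk (i - n) (by omega)).1
        have h5 := hA2 (n - (i - n)) (by omega) (by omega)
        rw [show n + (i - n) = i by omega] at h4
        rw [h4]; linarith
      have hh : ∀ i, n < i → i ≤ 2 * n → Even i → hgt (xa P a) i < 1 := fun i h2 h3 h6 => by
        have h4 := (hk (i - n) (by omega)).2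
        have h5 := hA3 (n - (i - n)) (by rcases h6 with ⟨r, hr⟩; omega) (by
          rcases h6 with ⟨r, hr⟩; exact ⟨2 * j + 2 - r, by omega⟩)
        rw [show n + (i - n) = i by omega] at h4
        rw [h4]; linarith
      have h2 := (reflect hx h1 hk0).1.mono (show 2 * n + 1 ≤ 2 * (2 * n) by omega)
      have hk1 : kap (xa P a) (2 * n + 1) < 0 := by
        rw [(reflect_kap hx h1 hk0 (i := 1) (by omega)).1]
        have := hpos (2 * n - 1) (by omega) (by omega)
        linarith
      filter_upwards [near_all hP0 hP ha ha32 h2] with a' h3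
      rcases le_or_gt (kap (xa P a') n) 0 with h4 | h4
      · left
        exact ⟨⟨h3.1.mono (by omega), fun i _ _ => by omega, fun i _ _ => by omega⟩, h4, fun _ h => by omega⟩
      · right
        refine ⟨h0, Or.inr ⟨trivial, ?_⟩⟩
        have hD : ∀ i, n ≤ i → i < n + n → 0 < kap (xa P a') i := fun i h5 h6 => by
          rcases Nat.eq_or_lt_of_le h5 with h7 | h7
          · subst h7; exact h4
          · exact (h3.2 i (by omega)).1 (hpos i h7 (by omega))
        have hh' : ∀ i, n < i → i ≤ n + n → Even i → hgt (xa P a') i < 1 := fun i h5 h6 h7 =>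
          (h3.2 i (by omega)).2.2.1 (hh i h5 (by omega) h7)
        rcases le_or_gt (kap (xa P a') (n + n)) 0 with h8 | h8
        · left
          exact ⟨⟨h3.1.mono (by omega), hD, fun i h5 h6 h7 => hh' i h5 (by omega) h7⟩, h8,
            fun _ _ h9 => hh' _ (by omega) le_rfl h9⟩
        · right
          have h9 : kap (xa P a') (n + (n + 1)) < 0 := by
            rw [show n + (n + 1) = 2 * n + 1 by omega]
            exact (h3.2 _ (by omega)).2.1 hk1
          refine ⟨⟨h3.1.mono (by omega), fun i h5 h6 => ?_, fun i h5 h6 h7 => hh' i h5 (by omega) h7⟩, h9.le,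
            fun h => by linarith⟩
          rcases Nat.lt_or_ge i (n + n) with h7 | h7
          · exact hD i h5 h7
          · rw [show i = n + n by omega]; exact h8
    · have h1 := (reflect hx h.q.alt h0).1.mono (show n + m + 1 ≤ 2 * (n + m) by omega)
      have hk1 : kap (xa P a) (n + m + 1) < 0 := by
        rw [(reflect_kap hx h.q.alt h0 (i := 1) (by omega)).1]
        have := h.q.D (n + m - 1) (by omega) (by omega)
        linarith
      filter_upwards [near_all hP0 hP ha ha32 h1] with a' h3
      have hD : ∀ i, n ≤ i → i < n + m → 0 < kap (xa P a') i := fun i h5 h6 =>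
        (h3.2 i (by omega)).1 (h.q.D i h5 h6)
      have hh : ∀ i, n < i → i ≤ n + m → Even i → hgt (xa P a') i < 1 := fun i h5 h6 h7 => by
        refine (h3.2 i (by omega)).2.2.1 ?_
        rcases Nat.lt_or_ge i (n + m) with h8 | h8
        · exact h.q.ht i h5 h8 h7
        · have : i = n + m := by omega
          subst this; exact h.z h0 hm h7
      rcases le_or_gt (kap (xa P a') (n + m)) 0 with h8 | h8
      · left
        exact ⟨⟨h3.1.mono (by omega), hD, fun i h5 h6 h7 => hh i h5 (by omega) h7⟩, h8,
            fun _ _ h9 => hh _ (by omega) le_rfl h9⟩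
      · right
        refine ⟨h0, Or.inl ⟨hm, ?_⟩⟩
        have h9 : kap (xa P a') (n + (m + 1)) < 0 := (h3.2 _ (by omega)).2.1 hk1
        refine ⟨⟨h3.1.mono (by omega), fun i h5 h6 => ?_, fun i h5 h6 h7 => hh i h5 (by omega) h7⟩, h9.le,
            fun h => by linarith⟩
        rcases Nat.lt_or_ge i (n + m) with h7 | h7
        · exact hD i h5 h7
        · rw [show i = n + m by omega]; exact h8

/-- everything about the point `b` -/
structure BB (P : ℝ) (j : ℕ) (A b : ℝ) : Prop where
  pos : 0 < b
  lt : b < A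
  reg : ∀ a, 0 < a → a < b → ∃ m, Rm P (2 * j + 2) m a
  nreg : ∀ m, ¬ Rm P (2 * j + 2) m b
  q0 : Qm P (2 * j + 2) 0 b

theorem rm_zero_near {P : ℝ} (hP0 : 0 < P) (hP : P < 2) (n : ℕ) (hn : 1 ≤ n) :
    ∃ δ, 0 < δ ∧ ∀ a, 0 < a → a < δ → Rm P n 0 a := by
  obtain ⟨δ, hδ, hh⟩ := mem_nhdsGT_iff_exists_Ioo_subset.1 (lemS hP0 hP n)
  refine ⟨δ, hδ, fun a h1 h2 => ?_⟩
  obtain ⟨e1, e2, -⟩ := hh ⟨h1, h2⟩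
  exact ⟨⟨e1, fun i _ _ => by omega, fun i _ _ => by omega⟩, (e2 n hn le_rfl).le, fun _ h => by omega⟩

theorem BB.ex {P : ℝ} (hP0 : 0 < P) (hP : P < 2) {j : ℕ} {A : ℝ} (hA : AJ P j A) : ∃ b, BB P j A b := by
  set n := 2 * j + 2 with hn
  set B := {a | 0 < a ∧ a ≤ A ∧ ∀ m, ¬ Rm P n m a} with hB
  have hAB : A ∈ B := ⟨hA.pos, le_rfl, fun m hm => hA.not_alt hP0 hP (hm.q.alt.mono (by omega))⟩
  have hBb : BddBelow B := ⟨0, fun a ha => ha.1.le⟩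
  set b := sInf B with hb
  have hbA : b ≤ A := csInf_le hBb hAB
  have hb0 : 0 < b := by
    obtain ⟨δ, hδ, hh⟩ := rm_zero_near hP0 hP n (by omega)
    refine lt_of_lt_of_le hδ (le_csInf ⟨A, hAB⟩ fun a ha => ?_)
    by_contra hc
    push Not at hc
    exact ha.2.2 0 (hh a ha.1 hc)
  have hreg : ∀ a, 0 < a → a < b → ∃ m, Rm P n m a := by
    intro a h1 h2
    by_contra hc
    push Not at hc
    exact absurd (csInf_le hBb (show a ∈ B from ⟨h1, by linarith, hc⟩)) (by linarith)
  have halt : Alt (xa P b) n := by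
    obtain ⟨u, -, hu, hut⟩ := exists_seq_strictMono_tendsto' hb0
    refine Lp (xa_conv hP0.le hP.le hut) (fun k => xa_isSol hP0 hP (hu k).1 (by linarith [hA.le, (hu k).2]))
      (xa_isSol hP0 hP hb0 (by linarith [hA.le])) (hA.step hP0 hP hb0 hbA).1 (fun k => ?_)
    obtain ⟨m, hm⟩ := hreg (u k) (hu k).1 (hu k).2
    refine ⟨hm.q.alt.mono (by omega), ?_⟩
    rcases Nat.eq_zero_or_pos m with h0 | h0
    · subst h0; exact Or.inl hm.last
    · exact Or.inr (hm.q.alt.mono (by omega))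
  have hlt : b < A := lt_of_le_of_ne hbA (fun e => hA.not_alt hP0 hP (e ▸ halt))
  refine ⟨b, hb0, hlt, hreg, fun m hm => ?_, halt, fun i _ _ => by omega, fun i _ _ => by omega⟩
  have hev := Rm.isopen_aux hP0 hP hA hb0 hlt hm
  obtain ⟨ε, hε, hh⟩ := Metric.eventually_nhds_iff.1 hev
  obtain ⟨a, haB, hab⟩ := exists_lt_of_csInf_lt ⟨A, hAB⟩ (show sInf B < b + ε by linarith)
  have := hh (y := a) (by
    rw [Real.dist_eq, abs_lt]
    have := csInf_le hBb haB
    constructor <;> linarith)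
  rcases this with h | ⟨_, ⟨_, h⟩ | ⟨_, h | h⟩⟩ <;> exact haB.2.2 _ h

def Exit (P : ℝ) (j m : ℕ) (b : ℝ) : Prop :=
  Qm P (2 * j + 2) m b ∧ kap (xa P b) (2 * j + 2 + m) = 0 ∧ 2 ≤ m ∧ Even m ∧
    1 < hgt (xa P b) (2 * j + 2 + m)

theorem BB.left {P : ℝ} {j : ℕ} {A b : ℝ} (h : BB P j A b) (p : ℝ → Prop) (hp : ∀ᶠ a in 𝓝 b, p a) :
    ∃ a, 0 < a ∧ a < b ∧ p a := by
  obtain ⟨ε, hε, hh⟩ := Metric.eventually_nhds_iff.1 hp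
  have := h.pos
  refine ⟨b - min ε b / 2, ?_, ?_, hh ?_⟩
  · have := min_le_right ε b; linarith
  · have := lt_min hε h.pos; linarith
  · rw [Real.dist_eq, abs_lt]
    have := min_le_left ε b
    have := lt_min hε h.pos
    constructor <;> linarith

theorem BB.qstep {P : ℝ} (hP0 : 0 < P) (hP : P < 2) {j : ℕ} {A b : ℝ} (hA : AJ P j A) (h : BB P j A b)
    {m : ℕ} (hq : Qm P (2 * j + 2) m b) : Qm P (2 * j + 2) (m + 1) b ∨ Exit P j m b := by
  have hb32 : b < 3 / 2 := by linarith [hA.le, h.lt]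
  have hx := xa_isSol hP0 hP h.pos hb32.le
  have hnev : Even (2 * j + 2) := ⟨j + 1, by ring⟩
  rcases lt_trichotomy (kap (xa P b) (2 * j + 2 + m)) 0 with h1 | h1 | h1
  · exact absurd ⟨hq, h1.le, fun h2 => by linarith⟩ (h.nreg m)
  · right
    have h2 : 1 ≤ m ∧ Even (2 * j + 2 + m) ∧ 1 ≤ hgt (xa P b) (2 * j + 2 + m) := by
      by_contra hc
      refine h.nreg m ⟨hq, h1.le, fun _ h3 h4 => ?_⟩
      by_contra h5
      exact hc ⟨h3, h4, not_lt.1 h5⟩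
    obtain ⟨h3, h4, h5⟩ := h2
    have h6 : Even m := by rw [Nat.even_add] at h4; exact h4.1 hnev
    refine ⟨hq, h1, ?_, h6, lt_of_le_of_ne h5 fun e => ?_⟩
    · rcases h6 with ⟨r, hr⟩; omega
    · exact touch_rev hx hq.alt le_rfl (by omega) h4 e.symm h1.ge
  · left
    obtain ⟨u, -, hu, hut⟩ := exists_seq_strictMono_tendsto' h.pos
    have hev := hut.eventually (near_all hP0 hP h.pos hb32 hq.alt)
    obtain ⟨N, hN⟩ := eventually_atTop.1 hev
    have key : ∀ k, N ≤ k → ∃ m', m + 1 ≤ m' ∧ Rm P (2 * j + 2) m' (u k) := by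
      intro k hk
      obtain ⟨m', hm'⟩ := h.reg (u k) (hu k).1 (hu k).2
      refine ⟨m', ?_, hm'⟩
      by_contra hc
      have h2 := hm'.last
      have h3 : 0 < kap (xa P (u k)) (2 * j + 2 + m') := by
        refine ((hN k hk).2 _ (by omega)).1 ?_
        rcases Nat.lt_or_ge m' m with h4 | h4
        · exact hq.D _ (by omega) (by omega)
        · rw [show m' = m by omega]; exact h1
      linarith
    have hut' : Tendsto (fun k => u (k + N)) atTop (𝓝 b) := (tendsto_add_atTop_iff_nat N).2 hut
    have halt : Alt (xa P b) (2 * j + 2 + m + 1) := by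
      refine Lp (xa_conv hP0.le hP.le hut') (fun k => xa_isSol hP0 hP (hu _).1 (by linarith [(hu (k + N)).2]))
        hx hq.alt (fun k => ?_)
      obtain ⟨m', h2, h3⟩ := key (k + N) (by omega)
      refine ⟨h3.q.alt.mono (by omega), ?_⟩
      rcases Nat.eq_or_lt_of_le h2 with h4 | h4
      · subst h4; exact Or.inl h3.last
      · exact Or.inr (h3.q.alt.mono (by omega))
    refine ⟨halt, fun i h2 h3 => ?_, fun i h2 h3 h4 => ?_⟩
    · rcases Nat.lt_or_ge i (2 * j + 2 + m) with h5 | h5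
      · exact hq.D i h2 h5
      · rw [show i = 2 * j + 2 + m by omega]; exact h1
    · rcases Nat.lt_or_ge i (2 * j + 2 + m) with h5 | h5
      · exact hq.ht i h2 h5 h4
      · have e : i = 2 * j + 2 + m := by omega
        subst e
        refine lt_of_le_of_ne ?_ (fun e => touch_rev hx hq.alt le_rfl (by omega) h4 e h1.le)
        refine le_of_tendsto (((near hP0 hP h.pos hb32 hq.alt).2 _ le_rfl).1.comp hut') (Eventually.of_forall fun k => ?_)
        obtain ⟨m', h6, h7⟩ := key (k + N) (by omega)
        exact (h7.q.ht _ h2 (by omega) h4).le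

theorem BB.dich {P : ℝ} (hP0 : 0 < P) (hP : P < 2) {j : ℕ} {A b : ℝ} (hA : AJ P j A) (h : BB P j A b) :
    (∀ m, Qm P (2 * j + 2) m b) ∨ ∃ m, Exit P j m b := by
  by_contra hc
  push Not at hc
  obtain ⟨⟨m, hm⟩, h2⟩ := hc
  apply hm
  clear hm
  induction m with
  | zero => exact h.q0
  | succ m ih => exact (h.qstep hP0 hP hA ih).resolve_right (h2 m)

/-- crossing lemma -/
theorem BB.cross {P : ℝ} (hP0 : 0 < P) (hP : P < 2) {j : ℕ} {A b : ℝ} (hA : AJ P j A) (h : BB P j A b)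
    {m : ℕ} (he : Exit P j m b) {m' : ℕ} (h1 : m ≤ m') (h2 : m' < 2 * j + 2) :
    ∃ q, 0 < q ∧ q < A ∧ Rm P (2 * j + 2) m' q ∧ kap (xa P q) (2 * j + 2 + m') = 0 := by
  have hb32 : b < 3 / 2 := by linarith [hA.le, h.lt]
  have hx := xa_isSol hP0 hP h.pos hb32.le
  obtain ⟨hq, hk, hm2, hmev, hh1⟩ := he
  have hreg := h.reg
  have hop := fun {a : ℝ} {m : ℕ} (h1 : 0 < a) (h2 : a < b) (h3 : Rm P (2 * j + 2) m a) =>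
    Rm.isopen_aux hP0 hP hA h1 (h2.trans h.lt) h3
  -- near b from the left
  have hnb : ∀ᶠ a in 𝓝 b, 0 < a → a < b → Rm P (2 * j + 2) m a := by
    have r1 := (reflect hx hq.alt hk).1.mono (show 2 * j + 2 + m + 1 ≤ 2 * (2 * j + 2 + m) by omega)
    have hk1 : kap (xa P b) (2 * j + 2 + m + 1) < 0 := by
      rw [(reflect_kap hx hq.alt hk (i := 1) (by omega)).1]
      have := hq.D (2 * j + 2 + m - 1) (by omega) (by omega)
      linarith
    filter_upwards [near_all hP0 hP h.pos hb32 r1] with a h3 h4 h5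
    obtain ⟨m1, hm1⟩ := h.reg a h4 h5
    have e1 : m ≤ m1 := by
      by_contra hc
      have := (h3.2 (2 * j + 2 + m1) (by omega)).1 (hq.D _ (by omega) (by omega))
      have := hm1.last
      linarith
    have hh := (h3.2 (2 * j + 2 + m) (by omega)).2.2.2 hh1
    have e2 : m1 = m := by
      by_contra hc
      have e3 : Even (2 * j + 2 + m) := by
        exact Even.add ⟨j + 1, by ring⟩ hmev
      have := hm1.q.ht (2 * j + 2 + m) (by omega) (by omega) e3
      linarith
    exact e2 ▸ hm1
  generalize hn : 2 * j + 2 = n at *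
  -- the point z
  set S := {a | 0 < a ∧ a < b ∧ Rm P n 0 a} with hS
  obtain ⟨δ, hδ, hδ'⟩ := rm_zero_near hP0 hP n (by omega)
  have hSne : min δ b / 2 ∈ S := by
    have := lt_min hδ h.pos
    have := min_le_left δ b
    have := min_le_right δ b
    exact ⟨by linarith, by linarith, hδ' _ (by linarith) (by linarith)⟩
  have hSb : BddAbove S := ⟨b, fun a ha => ha.2.1.le⟩
  set z := sSup S with hz
  have hz0 : 0 < z := lt_of_lt_of_le hSne.1 (le_csSup hSb hSne)
  have hzb : z < b := by
    obtain ⟨ε, hε, hh⟩ := Metric.eventually_nhds_iff.1 hnb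
    refine lt_of_le_of_lt (csSup_le ⟨_, hSne⟩ (fun a ha => ?_)) (show b - ε / 2 < b by linarith)
    by_contra hc
    push Not at hc
    have := hh (y := a) (by rw [Real.dist_eq, abs_lt]; constructor <;> linarith [ha.2.1]) ha.1 ha.2.1
    have := this.uniq ha.2.2
    omega
  have hzR : ∀ a, z < a → a < b → ∀ k, Rm P n k a → 1 ≤ k := by
    intro a h3 h4 k hk'
    by_contra hc
    have : k = 0 := by omega
    subst this
    exact absurd (le_csSup hSb (show a ∈ S from ⟨by linarith, h4, hk'⟩)) (by linarith)
  obtain ⟨mz, hmz⟩ := hreg z hz0 hzb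
  obtain ⟨ε, hε, hh⟩ := Metric.eventually_nhds_iff.1 (hop hz0 hzb hmz)
  have hmz0 : mz = 0 := by
    obtain ⟨a, haS, hab⟩ := exists_lt_of_lt_csSup ⟨_, hSne⟩ (show z - ε < sSup S by linarith)
    have h3 := hh (y := a) (by
      rw [Real.dist_eq, abs_lt]
      have := le_csSup hSb haS
      constructor <;> linarith)
    rcases h3 with h3 | ⟨_, ⟨h4, h3⟩ | ⟨h4, _⟩⟩
    · exact h3.uniq haS.2.2
    · have := h3.uniq haS.2.2; omega
    · exact h4
  have hright : ∀ a, z < a → a < b → a < z + ε → ∀ k, Rm P n k a → n ≤ k := by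
    intro a h3 h4 h5 k hk'
    have h6 := hzR a h3 h4 k hk'
    have h7 := hh (y := a) (by rw [Real.dist_eq, abs_lt]; constructor <;> linarith)
    rcases h7 with h7 | ⟨_, ⟨h8, _⟩ | ⟨_, h7 | h7⟩⟩
    · have := h7.uniq hk'; omega
    · omega
    · have := h7.uniq hk'; omega
    · have := h7.uniq hk'; omega
  -- the point q
  set U := {a | z < a ∧ a < b ∧ ∃ k ≤ m', Rm P n k a} with hU
  have hUb : BddBelow U := ⟨z, fun a ha => ha.1.le⟩
  obtain ⟨a0, ha0⟩ : ∃ a0, a0 ∈ U := by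
    obtain ⟨a, ha, hab, h3, h4⟩ := h.left (fun a => (0 < a → a < b → Rm P n m a) ∧ z < a)
      (hnb.and (lt_mem_nhds hzb))
    exact ⟨a, h4, hab, m, h1, h3 ha hab⟩
  set q := sInf U with hqd
  have hqb : q < b := lt_of_le_of_lt (csInf_le hUb ha0) ha0.2.1
  have hzq : z < q := by
    refine lt_of_lt_of_le (show z < z + ε by linarith) (le_csInf ⟨_, ha0⟩ fun a ha => ?_)
    by_contra hc
    push Not at hc
    obtain ⟨k, hk1, hk2⟩ := ha.2.2
    have := hright a ha.1 ha.2.1 hc k hk2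
    omega
  have hq0 : 0 < q := hz0.trans hzq
  obtain ⟨μ, hμ⟩ := hreg q hq0 hqb
  have hμ1 := hzR q hzq hqb μ hμ
  obtain ⟨η, hη, hh2⟩ := Metric.eventually_nhds_iff.1 (hop hq0 hqb hμ)
  obtain ⟨a, haU, haq⟩ := exists_lt_of_csInf_lt ⟨_, ha0⟩ (show sInf U < q + η by linarith)
  have haq' := csInf_le hUb haU
  have f1 := hh2 (y := a) (by rw [Real.dist_eq, abs_lt]; constructor <;> linarith)
  set c := max ((z + q) / 2) (q - η / 2) with hc
  have hc1 : z < c := lt_of_lt_of_le (by linarith) (le_max_left _ _)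
  have hc2 : c < q := max_lt (by linarith) (by linarith)
  have hc3 : q - η / 2 ≤ c := le_max_right _ _
  have f2 := hh2 (y := c) (by rw [Real.dist_eq, abs_lt]; constructor <;> linarith)
  have hcU : ∀ k, Rm P n k c → m' < k := by
    intro k hk'
    by_contra hcc
    exact absurd (csInf_le hUb (show c ∈ U from ⟨hc1, hc2.trans hqb, k, not_lt.1 hcc, hk'⟩)) (by linarith)
  obtain ⟨k, hk1, hk2⟩ := haU.2.2
  have g1 : μ ≤ m' := by
    rcases f1 with f | ⟨_, ⟨_, f⟩ | ⟨f, _⟩⟩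
    · have := f.uniq hk2; omega
    · have := f.uniq hk2; omega
    · omega
  rcases f2 with f | ⟨f0, ⟨_, f⟩ | ⟨f, _⟩⟩
  · have := hcU _ f; omega
  · have := hcU _ f
    have e : μ = m' := by omega
    subst e
    exact ⟨q, hq0, hqb.trans h.lt, hμ, f0⟩
  · omega



theorem bd_of {P : ℝ} {x : Cur} (hx : IsSol P x) (hA : ∀ n, Alt x n) {M : ℕ}
    (h : ∀ i, M ≤ i → Even i → hgt x i ≤ 1) {t : ℝ} (ht : tt x M ≤ t) : x.v0 t ≤ 1 := by
  obtain ⟨n, hn⟩ := exists_nat_gt (3 * t)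
  have h1 := (hA (n + M)).tt_ge hx le_rfl
  have h2 : (0 : ℝ) ≤ M := Nat.cast_nonneg M
  push_cast at h1
  exact (hA (n + M)).v0_le (m := M) (by omega) zero_le_one (fun i h3 _ h4 => h i h3 h4) ⟨ht, by linarith⟩

structure Good (P e : ℝ) (p : ℕ) : Prop where
  pos : 0 < e
  lt : e < 3 / 2
  alt : ∀ n, Alt (xa P e) n
  neg : ∀ i, 1 ≤ i → i ≤ p → kap (xa P e) i ≤ 0
  nonneg : ∀ i, p < i → 0 ≤ kap (xa P e) i
  ht : ∀ i, p + 2 ≤ i → Even i → hgt (xa P e) i ≤ 1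

theorem Good.bd {P e : ℝ} {p : ℕ} (hP0 : 0 < P) (hP : P < 2) (h : Good P e p) :
    ∀ t, tt (xa P e) (p + 2) ≤ t → (xa P e).v0 t ≤ 1 := fun _ ht =>
  bd_of (xa_isSol hP0 hP h.pos h.lt.le) h.alt h.ht ht

theorem Good.uniq {P e : ℝ} {p q : ℕ} (hP0 : 0 < P) (hP : P < 2) (h : Good P e p) (h' : Good P e q) :
    p = q := by
  have key : ∀ {p q : ℕ}, Good P e p → Good P e q → ¬ p < q := by
    intro p q h h' hpq
    exact kap_ne_zero (xa_isSol hP0 hP h.pos h.lt.le) h.alt (xa_spec P e).2.2.2.2 (h.bd hP0 hP) (i := q) (by omega)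
      (le_antisymm (h'.neg q (by omega) le_rfl) (h.nonneg q hpq))
  have := key h h'
  have := key h' h
  omega

theorem translate {P : ℝ} (hP0 : 0 < P) (hP : P < 2) {a : ℝ} (ha : 0 < a) (ha' : a ≤ 3 / 2) {N : ℕ}
    (hN : Even N) (h : Alt (xa P a) N) (hk : kap (xa P a) N = 0) :
    0 < hgt (xa P a) N ∧ hgt (xa P a) N < 3 / 2 ∧ Alt (xa P (hgt (xa P a) N)) N ∧
      ∀ l ≤ N, kap (xa P (hgt (xa P a) N)) l = - kap (xa P a) (N - l) ∧
        hgt (xa P (hgt (xa P a) N)) l = hgt (xa P a) (N - l) := by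
  have hx := xa_isSol hP0 hP ha ha'
  have h1 := (reflect hx h hk).1
  rw [two_mul] at h1
  rw [← shift_eq_xa hx h hN hk]
  refine ⟨(h.even_pos le_rfl hN).1, h.hgt_lt hx le_rfl, (shift_alt h1 hN).1, fun l hl => ?_⟩
  obtain ⟨e1, e2⟩ := shift_kap h1 hN hl
  obtain ⟨e3, e4⟩ := reflect_kap hx h hk hl
  exact ⟨by rw [e1, e3], by rw [e2, e4]⟩

theorem lim_alt {P : ℝ} (hP0 : 0 < P) (hP : P < 2) {e : ℕ → ℝ} {ε : ℝ} (he : Tendsto e atTop (𝓝 ε))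
    (hr : ∀ k, 0 < e k ∧ e k < 3 / 2) (hε : 0 < ε) (halt : ∀ N, ∀ᶠ k in atTop, Alt (xa P (e k)) N) :
    ε < 3 / 2 ∧ ∀ N, Alt (xa P ε) N := by
  have hs := fun k => xa_isSol hP0 hP (hr k).1 (hr k).2.le
  have hle : ε ≤ 3 / 2 := le_of_tendsto he (Eventually.of_forall fun k => (hr k).2.le)
  have hc := xa_conv hP0.le hP.le he
  have hlt : ε < 3 / 2 := by
    refine lt_of_le_of_ne hle fun h32 => ?_
    obtain ⟨f0, f1, f2, f3, f4⟩ := xa_spec P ε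
    obtain ⟨δ, hδ, hh⟩ := top_fwd f0 (q := 0) f2 (by rw [f3, h32]; norm_num) (by rw [f1, h32]) f4.ge
    have hm := lt_min hδ (show (0 : ℝ) < 1 / 3 by norm_num)
    have hm1 := min_le_left δ (1 / 3 : ℝ)
    have hm2 := min_le_right δ (1 / 3 : ℝ)
    set t := min δ (1 / 3 : ℝ) / 2 with ht
    have h1 := hh t ⟨by linarith, by linarith⟩
    have h2 : (xa P ε).v1 t ≤ 0 := by
      refine le_of_tendsto (hc.tendsto (tendsto_const_nhds (x := t)) (Eventually.of_forall fun _ => by linarith)).2.1 ?_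
      filter_upwards [halt 1] with k hk
      have h3 := hk.gap (hs k) (i := 0) one_pos
      have h4 := hk.sg 0 one_pos t ⟨by simp only [tt]; linarith, by simp only [tt] at *; linarith⟩
      rw [pow_zero, one_mul] at h4
      exact h4.le
    linarith
  refine ⟨hlt, fun N => ?_⟩
  induction N with
  | zero => exact xa_alt0 hε hlt
  | succ N ih =>
    obtain ⟨K, hK⟩ := eventually_atTop.1 (halt (N + 2))
    have he' : Tendsto (fun k => e (k + K)) atTop (𝓝 ε) := (tendsto_add_atTop_iff_nat K).2 he
    refine Lp (xa_conv hP0.le hP.le he') (fun k => hs _) (xa_isSol hP0 hP hε hle) ih (fun k => ?_)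
    have := hK (k + K) (by omega)
    exact ⟨this.mono (by omega), Or.inr this⟩

theorem cpt_lim {P : ℝ} (hP0 : 0 < P) (hP : P < 2) {δ : ℝ} (hδ : 0 < δ) (s : ℕ → ℝ) (M : ℕ)
    (h : ∀ N, ∃ e, δ ≤ e ∧ e < 3 / 2 ∧ Alt (xa P e) N ∧ (∀ l, 1 ≤ l → l ≤ N → 0 ≤ s l * kap (xa P e) l) ∧
      ∀ l, M ≤ l → l ≤ N → Even l → hgt (xa P e) l ≤ 1) :
    ∃ e, 0 < e ∧ e < 3 / 2 ∧ (∀ N, Alt (xa P e) N) ∧ (∀ l, 1 ≤ l → 0 ≤ s l * kap (xa P e) l) ∧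
      ∀ l, M ≤ l → Even l → hgt (xa P e) l ≤ 1 := by
  choose e h1 h2 h3 h4 h5 using h
  obtain ⟨ε, hε, u, hu, hut⟩ := (isCompact_Icc (a := δ) (b := 3 / 2)).tendsto_subseq
    (x := e) (fun n => ⟨h1 n, (h2 n).le⟩)
  have hε0 : 0 < ε := lt_of_lt_of_le hδ hε.1
  have hge : ∀ N, ∀ᶠ k in atTop, N ≤ u k := fun N => hu.tendsto_atTop.eventually_ge_atTop N
  obtain ⟨g1, g2⟩ := lim_alt hP0 hP hut (fun k => ⟨lt_of_lt_of_le hδ (h1 _), h2 _⟩) hε0 (fun N => by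
    filter_upwards [hge N] with k hk
    exact (h3 (u k)).mono hk)
  refine ⟨ε, hε0, g1, g2, fun l hl => ?_, fun l hl he => ?_⟩
  · refine ge_of_tendsto ((((near hP0 hP hε0 g1 (g2 l)).2 l le_rfl).2.comp hut).const_mul (s l)) ?_
    filter_upwards [hge l] with k hk
    exact h4 (u k) l hl hk
  · refine le_of_tendsto (((near hP0 hP hε0 g1 (g2 l)).2 l le_rfl).1.comp hut) ?_
    filter_upwards [hge l] with k hk
    exact h5 (u k) l hl hk he

theorem case_good {P : ℝ} (hP0 : 0 < P) (hP : P < 2) {j : ℕ} {A b : ℝ} (hA : AJ P j A) (h : BB P j A b)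
    (hq : ∀ m, Qm P (2 * j + 2) m b) : Good P b (2 * j + 1) := by
  refine ⟨h.pos, by linarith [h.lt, hA.le], fun n => (hq n).alt.mono (by omega), fun i h1 h2 => ?_,
    fun i h1 => ?_, fun i h1 h2 => ?_⟩
  · exact ((hA.step hP0 hP h.pos h.lt.le).2 i h1 h2).le
  · exact ((hq (i + 1)).D i (by omega) (by omega)).le
  · exact ((hq (i + 1)).ht i (by omega) (by omega) h2).le

theorem case_inf {P : ℝ} (hP0 : 0 < P) (hP : P < 2)
    (h : ∀ N, ∃ j A b m, AJ P j A ∧ BB P j A b ∧ Exit P j m b ∧ N < m) : False := by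
  obtain ⟨e, h0, h1, h2, h3, h4⟩ := cpt_lim hP0 hP one_pos (fun _ => -1) 1 (by
    intro N
    obtain ⟨j, A, b, m, hA, hB, ⟨hq, hk, hm2, hme, hh⟩, hN⟩ := h N
    have hev : Even (2 * j + 2 + m) := Even.add ⟨j + 1, by ring⟩ hme
    obtain ⟨t1, t2, t3, t4⟩ := translate hP0 hP hB.pos (by linarith [hA.le, hB.lt]) hev hq.alt hk
    refine ⟨_, hh.le, t2, t3.mono (by omega), fun l h1 h2 => ?_, fun l h1 h2 h3 => ?_⟩
    · rw [(t4 l (by omega)).1]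
      have := hq.D (2 * j + 2 + m - l) (by omega) (by omega)
      linarith
    · rw [(t4 l (by omega)).2]
      exact (hq.ht _ (by omega) (by omega) ((Nat.even_sub (by omega)).2 (by simp [hev, h3]))).le)
  refine no_all_neg (xa_isSol hP0 hP h0 h1.le) h2 (fun t ht => bd_of (xa_isSol hP0 hP h0 h1.le) h2 h4 ht) ?_
  have := h3 1 le_rfl
  linarith

theorem case_bdd {P : ℝ} (hP0 : 0 < P) (hP : P < 2) {μ : ℕ} (hμe : Even μ)
    (h : ∀ J, ∃ j A b m, AJ P j A ∧ BB P j A b ∧ Exit P j m b ∧ m ≤ μ ∧ J ≤ j) : ∃ e, Good P e μ := by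
  obtain ⟨δ, hδ, hS⟩ := mem_nhdsGT_iff_exists_Ioo_subset.1 (lemS hP0 hP (μ + 1))
  obtain ⟨e, h0, h1, h2, h3, h4⟩ := cpt_lim hP0 hP hδ (fun l => if l ≤ μ then -1 else 1) (μ + 2) (by
    intro N
    obtain ⟨j, A, b, m, hA, hB, he, hm, hJ⟩ := h (N + μ + 1)
    obtain ⟨q, hq0, hqA, hq, hk⟩ := hB.cross hP0 hP hA he hm (by omega)
    have hev : Even (2 * j + 2 + μ) := Even.add ⟨j + 1, by ring⟩ hμe
    obtain ⟨t1, t2, t3, t4⟩ := translate hP0 hP hq0 (by linarith [hA.le, hB.lt]) hev hq.q.alt hk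
    have hneg := (hA.step hP0 hP hq0 hqA.le).2
    refine ⟨_, ?_, t2, t3.mono (by omega), fun l h1 h2 => ?_, fun l h1 h2 h3 => ?_⟩
    · by_contra hc
      push Not at hc
      have h5 := (hS ⟨t1, hc⟩).2.1 (μ + 1) (by omega) le_rfl
      rw [(t4 (μ + 1) (by omega)).1] at h5
      have := hneg (2 * j + 2 + μ - (μ + 1)) (by omega) (by omega)
      linarith
    · rw [(t4 l (by omega)).1]
      split_ifs with hl
      · have := hq.q.D (2 * j + 2 + μ - l) (by omega) (by omega)
        linarith
      · have := hneg (2 * j + 2 + μ - l) (by omega) (by omega)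
        linarith
    · rw [(t4 l (by omega)).2]
      exact (hA.hlt q hq0 hqA _ (by omega) ((Nat.even_sub (by omega)).2 (by simp [hev, h3]))).le)
  refine ⟨e, h0, h1, h2, fun i h5 h6 => ?_, fun i h5 => ?_, h4⟩
  · have := h3 i h5
    simp only [h6, if_true] at this
    linarith
  · have := h3 i (by omega)
    rw [if_neg (by omega)] at this
    linarith

theorem many_good {P : ℝ} (hP0 : 0 < P) (hP : P < 2) (p0 : ℕ) : ∃ p, p0 ≤ p ∧ ∃ e, Good P e p := by
  by_contra hc
  push Not at hc
  have hex : ∀ j, p0 ≤ j → ∃ A b m, AJ P j A ∧ BB P j A b ∧ Exit P j m b := by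
    intro j hj
    obtain ⟨A, hA⟩ := AJ.ex hP0 hP j
    obtain ⟨b, hb⟩ := BB.ex hP0 hP hA
    rcases hb.dich hP0 hP hA with h | ⟨m, hm⟩
    · exact absurd (case_good hP0 hP hA hb h) (hc (2 * j + 1) (by omega) b)
    · exact ⟨A, b, m, hA, hb, hm⟩
  refine case_inf hP0 hP fun N => ?_
  by_contra hN
  push Not at hN
  obtain ⟨e, he⟩ := case_bdd hP0 hP (μ := 2 * (N + p0)) (by simp) (fun J => by
    obtain ⟨A, b, m, h1, h2, h3⟩ := hex (max J p0) (le_max_right _ _)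
    have := hN _ A b m h1 h2 h3
    exact ⟨max J p0, A, b, m, h1, h2, h3, by omega, le_max_left _ _⟩)
  exact hc _ (by omega) e he

theorem good_seq {P : ℝ} (hP0 : 0 < P) (hP : P < 2) : ∃ e : ℕ → ℝ, Function.Injective e ∧
    ∀ k, ∃ p, Good P (e k) p := by
  have hinf : {p | ∃ e, Good P e p}.Infinite := by
    refine Set.infinite_of_not_bddAbove ?_
    rintro ⟨B, hB⟩
    obtain ⟨p, h1, h2⟩ := many_good hP0 hP (B + 1)
    have := hB h2
    omega
  let f := hinf.natEmbedding
  refine ⟨fun k => Classical.choose (f k).2, fun k l hkl => ?_, fun k => ⟨(f k).1, Classical.choose_spec (f k).2⟩⟩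
  have h1 := Classical.choose_spec (f k).2
  have h2 := Classical.choose_spec (f l).2
  simp only at hkl
  rw [← hkl] at h2
  exact f.injective (Subtype.ext (h1.uniq hP0 hP h2))



theorem smooth_of {P : ℝ} {x : Cur} (h : SolEq P x) (hf : ∀ t, ff (x.v0 t) = x.v0 t ^ 2 - x.v0 t) (n : ℕ) :
    ContDiff ℝ n x.v0 ∧ ContDiff ℝ n x.v1 ∧ ContDiff ℝ n x.v2 ∧ ContDiff ℝ n x.v3 := by
  induction n with
  | zero =>
    simp only [Nat.cast_zero, contDiff_zero]
    exact ⟨x.c0, x.c1, x.c2, x.c3⟩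
  | succ n ih =>
    obtain ⟨i0, i1, i2, i3⟩ := ih
    have step : ∀ f f' : ℝ → ℝ, (∀ t, HasDerivAt f (f' t) t) → ContDiff ℝ n f' → ContDiff ℝ ((n + 1 : ℕ)) f := by
      intro f f' h1 h2
      have e : deriv f = f' := funext fun t => (h1 t).deriv
      push_cast
      rw [contDiff_succ_iff_deriv]
      refine ⟨fun t => (h1 t).differentiableAt, fun h => ?_, by rw [e]; exact h2⟩
      exact absurd h (by simp)
    refine ⟨step _ _ x.d0 i1, step _ _ x.d1 i2, step _ _ x.d2 i3, step _ _ h ?_⟩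
    simp only [hf]
    exact (contDiff_const.mul i2).add ((i0.pow 2).sub i0)

theorem good_final {c : ℝ} (hc : 1 / 4 < c) {e : ℝ} {p : ℕ} (hg : Good (1 / √c) e p) (φ : ℝ → ℝ)
    (hφ : ∀ z, φ z = c * (xa (1 / √c) e).v0 (√√c * z)) :
    ContDiff ℝ (⊤ : ℕ∞) φ ∧ (∀ z : ℝ, φ (-z) = φ z) ∧ φ ≠ 0 ∧
        (∀ z : ℝ, iteratedDeriv 4 φ z - iteratedDeriv 2 φ z + c * φ z = (φ z) ^ 2) ∧
        ∃ C κ : ℝ, 0 < C ∧ 0 < κ ∧ ∀ z : ℝ, |φ z| ≤ C * Real.exp (-κ * |z|) := by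
  have hc0 : 0 < c := by linarith
  set r := √c with hr
  have hr0 : 0 < r := Real.sqrt_pos.2 hc0
  have hr2 : r ^ 2 = c := Real.sq_sqrt hc0.le
  have hrh : 1 / 2 < r := by
    by_contra h; push Not at h; nlinarith
  set L := √r with hL
  have hL0 : 0 < L := Real.sqrt_pos.2 hr0
  have hL2 : L ^ 2 = r := Real.sq_sqrt hr0.le
  set P := 1 / r with hPd
  have hP0 : 0 < P := by positivity
  have hP2 : P < 2 := by rw [hPd, div_lt_iff₀ hr0]; linarith
  set x := xa P e with hx
  have hs : IsSol P x := xa_isSol hP0 hP2 hg.pos hg.lt.le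
  obtain ⟨-, s0, s1, -, s3⟩ := xa_spec P e
  have hev : ∀ t, x.v0 (-t) = x.v0 t := fun t => by
    have := (symm_of hs (T := 0) s1 s3 t).1
    rwa [mul_zero, zero_sub] at this
  have hbd : ∀ t, -(3 / 5) ≤ x.v0 t ∧ x.v0 t ≤ 3 / 2 := fun t => by
    rcases le_total 0 t with h | h
    · exact alt_bd hs hg.alt h
    · rw [← hev]; exact alt_bd hs hg.alt (by linarith)
  have hf : ∀ t, ff (x.v0 t) = x.v0 t ^ 2 - x.v0 t := fun t =>
    ff_mid (by linarith [(hbd t).1]) (by linarith [(hbd t).2])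
  have hφe : φ = fun z => c * x.v0 (L * z) := funext hφ
  have hl : ∀ z, HasDerivAt (fun z => L * z) L z := fun z => by simpa using (hasDerivAt_id z).const_mul L
  have ch : ∀ (f f' : ℝ → ℝ) (k : ℝ), (∀ t, HasDerivAt f (f' t) t) →
      deriv (fun z => k * f (L * z)) = fun z => (k * L) * f' (L * z) := by
    intro f f' k h
    funext z
    have := ((h (L * z)).comp z (hl z)).const_mul k
    refine HasDerivAt.deriv (hd_cg this (fun _ => rfl) (by ring))
  have d1 : iteratedDeriv 1 φ = fun z => (c * L) * x.v1 (L * z) := by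
    rw [iteratedDeriv_one, hφe, ch _ _ _ x.d0]
  have d2 : iteratedDeriv 2 φ = fun z => (c * L * L) * x.v2 (L * z) := by
    rw [iteratedDeriv_succ, d1, ch _ _ _ x.d1]
  have d3 : iteratedDeriv 3 φ = fun z => (c * L * L * L) * x.v3 (L * z) := by
    rw [iteratedDeriv_succ, d2, ch _ _ _ x.d2]
  have d4 : iteratedDeriv 4 φ = fun z => (c * L * L * L * L) * (P * x.v2 (L * z) + ff (x.v0 (L * z))) := by
    rw [iteratedDeriv_succ, d3, ch _ (fun t => P * x.v2 t + ff (x.v0 t)) _ hs.eq]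
  obtain ⟨C, k, hC, hk, hdec⟩ := decay hs hg.alt (hg.bd hP0 hP2)
  refine ⟨?_, fun z => ?_, fun h => ?_, fun z => ?_, c * C, k * L, by positivity, by positivity, fun z => ?_⟩
  · refine contDiff_infty.2 fun n => ?_
    rw [hφe]
    exact contDiff_const.mul ((smooth_of hs.eq hf n).1.comp (contDiff_const.mul contDiff_id))
  · rw [hφ, hφ, mul_neg, hev]
  · have := congrFun h 0
    rw [hφ, mul_zero, s0] at this
    have h2 := mul_pos hc0 hg.pos
    simp only [Pi.zero_apply] at this
    linarith
  · rw [d4, d2, hφ]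
    simp only
    rw [hf]
    have e4 : c * L * L * L * L = c * c := by
      have : c * L * L * L * L = c * (L ^ 2) ^ 2 := by ring
      rw [this, hL2, hr2]
    have e2 : c * L * L = c * r := by rw [← hL2]; ring
    have e3 : c * c * P = c * r := by rw [hPd, ← hr2]; field_simp
    rw [e4, e2]
    linear_combination x.v2 (L * z) * e3
  · rw [hφ, abs_mul, abs_of_pos hc0]
    have h1 : x.v0 (L * z) = x.v0 (L * |z|) := by
      rcases abs_choice z with h | h <;> rw [h]
      rw [mul_neg, hev]
    rw [h1]
    have h2 := hdec (L * |z|) (by positivity)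
    calc c * |x.v0 (L * |z|)| ≤ c * (C * exp (-k * (L * |z|))) := by gcongr
      _ = c * C * exp (-(k * L) * |z|) := by rw [mul_assoc]; congr 3; ring

theorem main_pulse (c : ℝ) (hc : 1 / 4 < c) :
    ∃ φ : ℕ → ℝ → ℝ, Function.Injective φ ∧ ∀ n : ℕ,
        ContDiff ℝ (⊤ : ℕ∞) (φ n) ∧ (∀ z : ℝ, φ n (-z) = φ n z) ∧ φ n ≠ 0 ∧
        (∀ z : ℝ, iteratedDeriv 4 (φ n) z - iteratedDeriv 2 (φ n) z + c * φ n z = (φ n z) ^ 2) ∧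
        ∃ C κ : ℝ, 0 < C ∧ 0 < κ ∧ ∀ z : ℝ, |φ n z| ≤ C * Real.exp (-κ * |z|) := by
  have hc0 : 0 < c := by linarith
  have hr0 : 0 < √c := Real.sqrt_pos.2 hc0
  have hr2 : √c ^ 2 = c := Real.sq_sqrt hc0.le
  have hrh : 1 / 2 < √c := by
    by_contra h; push Not at h; nlinarith
  obtain ⟨e, he, hg⟩ := good_seq (P := 1 / √c) (by positivity) (by rw [div_lt_iff₀ hr0]; linarith)
  refine ⟨fun n z => c * (xa (1 / √c) (e n)).v0 (√√c * z), fun n m h => he ?_, fun n => ?_⟩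
  · have := congrFun h 0
    simp only [mul_zero, (xa_spec _ _).2.1] at this
    exact mul_left_cancel₀ hc0.ne' this
  · obtain ⟨p, hp⟩ := hg n
    exact good_final hc hp _ (fun _ => rfl)



end Pulse


/-- For every `c > 1/4` there are infinitely many pairwise distinct multi-pulse
solutions of the traveling-wave ODE `φ⁗ - φ″ + c·φ = φ²`: there is an injective
sequence of smooth, even, nontrivial, exponentially decaying solutions. -/
theorem exists_infinitely_many_pulse_solutions (c : ℝ) (hc : 1 / 4 < c) :
    ∃ φ : ℕ → ℝ → ℝ,
      Function.Injective φ ∧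
      ∀ n : ℕ,
        ContDiff ℝ (⊤ : ℕ∞) (φ n) ∧
        (∀ z : ℝ, φ n (-z) = φ n z) ∧
        φ n ≠ 0 ∧
        (∀ z : ℝ,
          iteratedDeriv 4 (φ n) z - iteratedDeriv 2 (φ n) z + c * φ n z = (φ n z) ^ 2) ∧
        ∃ C κ : ℝ, 0 < C ∧ 0 < κ ∧ ∀ z : ℝ, |φ n z| ≤ C * Real.exp (-κ * |z|) := by
  exact Pulse.main_pulse c hc
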